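/- arXiv:1009.3588 — 5 statements merged into one kernel-verified Lean document; each statement's English description precedes it below -/
import Mathlib

section
/- Suppose f(x,y) ∈ ℝ[x,y] is non-negative on the strip [0,1] × ℝ. Then there exist sums of squares σ(x,y), τ(x,y) ∈ Σℝ[x,y]² such that f(x,y) = σ(x,y) + τ(x,y)·(x − x²). -/
namespace Strip
open Polynomial

def InM (f : ℝ[X][X]) : Prop :=
  ∃ σ τ : ℝ[X][X], IsSumSq σ ∧ IsSumSq τ ∧ f = σ + τ * C (X - X ^ 2)

lemma InM.of_sumSq {f : ℝ[X][X]} (h : IsSumSq f) : InM f :=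
  ⟨f, 0, h, IsSumSq.zero, by simp⟩

lemma InM.sq (f : ℝ[X][X]) : InM (f ^ 2) := .of_sumSq (by rw [pow_two]; exact .mul_self f)

lemma InM.zero : InM 0 := .of_sumSq .zero
lemma InM.one : InM 1 := .of_sumSq .one

lemma InM.add {f g : ℝ[X][X]} : InM f → InM g → InM (f + g) := by
  rintro ⟨a, b, ha, hb, rfl⟩ ⟨c, d, hc, hd, rfl⟩
  exact ⟨a + c, b + d, ha.add hc, hb.add hd, by ring⟩

lemma isSumSq_sq {R : Type*} [CommRing R] (a : R) : IsSumSq (a ^ 2) := by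
  rw [pow_two]; exact .mul_self a

lemma InM.mul {f g : ℝ[X][X]} : InM f → InM g → InM (f * g) := by
  rintro ⟨a, b, ha, hb, rfl⟩ ⟨c, d, hc, hd, rfl⟩
  refine ⟨a * c + b * d * (C (X - X ^ 2)) ^ 2, a * d + b * c, ?_, ?_, by ring⟩
  · exact (ha.mul hc).add ((hb.mul hd).mul (isSumSq_sq _))
  · exact (ha.mul hd).add (hb.mul hc)

lemma InM.pow {f : ℝ[X][X]} (h : InM f) (n : ℕ) : InM (f ^ n) := by
  induction n with
  | zero => simpa using InM.one
  | succ n ih => rw [pow_succ]; exact ih.mul h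

lemma InM.sum {ι : Type*} (s : Finset ι) (f : ι → ℝ[X][X]) (h : ∀ i ∈ s, InM (f i)) :
    InM (∑ i ∈ s, f i) := by
  classical
  induction s using Finset.induction_on with
  | empty => simpa using InM.zero
  | insert a s ha ih =>
    rw [Finset.sum_insert ha]
    exact (h a (by simp)).add (ih fun i hi => h i (by simp [hi]))

lemma InM.CX : InM (C X) :=
  ⟨(C X) ^ 2, 1, isSumSq_sq _, .one, by simp⟩

lemma InM.COneSubX : InM (C (1 - X)) :=
  ⟨(C (1 - X)) ^ 2, 1, isSumSq_sq _, .one, by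
    rw [one_mul, ← C_pow, ← C_add]; congr 1; ring⟩

lemma IsSumSq.map' {R S : Type*} [CommRing R] [CommRing S] (φ : R →+* S) {a : R}
    (h : IsSumSq a) : IsSumSq (φ a) := by
  induction h with
  | zero => simpa using IsSumSq.zero
  | sq_add a hs ih => rw [map_add, map_mul]; exact (IsSumSq.mul_self _).add ih

lemma InM.const {c : ℝ} (hc : 0 ≤ c) : InM (C (C c)) := by
  have : C (C c) = (C (C (√c)) : ℝ[X][X]) ^ 2 := by
    rw [← C_pow, ← C_pow, Real.sq_sqrt hc]
  rw [this]; exact .sq _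

/-- flip x -> 1 - x -/
noncomputable def flip : ℝ[X][X] →+* ℝ[X][X] := mapRingHom (compRingHom (1 - X))

lemma InM.flip {f : ℝ[X][X]} : InM f → InM (flip f) := by
  rintro ⟨a, b, ha, hb, rfl⟩
  refine ⟨Strip.flip a, Strip.flip b, IsSumSq.map' _ ha, IsSumSq.map' _ hb, ?_⟩
  rw [map_add, map_mul]
  congr 2
  simp only [Strip.flip, coe_mapRingHom, map_C, coe_compRingHom_apply]
  congr 1
  simp; ring

lemma flip_flip (f : ℝ[X][X]) : flip (flip f) = f := by
  unfold flip
  rw [coe_mapRingHom, map_map]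
  convert Polynomial.map_id using 2
  ext <;> simp

/-- a continuous function nonneg off roots of a nonzero polynomial is nonneg -/
lemma nonneg_of_off_roots {g : ℝ → ℝ} (hg : Continuous g) {q : ℝ[X]} (hq : q ≠ 0)
    {s : Set ℝ} (hs : s ⊆ closure (interior s))
    (h : ∀ y ∈ s, q.eval y ≠ 0 → 0 ≤ g y) : ∀ y ∈ s, 0 ≤ g y := by
  have hd : Dense ({y | q.eval y ≠ 0}) := by
    have : {y | q.eval y ≠ 0} = (q.rootSet ℝ)ᶜ := by
      ext y; simp [mem_rootSet, hq]
    rw [this]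
    exact (Set.Finite.countable (rootSet_finite q ℝ)).dense_compl ℝ
  have h1 : interior s ⊆ closure (interior s ∩ {y | q.eval y ≠ 0}) :=
    hd.open_subset_closure_inter isOpen_interior
  have h2 : s ⊆ closure (interior s ∩ {y | q.eval y ≠ 0}) :=
    hs.trans (closure_minimal h1 isClosed_closure)
  intro y hy
  have h3 : closure (interior s ∩ {y | q.eval y ≠ 0}) ⊆ {y | 0 ≤ g y} := by
    apply closure_minimal _ (isClosed_le continuous_const hg)
    rintro z ⟨hz, hz'⟩
    exact h z (interior_subset hz) hz'
  exact h3 (h2 hy)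

lemma nonneg_of_off_roots_univ {g : ℝ → ℝ} (hg : Continuous g) {q : ℝ[X]} (hq : q ≠ 0)
    (h : ∀ y, q.eval y ≠ 0 → 0 ≤ g y) : ∀ y, 0 ≤ g y := fun y =>
  nonneg_of_off_roots hg hq (s := Set.univ) (by simp) (fun y _ => h y) y trivial

lemma univ_sos_aux (n : ℕ) : ∀ p : ℝ[X], p.natDegree ≤ n → (∀ y, 0 ≤ p.eval y) → IsSumSq p := by
  induction n using Nat.strong_induction_on with
  | _ n ih =>
  intro p hpn h
  by_cases hd : p.natDegree = 0
  · rw [eq_C_of_natDegree_eq_zero hd]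
    have h0 : 0 ≤ p.coeff 0 := by
      have := h 0; rwa [← coeff_zero_eq_eval_zero] at this
    have : C (p.coeff 0) = (C (√(p.coeff 0))) ^ 2 := by rw [← C_pow, Real.sq_sqrt h0]
    rw [this]; exact isSumSq_sq _
  · have hdeg : 0 < p.degree := natDegree_pos_iff_degree_pos.1 (Nat.pos_of_ne_zero hd)
    have ht : Filter.Tendsto (fun y => p.eval y) (Filter.cocompact ℝ) Filter.atTop := by
      have := p.tendsto_norm_atTop hdeg (tendsto_norm_cocompact_atTop (E := ℝ))
      refine this.congr fun y => ?_
      rw [Real.norm_of_nonneg (h y)]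
    obtain ⟨a, ha⟩ := p.continuous.exists_forall_le ht
    set m := p.eval a with hm
    set r := p - C m with hr
    have hr0 : r ≠ 0 := by
      intro h0
      apply hd
      rw [sub_eq_zero.1 h0]; simp
    have hroot : r.IsRoot a := by simp [hr, hm]
    have hroot' : (derivative r).IsRoot a := by
      have hl : IsLocalMin (fun y => p.eval y) a := Filter.Eventually.of_forall ha
      have := hl.deriv_eq_zero
      rw [Polynomial.deriv] at this
      simp [hr, IsRoot, this]
    have h2 : 1 < r.rootMultiplicity a :=
      (one_lt_rootMultiplicity_iff_isRoot hr0).2 ⟨hroot, hroot'⟩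
    obtain ⟨q, hq⟩ : (X - C a) ^ 2 ∣ r := (le_rootMultiplicity_iff hr0).1 h2
    have hq0 : q ≠ 0 := by rintro rfl; simp at hq; exact hr0 hq
    have hqn : q.natDegree + 2 = p.natDegree := by
      have h3 : r.natDegree = p.natDegree := by rw [hr, natDegree_sub_C]
      rw [← h3, hq, natDegree_mul (pow_ne_zero _ (X_sub_C_ne_zero a)) hq0, natDegree_pow,
        natDegree_X_sub_C]
      ring
    have hqs : IsSumSq q := by
      apply ih q.natDegree (by omega) q le_rfl
      apply nonneg_of_off_roots_univ q.continuous (X_sub_C_ne_zero a)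
      intro y hy
      have h4 : 0 ≤ r.eval y := by simp [hr]; exact ha y
      rw [hq] at h4
      simp only [eval_mul, eval_pow] at h4
      exact nonneg_of_mul_nonneg_right h4 (by positivity)
    have hp : p = (X - C a) ^ 2 * q + (C (√m)) ^ 2 := by
      rw [← C_pow, Real.sq_sqrt (h a), ← hq, hr]; ring
    rw [hp]
    exact ((isSumSq_sq _).mul hqs).add (isSumSq_sq _)

lemma univ_sos (p : ℝ[X]) (h : ∀ y, 0 ≤ p.eval y) : IsSumSq p := univ_sos_aux _ p le_rfl h

end Strip

namespace Strip
open Polynomial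

lemma bern_coeff_tendsto (i : ℕ) : ∀ δ : ℝ, 0 < δ → ∃ N : ℕ, ∀ n ≥ N, ∀ k ≤ n,
    |(k.choose i : ℝ) / (n.choose i : ℝ) - ((k : ℝ) / n) ^ i| ≤ δ := by
  induction i with
  | zero => intro δ hδ; exact ⟨0, fun n _ k _ => by simp; exact hδ.le⟩
  | succ i ih =>
    intro δ hδ
    obtain ⟨N, hN⟩ := ih (δ / 2) (by positivity)
    obtain ⟨M, hM⟩ := exists_nat_gt (2 * (i : ℝ) / δ)
    refine ⟨max N (M + i + 1), fun n hn k hk => ?_⟩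
    have hnN : N ≤ n := le_trans (le_max_left _ _) hn
    have hnM : M + i + 1 ≤ n := le_trans (le_max_right _ _) hn
    have h1 := hN n hnN k hk
    have hni : (0 : ℝ) < (n : ℝ) - i := by
      have : ((M + i + 1 : ℕ) : ℝ) ≤ n := by exact_mod_cast hnM
      push_cast at this
      have : (0 : ℝ) ≤ M := by positivity
      linarith
    have hn0 : (0 : ℝ) < n := by
      have : (0 : ℝ) ≤ i := by positivity
      linarith
    have hkn : (k : ℝ) ≤ n := by exact_mod_cast hk
    have hk0 : (0 : ℝ) ≤ k := by positivity
    have hcn : (0 : ℝ) < n.choose i := by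
      exact_mod_cast Nat.choose_pos (by omega)
    have hcn' : (0 : ℝ) < n.choose (i + 1) := by
      exact_mod_cast Nat.choose_pos (by omega)
    have hstep : ∀ m : ℕ, (m.choose (i + 1) : ℝ) * (i + 1) = m.choose i * ((m : ℝ) - i) := by
      intro m
      have := Nat.choose_succ_right_eq m i
      by_cases him : i ≤ m
      · have h2 : ((m.choose (i + 1) * (i + 1) : ℕ) : ℝ) = ((m.choose i * (m - i) : ℕ) : ℝ) := by
          rw [this]
        push_cast [Nat.cast_sub him] at h2
        exact h2
      · rw [Nat.choose_eq_zero_of_lt (by omega), Nat.choose_eq_zero_of_lt (by omega)]; simp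
    have hi1 : (0 : ℝ) < i + 1 := by positivity
    have hb : (k.choose (i + 1) : ℝ) / (n.choose (i + 1) : ℝ)
        = (k.choose i : ℝ) / (n.choose i : ℝ) * (((k : ℝ) - i) / ((n : ℝ) - i)) := by
      rw [div_mul_div_comm, ← hstep, ← hstep]
      field_simp
    have hb1 : (k.choose i : ℝ) / (n.choose i : ℝ) ≤ 1 := by
      rw [div_le_one hcn]
      exact_mod_cast Nat.choose_le_choose i hk
    have hb0 : (0 : ℝ) ≤ (k.choose i : ℝ) / (n.choose i : ℝ) := by positivity
    have hd : |((k : ℝ) - i) / ((n : ℝ) - i) - (k : ℝ) / n| ≤ δ / 2 := by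
      have : ((k : ℝ) - i) / ((n : ℝ) - i) - (k : ℝ) / n = - (i * (n - k) / (((n : ℝ) - i) * n)) := by
        field_simp; ring
      rw [this, abs_neg, abs_of_nonneg (by
        have : (0 : ℝ) ≤ n - k := by linarith
        positivity)]
      rw [div_le_iff₀ (by positivity)]
      have hM' : (M : ℝ) ≤ n - i := by
        have : ((M + i + 1 : ℕ) : ℝ) ≤ n := by exact_mod_cast hnM
        push_cast at this; linarith
      have h3 : 2 * (i : ℝ) < δ * (n - i) := by
        rw [div_lt_iff₀ hδ] at hM
        nlinarith
      have h4 : (i : ℝ) * (n - k) ≤ i * n := by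
        have : (0 : ℝ) ≤ i := by positivity
        nlinarith
      nlinarith
    have hkn1 : (k : ℝ) / n ≤ 1 := by rw [div_le_one hn0]; exact hkn
    have hkn0 : 0 ≤ (k : ℝ) / n := by positivity
    rw [hb, pow_succ]
    set b := (k.choose i : ℝ) / (n.choose i : ℝ)
    set u := ((k : ℝ) - i) / ((n : ℝ) - i)
    set v := (k : ℝ) / n
    have : b * u - v ^ i * v = b * (u - v) + (b - v ^ i) * v := by ring
    rw [this]
    calc |b * (u - v) + (b - v ^ i) * v| ≤ |b| * |u - v| + |b - v ^ i| * |v| := by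
          rw [← abs_mul, ← abs_mul]; exact abs_add_le _ _
      _ ≤ 1 * (δ / 2) + (δ / 2) * 1 := by
          gcongr
          · rw [abs_of_nonneg hb0]; exact hb1
          · rw [abs_of_nonneg hkn0]; exact hkn1
      _ = δ := by ring

lemma X_pow_bern (n i : ℕ) (hi : i ≤ n) : (X : ℝ[X]) ^ i = ∑ k ∈ Finset.range (n + 1),
    C ((k.choose i : ℝ) / (n.choose i : ℝ)) * (C (n.choose k : ℝ) * (X ^ k * (1 - X) ^ (n - k))) := by
  have h1 : (X : ℝ[X]) ^ i = X ^ i * (X + (1 - X)) ^ (n - i) := by simp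
  rw [h1, add_pow, Finset.mul_sum]
  have h2 : n + 1 = i + (n - i + 1) := by omega
  rw [h2, Finset.sum_range_add _ i]
  have h3 : ∑ x ∈ Finset.range i, (C ((x.choose i : ℝ) / (n.choose i : ℝ)) *
      (C (n.choose x : ℝ) * (X ^ x * (1 - X) ^ (n - x))) : ℝ[X]) = 0 := by
    apply Finset.sum_eq_zero
    intro x hx
    rw [Nat.choose_eq_zero_of_lt (Finset.mem_range.1 hx)]; simp
  rw [h3, zero_add]
  apply Finset.sum_congr rfl
  intro x hx
  have hx' : x ≤ n - i := by have := Finset.mem_range.1 hx; omega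
  have hc : ((n - i).choose x : ℝ) = ((i + x).choose i : ℝ) / (n.choose i : ℝ) * (n.choose (i + x)) := by
    have hn : (n.choose i : ℝ) ≠ 0 := by exact_mod_cast (Nat.choose_pos hi).ne'
    have := Nat.choose_mul (n := n) (k := i + x) (s := i) (by omega)
    rw [div_mul_eq_mul_div, eq_div_iff hn]
    have h4 : i + x - i = x := by omega
    rw [h4] at this
    have h5 : ((n.choose (i + x) * (i + x).choose i : ℕ) : ℝ)
      = ((n.choose i * (n - i).choose x : ℕ) : ℝ) := by rw [this]
    push_cast at h5
    linarith
  have h6 : (((n - i).choose x : ℕ) : ℝ[X]) = C ((n - i).choose x : ℝ) := by simp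
  rw [h6, hc, C_mul]
  have h7 : n - (i + x) = n - i - x := by omega
  rw [h7]
  ring

lemma abs_pow_le_one_add_sq (d j : ℕ) (hj : j ≤ 2 * d) (y : ℝ) : |y| ^ j ≤ (1 + y ^ 2) ^ d := by
  have h1 : |y| ≤ √(1 + y ^ 2) := by
    rw [← Real.sqrt_sq_eq_abs]; apply Real.sqrt_le_sqrt; linarith
  have h2 : 1 ≤ √(1 + y ^ 2) := by
    rw [Real.one_le_sqrt]; have := sq_nonneg y; linarith
  calc |y| ^ j ≤ √(1 + y ^ 2) ^ j := by gcongr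
    _ ≤ √(1 + y ^ 2) ^ (2 * d) := by gcongr
    _ = (1 + y ^ 2) ^ d := by rw [pow_mul, Real.sq_sqrt (by positivity)]

theorem strict_case (P : ℝ[X][X]) (d : ℕ) (hd : P.natDegree ≤ 2 * d) (c : ℝ) (hc : 0 < c)
    (h : ∀ x ∈ Set.Icc (0 : ℝ) 1, ∀ y, c * (1 + y ^ 2) ^ d ≤ P.evalEval x y) : InM P := by
  classical
  -- uniform x-degree bound
  obtain ⟨D, hD⟩ : ∃ D, ∀ j ∈ Finset.range (2 * d + 1), (P.coeff j).natDegree < D := by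
    refine ⟨(Finset.range (2 * d + 1)).sup (fun j => (P.coeff j).natDegree) + 1, fun j hj => ?_⟩
    have := Finset.le_sup (f := fun j => (P.coeff j).natDegree) hj
    exact Nat.lt_succ_of_le this
  set A : ℝ := ∑ j ∈ Finset.range (2 * d + 1), ∑ i ∈ Finset.range D, |(P.coeff j).coeff i| with hA
  have hA0 : 0 ≤ A := by positivity
  set δ := c / (A + 1) with hδ
  have hδ0 : 0 < δ := by positivity
  choose N hN using fun i => bern_coeff_tendsto i δ hδ0
  set n := (Finset.range D).sup N + D + 1 with hn
  have hnN : ∀ i ∈ Finset.range D, N i ≤ n := fun i hi => by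
    have := Finset.le_sup (f := N) hi; omega
  let Q : ℕ → ℝ[X] := fun k => ∑ j ∈ Finset.range (2 * d + 1),
    C (∑ i ∈ Finset.range D, (P.coeff j).coeff i * ((k.choose i : ℝ) / (n.choose i : ℝ))) * X ^ j
  let B : ℕ → ℝ[X] := fun k => C (n.choose k : ℝ) * (X ^ k * (1 - X) ^ (n - k))
  have hcoef : ∀ j ∈ Finset.range (2 * d + 1), P.coeff j = ∑ k ∈ Finset.range (n + 1),
      C (∑ i ∈ Finset.range D, (P.coeff j).coeff i * ((k.choose i : ℝ) / (n.choose i : ℝ))) * B k := by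
    intro j hj
    conv_lhs => rw [as_sum_range' (P.coeff j) D (hD j hj)]
    simp only [map_sum, Finset.sum_mul]
    rw [Finset.sum_comm]
    apply Finset.sum_congr rfl
    intro i hi
    rw [← C_mul_X_pow_eq_monomial, X_pow_bern n i (by have := Finset.mem_range.1 hi; omega),
      Finset.mul_sum]
    apply Finset.sum_congr rfl
    intro k hk
    simp only [B, C_mul]
    ring
  have hP : P = ∑ k ∈ Finset.range (n + 1), C (B k) * (Q k).map C := by
    conv_lhs => rw [as_sum_range_C_mul_X_pow' P (show P.natDegree < 2 * d + 1 by omega)]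
    have : ∀ k, C (B k) * (Q k).map C = ∑ j ∈ Finset.range (2 * d + 1),
       C (C (∑ i ∈ Finset.range D, (P.coeff j).coeff i * ((k.choose i : ℝ) / (n.choose i : ℝ))) * B k) * X ^ j := by
      intro k
      simp only [Q, Polynomial.map_sum, Polynomial.map_mul, Polynomial.map_pow, map_X, map_C,
        Finset.mul_sum, C_mul]
      apply Finset.sum_congr rfl
      intro j hj
      ring
    simp only [this]
    rw [Finset.sum_comm]
    apply Finset.sum_congr rfl
    intro j hj
    conv_lhs => rw [hcoef j hj]
    rw [map_sum, Finset.sum_mul]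
  rw [hP]
  apply InM.sum
  intro k hk
  have hkn : k ≤ n := by have := Finset.mem_range.1 hk; omega
  apply InM.mul
  · simp only [B, C_mul, C_pow]
    exact (InM.const (by positivity)).mul ((InM.CX.pow _).mul (InM.COneSubX.pow _))
  · apply InM.of_sumSq
    have : IsSumSq (Q k) := by
      apply univ_sos
      intro y
      have hn0 : (0 : ℝ) < n := by simp only [hn]; positivity
      have hx : (k : ℝ) / n ∈ Set.Icc (0 : ℝ) 1 :=
        ⟨by positivity, by rw [div_le_one hn0]; exact_mod_cast hkn⟩
      have h1 := h _ hx y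
      have h2 : P.evalEval ((k : ℝ) / n) y = ∑ j ∈ Finset.range (2 * d + 1),
          (∑ i ∈ Finset.range D, (P.coeff j).coeff i * ((k : ℝ) / n) ^ i) * y ^ j := by
        conv_lhs => rw [as_sum_range_C_mul_X_pow' P (show P.natDegree < 2 * d + 1 by omega)]
        simp only [evalEval_finsetSum, evalEval_mul, evalEval_pow, evalEval_C, evalEval_X]
        apply Finset.sum_congr rfl
        intro j hj
        congr 1
        rw [eval_eq_sum_range' (hD j hj)]
      have h3 : (Q k).eval y = ∑ j ∈ Finset.range (2 * d + 1),
          (∑ i ∈ Finset.range D, (P.coeff j).coeff i * ((k.choose i : ℝ) / (n.choose i : ℝ))) * y ^ j := by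
        simp [Q, eval_finsetSum]
      have h4 : |(Q k).eval y - P.evalEval ((k : ℝ) / n) y| ≤ (A * δ) * (1 + y ^ 2) ^ d := by
        rw [h2, h3, ← Finset.sum_sub_distrib]
        refine (Finset.abs_sum_le_sum_abs _ _).trans ?_
        rw [hA, Finset.sum_mul, Finset.sum_mul]
        apply Finset.sum_le_sum
        intro j hj
        rw [← sub_mul, abs_mul, abs_pow]
        apply mul_le_mul _ (abs_pow_le_one_add_sq d j (by have := Finset.mem_range.1 hj; omega) y)
          (by positivity) (by positivity)
        rw [← Finset.sum_sub_distrib, Finset.sum_mul]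
        refine (Finset.abs_sum_le_sum_abs _ _).trans ?_
        apply Finset.sum_le_sum
        intro i hi
        rw [← mul_sub, abs_mul]
        gcongr
        exact hN i n (hnN i hi) k hkn
      have h5 : A * δ ≤ c := by
        rw [hδ, mul_div_assoc', div_le_iff₀ (by positivity)]; nlinarith
      have h6 : (0 : ℝ) < (1 + y ^ 2) ^ d := by positivity
      have h7 := (abs_le.1 h4).1
      nlinarith
    exact IsSumSq.map' (mapRingHom C) this

end Strip

namespace Strip
open Polynomial

lemma unif_bound_x (p : ℝ[X]) : ∃ A : ℝ, 0 < A ∧ ∀ x ∈ Set.Icc (0 : ℝ) 1, |p.eval x| ≤ A := by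
  obtain ⟨A, hA⟩ := (isCompact_Icc (a := (0 : ℝ)) (b := 1)).exists_bound_of_continuousOn
    p.continuous.continuousOn
  exact ⟨max A 1, by positivity, fun x hx => (hA x hx).trans (le_max_left _ _)⟩

lemma poly_bound (G : ℝ[X][X]) (m : ℕ) (hm : G.natDegree ≤ m) :
    ∃ A : ℝ, 0 < A ∧ ∀ x ∈ Set.Icc (0 : ℝ) 1, ∀ y, |G.evalEval x y| ≤ A * (1 + |y|) ^ m := by
  choose A hA0 hA using fun j => unif_bound_x (G.coeff j)
  refine ⟨∑ j ∈ Finset.range (m + 1), A j, Finset.sum_pos (fun j _ => hA0 j) (by simp), ?_⟩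
  intro x hx y
  rw [as_sum_range_C_mul_X_pow' G (show G.natDegree < m + 1 by omega)]
  simp only [evalEval_finsetSum, evalEval_mul, evalEval_pow, evalEval_C, evalEval_X]
  refine (Finset.abs_sum_le_sum_abs _ _).trans ?_
  rw [Finset.sum_mul]
  apply Finset.sum_le_sum
  intro j hj
  rw [abs_mul, abs_pow]
  have h1 : |y| ^ j ≤ (1 + |y|) ^ m := by
    calc |y| ^ j ≤ (1 + |y|) ^ j := by gcongr; linarith
      _ ≤ (1 + |y|) ^ m := pow_le_pow_right₀ (by have := abs_nonneg y; linarith)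
        (by have := Finset.mem_range.1 hj; omega)
  exact mul_le_mul (hA j x hx) h1 (by positivity) (hA0 j).le

lemma taylor_mono (n : ℕ) : ∃ A : ℝ, 0 < A ∧ ∀ y δ : ℝ, |δ| ≤ 1 →
    |(y + δ) ^ n - y ^ n - n * y ^ (n - 1) * δ| ≤ A * (1 + |y|) ^ n * δ ^ 2 := by
  induction n with
  | zero => exact ⟨1, one_pos, fun y δ _ => by simp; positivity⟩
  | succ n ih =>
    obtain ⟨A, hA0, hA⟩ := ih
    refine ⟨A + n, by positivity, fun y δ hδ => ?_⟩
    have h1 := hA y δ hδ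
    have hs : |y + δ| ≤ 1 + |y| := (abs_add_le _ _).trans (by linarith)
    have h2 : (y + δ) ^ (n + 1) - y ^ (n + 1) - ((n + 1 : ℕ) : ℝ) * y ^ (n + 1 - 1) * δ
      = (y + δ) * ((y + δ) ^ n - y ^ n - n * y ^ (n - 1) * δ) + n * y ^ (n - 1) * δ ^ 2 := by
      cases n with
      | zero => simp
      | succ k => simp only [Nat.add_sub_cancel]; push_cast; ring_nf
    rw [h2]
    refine (abs_add_le _ _).trans ?_
    rw [abs_mul, abs_mul, abs_mul, abs_pow, abs_pow δ, sq_abs, Nat.abs_cast]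
    have h3 : |y| ^ (n - 1) ≤ (1 + |y|) ^ (n + 1) := by
      calc |y| ^ (n - 1) ≤ (1 + |y|) ^ (n - 1) := by gcongr; linarith
        _ ≤ _ := pow_le_pow_right₀ (by have := abs_nonneg y; linarith) (by omega)
    calc _ ≤ (1 + |y|) * (A * (1 + |y|) ^ n * δ ^ 2) + n * (1 + |y|) ^ (n + 1) * δ ^ 2 := by
          gcongr
      _ = _ := by ring

lemma taylor_bound (f : ℝ[X][X]) : ∃ (A : ℝ) (K : ℕ), 0 < A ∧ ∀ x ∈ Set.Icc (0 : ℝ) 1,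
    ∀ y δ : ℝ, |δ| ≤ 1 →
    |f.evalEval x (y + δ) - f.evalEval x y - (derivative f).evalEval x y * δ|
      ≤ A * (1 + |y|) ^ K * δ ^ 2 := by
  induction f using Polynomial.induction_on' with
  | add p q hp hq =>
    obtain ⟨A, K, hA0, hA⟩ := hp
    obtain ⟨B, L, hB0, hB⟩ := hq
    refine ⟨A + B, max K L, by positivity, fun x hx y δ hδ => ?_⟩
    have h1 := hA x hx y δ hδ
    have h2 := hB x hx y δ hδ
    have hs : 1 ≤ 1 + |y| := by have := abs_nonneg y; linarith
    rw [derivative_add]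
    simp only [evalEval_add]
    calc _ = |(p.evalEval x (y + δ) - p.evalEval x y - (derivative p).evalEval x y * δ)
          + (q.evalEval x (y + δ) - q.evalEval x y - (derivative q).evalEval x y * δ)| := by
          congr 1; ring
      _ ≤ A * (1 + |y|) ^ K * δ ^ 2 + B * (1 + |y|) ^ L * δ ^ 2 :=
          (abs_add_le _ _).trans (add_le_add h1 h2)
      _ ≤ A * (1 + |y|) ^ (max K L) * δ ^ 2 + B * (1 + |y|) ^ (max K L) * δ ^ 2 := by
          gcongr <;> simp
      _ = _ := by ring
  | monomial n a =>
    obtain ⟨A, hA0, hA⟩ := taylor_mono n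
    obtain ⟨B, hB0, hB⟩ := unif_bound_x a
    refine ⟨B * A, n, by positivity, fun x hx y δ hδ => ?_⟩
    rw [derivative_monomial]
    simp only [← C_mul_X_pow_eq_monomial, evalEval_mul, evalEval_pow, evalEval_C, evalEval_X,
      eval_mul, eval_natCast]
    calc _ = |eval x a| * |(y + δ) ^ n - y ^ n - n * y ^ (n - 1) * δ| := by
          rw [← abs_mul]; congr 1; ring
      _ ≤ B * (A * (1 + |y|) ^ n * δ ^ 2) := by
          gcongr
          · exact hB x hx
          · exact hA y δ hδ
      _ = _ := by ring

set_option maxHeartbeats 1000000 in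
theorem lower_bound (f u v : ℝ[X][X]) (h : ℝ[X]) (hh : h ≠ 0) (d : ℕ) (hf0 : f ≠ 0)
    (hd : f.natDegree = 2 * d)
    (hf : ∀ x ∈ Set.Icc (0 : ℝ) 1, ∀ y, 0 ≤ f.evalEval x y)
    (hbez : u * f + v * derivative f = C h) :
    ∃ e : ℝ[X], e ≠ 0 ∧ ∀ x ∈ Set.Icc (0 : ℝ) 1, ∀ y,
      (e.eval x) ^ 2 * (1 + y ^ 2) ^ d ≤ f.evalEval x y := by
  obtain ⟨A1, hA1, h1⟩ := poly_bound u _ le_rfl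
  obtain ⟨A2, hA2, h2⟩ := poly_bound v _ le_rfl
  obtain ⟨A3, hA3, h3⟩ := poly_bound (derivative f) _ le_rfl
  obtain ⟨A4, hA4, h4⟩ := poly_bound f _ le_rfl
  obtain ⟨A5, K5, hA5, h5⟩ := taylor_bound f
  set B : ℝ := 1 + A1 + A2 + A3 + A4 + A5 with hB
  set K : ℕ := u.natDegree + v.natDegree + (derivative f).natDegree + f.natDegree + K5 with hK
  have hB1 : 1 ≤ B := by linarith
  have upg : ∀ (A : ℝ) (k : ℕ) (y : ℝ), 0 < A → A ≤ B → k ≤ K →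
      A * (1 + |y|) ^ k ≤ B * (1 + |y|) ^ K := by
    intro A k y hA0 hA hk
    have hs : 1 ≤ 1 + |y| := by have := abs_nonneg y; linarith
    exact mul_le_mul hA (pow_le_pow_right₀ hs hk) (by positivity) (by positivity)
  have key1 : ∀ x ∈ Set.Icc (0 : ℝ) 1, ∀ y,
      (h.eval x) ^ 2 ≤ 10 * (B * (1 + |y|) ^ K) ^ 3 * f.evalEval x y := by
    intro x hx y
    have e1 := (h1 x hx y).trans (upg A1 _ y hA1 (by linarith) (by omega))
    have e2 := (h2 x hx y).trans (upg A2 _ y hA2 (by linarith) (by omega))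
    have e3 := (h3 x hx y).trans (upg A3 _ y hA3 (by linarith) (by omega))
    have e4 := (h4 x hx y).trans (upg A4 _ y hA4 (by linarith) (by omega))
    have e5 := fun δ hδ => (h5 x hx y δ hδ).trans
      (mul_le_mul_of_nonneg_right (upg A5 K5 y hA5 (by linarith) (by omega)) (sq_nonneg δ))
    have e6 := congrArg (evalEval x y) hbez
    simp only [evalEval_add, evalEval_mul, evalEval_C] at e6
    have hW : 1 ≤ B * (1 + |y|) ^ K := by
      have hs : 1 ≤ 1 + |y| := by have := abs_nonneg y; linarith
      exact one_le_mul_of_one_le_of_one_le hB1 (one_le_pow₀ hs)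
    have hf0' := hf x hx y
    generalize B * (1 + |y|) ^ K = W at *
    generalize hF : f.evalEval x y = F at *
    generalize hU : u.evalEval x y = U at *
    generalize hV : v.evalEval x y = V at *
    generalize hF' : (derivative f).evalEval x y = F' at *
    have hW0 : 0 < W := by linarith
    have e7 : F' ^ 2 ≤ 4 * W * F := by
      set δ := -(F' / (2 * W)) with hδ
      have hδ1 : |δ| ≤ 1 := by
        rw [hδ, abs_neg, abs_div, abs_of_pos (show 0 < 2 * W by linarith), div_le_one (by linarith)]
        linarith
      have := e5 δ hδ1
      have h8 := hf x hx (y + δ)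
      have h9 := (abs_le.1 this).2
      have h10 : 0 ≤ F + F' * δ + W * δ ^ 2 := by linarith
      have h11 : F + F' * δ + W * δ ^ 2 = F - F' ^ 2 / (4 * W) := by
        rw [hδ]; field_simp; ring
      rw [h11] at h10
      have h12 : F' ^ 2 / (4 * W) ≤ F := by linarith
      rw [div_le_iff₀ (by linarith)] at h12
      linarith
    have e8 : U ^ 2 ≤ W ^ 2 := sq_le_sq' (abs_le.1 e1).1 (abs_le.1 e1).2
    have e9 : V ^ 2 ≤ W ^ 2 := sq_le_sq' (abs_le.1 e2).1 (abs_le.1 e2).2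
    have e10 : F ≤ W := (abs_le.1 e4).2
    rw [← e6]
    calc (U * F + V * F') ^ 2 ≤ 2 * (U ^ 2 * (F * F)) + 2 * (V ^ 2 * F' ^ 2) := by
          nlinarith [sq_nonneg (U * F - V * F')]
      _ ≤ 2 * (W ^ 2 * (W * F)) + 2 * (W ^ 2 * (4 * W * F)) := by gcongr
      _ = _ := by ring
  -- the part at infinity
  set a := f.coeff (2 * d) with ha
  have ha0 : a ≠ 0 := by
    rw [ha, ← hd]; exact leadingCoeff_ne_zero.2 hf0
  obtain ⟨Cg, hCg0, hCg⟩ : ∃ Cg : ℝ, 0 < Cg ∧ ∀ x ∈ Set.Icc (0 : ℝ) 1, ∀ y,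
      |f.evalEval x y - a.eval x * (1 + y ^ 2) ^ d| * (1 + |y|) ≤ Cg * (1 + |y|) ^ (2 * d) := by
    set g := f - C a * (1 + X ^ 2) ^ d with hg
    have hgev : ∀ x y, g.evalEval x y = f.evalEval x y - a.eval x * (1 + y ^ 2) ^ d := by
      intro x y; simp [hg, evalEval_C]
    have hmon : ((1 + X ^ 2 : ℝ[X][X]) ^ d).Monic := by
      apply Monic.pow
      rw [add_comm]
      exact monic_X_pow_add_C (1 : ℝ[X]) two_ne_zero
    have hmd : ((1 + X ^ 2 : ℝ[X][X]) ^ d).natDegree = 2 * d := by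
      rw [natDegree_pow, add_comm]
      have : (X ^ 2 + 1 : ℝ[X][X]).natDegree = 2 := natDegree_X_pow_add_C (r := (1 : ℝ[X]))
      rw [this]; ring
    have hgc : g.coeff (2 * d) = 0 := by
      have := hmon.coeff_natDegree
      rw [hmd] at this
      rw [hg, coeff_sub, coeff_C_mul, this]; simp [ha]
    have hgd : g.natDegree ≤ 2 * d := by
      rw [hg]
      refine (natDegree_sub_le _ _).trans (max_le hd.le ?_)
      exact (natDegree_C_mul_le _ _).trans hmd.le
    rcases Nat.eq_zero_or_pos d with rfl | hdpos
    · refine ⟨1, one_pos, fun x hx y => ?_⟩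
      have : g = 0 := by
        rw [eq_C_of_natDegree_le_zero (p := g) (by simpa using hgd)]
        simpa using hgc
      rw [← hgev, this]; simp
    · have hgd' : g.natDegree ≤ 2 * d - 1 := by
        by_contra hcon
        have h1 : g.natDegree = 2 * d := by omega
        rw [← h1, coeff_natDegree, leadingCoeff_eq_zero] at hgc
        rw [hgc] at h1; simp at h1; omega
      obtain ⟨A, hA0, hA⟩ := poly_bound g _ hgd'
      refine ⟨A, hA0, fun x hx y => ?_⟩
      rw [← hgev]
      calc _ ≤ A * (1 + |y|) ^ (2 * d - 1) * (1 + |y|) := by gcongr; exact hA x hx y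
        _ = A * (1 + |y|) ^ (2 * d - 1 + 1) := by ring
        _ = _ := by congr 2; omega
  have hT : ∀ y : ℝ, (1 + |y|) ^ (2 * d) ≤ 2 ^ d * (1 + y ^ 2) ^ d := by
    intro y
    rw [pow_mul, ← mul_pow]
    gcongr
    rw [← sq_abs y]
    nlinarith [sq_nonneg (1 - |y|)]
  have hT' : ∀ y : ℝ, (1 + y ^ 2) ^ d ≤ (1 + |y|) ^ (2 * d) := by
    intro y
    rw [pow_mul]
    gcongr
    rw [← sq_abs y]
    nlinarith [abs_nonneg y]
  set C2 : ℝ := Cg * 2 ^ d with hC2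
  have hC20 : 0 < C2 := by positivity
  obtain ⟨A0, hA00, hA0⟩ := unif_bound_x a
  obtain ⟨H0, hH00, hH0⟩ := unif_bound_x h
  set A' : ℝ := A0 + 2 * C2 + 1 with hA'
  set H : ℝ := H0 + 1 with hH
  set L : ℕ := 3 * K + 2 * d with hL
  set κ : ℝ := 1 / (10 * B ^ 3) with hκ
  have hκ0 : 0 < κ := by positivity
  have hκ1 : κ ≤ 1 / 2 := by
    rw [hκ]
    apply one_div_le_one_div_of_le (by norm_num)
    have := one_le_pow₀ hB1 (n := 3)
    linarith
  have hA'0 : 0 < A' := by positivity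
  have hH0' : 0 < H := by positivity
  refine ⟨C (√κ / (H * A' ^ (L + 1))) * h * a ^ (L + 1), ?_, ?_⟩
  · refine mul_ne_zero (mul_ne_zero ?_ hh) (pow_ne_zero _ ha0)
    rw [Ne, C_eq_zero]; positivity
  intro x hx y
  set α := |a.eval x| / A' with hα
  set χ := |h.eval x| / H with hχ
  have hα0 : 0 ≤ α := by positivity
  have hα1 : α ≤ 1 := by rw [hα, div_le_one hA'0]; have := hA0 x hx; linarith
  have hχ0 : 0 ≤ χ := by positivity
  have hχ1 : χ ≤ 1 := by rw [hχ, div_le_one hH0']; have := hH0 x hx; linarith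
  have hev : (eval x (C (√κ / (H * A' ^ (L + 1))) * h * a ^ (L + 1))) ^ 2
      = κ * χ ^ 2 * α ^ (2 * (L + 1)) := by
    simp only [eval_mul, eval_C, eval_pow]
    rw [hα, hχ, pow_mul, div_pow, div_pow, sq_abs, sq_abs, mul_pow, mul_pow, div_pow,
      Real.sq_sqrt hκ0.le, mul_pow, div_pow]
    field_simp
    try ring_nf
  rw [hev]
  set T := (1 + y ^ 2) ^ d with hTdef
  have hT0 : 0 < T := by positivity
  set s := 1 + |y| with hs
  have hs1 : 1 ≤ s := by have := abs_nonneg y; linarith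
  have hs0 : 0 < s := by linarith
  have hg := hCg x hx y
  have hfn := hf x hx y
  have hgT : |f.evalEval x y - a.eval x * T| * s ≤ C2 * T := by
    refine hg.trans ?_
    rw [hC2, mul_assoc]
    exact mul_le_mul_of_nonneg_left (hT y) hCg0.le
  have hκχ : κ * χ ^ 2 ≤ 1 / 2 := by
    have : χ ^ 2 ≤ 1 := pow_le_one₀ hχ0 hχ1
    nlinarith
  rcases le_or_gt (2 * C2) (|a.eval x| * s) with hcase | hcase
  · have h6 : |f.evalEval x y - a.eval x * T| ≤ |a.eval x| * T / 2 := by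
      have : |f.evalEval x y - a.eval x * T| * s ≤ (|a.eval x| * T / 2) * s := by
        have := mul_le_mul_of_nonneg_right hcase hT0.le
        calc _ ≤ C2 * T := hgT
          _ ≤ _ := by linarith
      exact le_of_mul_le_mul_right this hs0
    have hapos : 0 < |a.eval x| := by
      rcases (abs_nonneg (a.eval x)).eq_or_lt with h0 | h0
      · rw [← h0] at hcase; linarith
      · exact h0
    have hap : 0 ≤ a.eval x := by
      by_contra hneg
      push Not at hneg
      rw [abs_of_neg hneg] at h6 hapos
      have := (abs_le.1 h6).2
      have h33 := mul_neg_of_neg_of_pos hneg hT0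
      linarith
    have h7 : |a.eval x| * T / 2 ≤ f.evalEval x y := by
      have := (abs_le.1 h6).1
      rw [abs_of_nonneg hap] at this ⊢
      linarith
    refine le_trans ?_ h7
    have h8 : α ^ (2 * (L + 1)) ≤ α := pow_le_of_le_one hα0 hα1 (by omega)
    have h9 : α ≤ |a.eval x| := by
      rw [hα]; apply div_le_self (by positivity); linarith
    calc κ * χ ^ 2 * α ^ (2 * (L + 1)) * T ≤ 1 / 2 * |a.eval x| * T := by
          gcongr
          exact h8.trans h9
      _ = _ := by ring
  · have h6 : α * s ≤ 1 := by
      rw [hα, div_mul_eq_mul_div, div_le_one hA'0]; linarith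
    have h7 : (α * s) ^ L ≤ 1 := pow_le_one₀ (by positivity) h6
    have hk := key1 x hx y
    have h8 : χ ^ 2 ≤ (h.eval x) ^ 2 := by
      rw [hχ, div_pow, sq_abs]
      apply div_le_self (by positivity)
      apply one_le_pow₀; linarith
    have h9 : α ^ (2 * (L + 1)) ≤ α ^ L := pow_le_pow_of_le_one hα0 hα1 (by omega)
    calc κ * χ ^ 2 * α ^ (2 * (L + 1)) * T
        ≤ κ * (10 * (B * s ^ K) ^ 3 * f.evalEval x y) * α ^ L * s ^ (2 * d) := by
          gcongr
          · exact h8.trans hk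
          · exact hT' y
      _ = (α * s) ^ L * f.evalEval x y := by
          rw [hκ, hL]; field_simp; ring
      _ ≤ 1 * f.evalEval x y := by gcongr
      _ = _ := one_mul _

end Strip

namespace Strip

structure IsPre {K : Type*} [Field K] (P : Set K) : Prop where
  add : ∀ a ∈ P, ∀ b ∈ P, a + b ∈ P
  mul : ∀ a ∈ P, ∀ b ∈ P, a * b ∈ P
  sq : ∀ a, a * a ∈ P
  neg : (-1 : K) ∉ P

theorem exists_order (K : Type*) [Field K] (h : ¬ IsSumSq (-1 : K)) :
    ∃ (_ : LinearOrder K), IsStrictOrderedRing K := by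
  classical
  obtain ⟨P, -, hP⟩ : ∃ P : Set K, {x : K | IsSumSq x} ⊆ P ∧ Maximal (· ∈ {P : Set K | IsPre P}) P := by
    apply zorn_subset_nonempty {P : Set K | IsPre P}
    · intro c hc hchain hne
      refine ⟨⋃₀ c, ⟨?_, ?_, ?_, ?_⟩, fun s hs => Set.subset_sUnion_of_mem hs⟩
      · rintro a ⟨s, hs, ha⟩ b ⟨t, ht, hb⟩
        rcases hchain.total hs ht with hst | hst
        · exact ⟨t, ht, (hc ht).add _ (hst ha) _ hb⟩
        · exact ⟨s, hs, (hc hs).add _ ha _ (hst hb)⟩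
      · rintro a ⟨s, hs, ha⟩ b ⟨t, ht, hb⟩
        rcases hchain.total hs ht with hst | hst
        · exact ⟨t, ht, (hc ht).mul _ (hst ha) _ hb⟩
        · exact ⟨s, hs, (hc hs).mul _ ha _ (hst hb)⟩
      · intro a
        obtain ⟨s, hs⟩ := hne
        exact ⟨s, hs, (hc hs).sq a⟩
      · rintro ⟨s, hs, hm⟩
        exact (hc hs).neg hm
    · exact ⟨fun a ha b hb => IsSumSq.add ha hb, fun a ha b hb => IsSumSq.mul ha hb,
        fun a => IsSumSq.mul_self a, h⟩
  have hp : IsPre P := hP.1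
  have h0 : (0 : K) ∈ P := by simpa using hp.sq 0
  have h1 : (1 : K) ∈ P := by simpa using hp.sq 1
  have hinv : ∀ a ∈ P, a⁻¹ ∈ P := by
    intro a ha
    by_cases h : a = 0
    · simpa [h] using h0
    have := hp.mul _ ha _ (hp.sq a⁻¹)
    rwa [← mul_assoc, mul_inv_cancel₀ h, one_mul] at this
  have hanti : ∀ a, a ∈ P → -a ∈ P → a = 0 := by
    intro a ha hna
    by_contra h
    apply hp.neg
    have := hp.mul _ hna _ (hinv a ha)
    rwa [neg_mul, mul_inv_cancel₀ h] at this
  have htot : ∀ a, a ∈ P ∨ -a ∈ P := by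
    intro a
    by_contra! hcon
    obtain ⟨ha, hna⟩ := hcon
    have hQ : IsPre {x | ∃ p ∈ P, ∃ q ∈ P, x = p + q * a} := by
      refine ⟨?_, ?_, ?_, ?_⟩
      · rintro _ ⟨p, hp1, q, hq1, rfl⟩ _ ⟨p', hp2, q', hq2, rfl⟩
        exact ⟨p + p', hp.add _ hp1 _ hp2, q + q', hp.add _ hq1 _ hq2, by ring⟩
      · rintro _ ⟨p, hp1, q, hq1, rfl⟩ _ ⟨p', hp2, q', hq2, rfl⟩
        exact ⟨p * p' + q * q' * (a * a), hp.add _ (hp.mul _ hp1 _ hp2) _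
          (hp.mul _ (hp.mul _ hq1 _ hq2) _ (hp.sq a)), p * q' + q * p',
          hp.add _ (hp.mul _ hp1 _ hq2) _ (hp.mul _ hq1 _ hp2), by ring⟩
      · intro x; exact ⟨x * x, hp.sq x, 0, h0, by ring⟩
      · rintro ⟨p, hp1, q, hq1, he⟩
        by_cases hq : q = 0
        · subst hq; simp at he; rw [← he] at hp1; exact hp.neg hp1
        · apply hna
          have : -a = (1 + p) * q⁻¹ := by
            field_simp; linear_combination he
          rw [this]
          exact hp.mul _ (hp.add _ h1 _ hp1) _ (hinv q hq1)
    have hsub : P ⊆ {x | ∃ p ∈ P, ∃ q ∈ P, x = p + q * a} :=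
      fun x hx => ⟨x, hx, 0, h0, by ring⟩
    exact ha (hP.2 hQ hsub ⟨0, h0, 1, h1, by ring⟩)
  let lo : LinearOrder K :=
    { le := fun a b => b - a ∈ P
      le_refl := fun a => by simpa using h0
      le_trans := fun a b c hab hbc => by
        have := hp.add _ hab _ hbc
        rwa [sub_add_sub_cancel'] at this
      le_antisymm := fun a b hab hba => by
        have h2 : b - a ∈ P := hab
        have h3 : a - b ∈ P := hba
        have := hanti (b - a) h2 (by rwa [neg_sub])
        exact (sub_eq_zero.1 this).symm
      le_total := fun a b => by
        have := htot (b - a)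
        rwa [neg_sub] at this
      toDecidableLE := Classical.decRel _ }
  refine ⟨lo, ?_⟩
  have hle : ∀ a b : K, a ≤ b ↔ b - a ∈ P := fun a b => Iff.rfl
  have : IsOrderedAddMonoid K := ⟨fun a b hab c => by
    rw [hle] at hab ⊢; simpa using hab, fun a b hab c => by
    rw [hle] at hab ⊢; simpa using hab⟩
  have : ZeroLEOneClass K := ⟨(hle _ _).2 (by simpa using h1)⟩
  apply IsStrictOrderedRing.of_mul_pos
  intro a b ha hb
  have h2 : a ∈ P := by simpa using (hle 0 a).1 ha.le
  have h3 : b ∈ P := by simpa using (hle 0 b).1 hb.le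
  refine lt_of_le_of_ne ((hle _ _).2 (by simpa using hp.mul _ h2 _ h3)) ?_
  exact (mul_ne_zero ha.ne' hb.ne').symm

end Strip

namespace Strip
open Polynomial

def FR (R : Type*) [CommRing R] : Prop :=
  ∀ (n : ℕ) (c : ℕ → R), ∑ i ∈ Finset.range n, c i ^ 2 = 0 → ∀ i < n, c i = 0

lemma IsSumSq.exists_sum {R : Type*} [CommRing R] {a : R} (h : IsSumSq a) :
    ∃ (n : ℕ) (c : ℕ → R), a = ∑ i ∈ Finset.range n, c i ^ 2 := by
  induction h with
  | zero => exact ⟨0, 0, by simp⟩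
  | sq_add b hs ih =>
    obtain ⟨n, c, rfl⟩ := ih
    refine ⟨n + 1, fun i => if i = n then b else c i, ?_⟩
    rw [Finset.sum_range_succ]
    beta_reduce
    rw [if_pos rfl, add_comm, pow_two b]
    congr 1
    apply Finset.sum_congr rfl
    intro i hi
    rw [if_neg (by have := Finset.mem_range.1 hi; omega)]

lemma coeff_sum_sq {R : Type*} [CommRing R] (n m : ℕ) (r : ℕ → R[X])
    (h : ∀ i < n, (r i).natDegree ≤ m) :
    (∑ i ∈ Finset.range n, r i ^ 2).coeff (2 * m) = ∑ i ∈ Finset.range n, ((r i).coeff m) ^ 2 := by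
  rw [finsetSum_coeff]
  apply Finset.sum_congr rfl
  intro i hi
  exact coeff_pow_of_natDegree_le (h i (Finset.mem_range.1 hi))

lemma natDegree_of_sum_sq {R : Type*} [CommRing R] (hR : FR R) (n d : ℕ) (r : ℕ → R[X])
    (h : (∑ i ∈ Finset.range n, r i ^ 2).natDegree ≤ 2 * d) : ∀ i < n, (r i).natDegree ≤ d := by
  intro i hi
  by_contra hcon
  push Not at hcon
  set m := (Finset.range n).sup (fun i => (r i).natDegree) with hm
  have hle : ∀ i < n, (r i).natDegree ≤ m := fun i hi =>
    Finset.le_sup (f := fun i => (r i).natDegree) (Finset.mem_range.2 hi)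
  have hdm : d < m := lt_of_lt_of_le hcon (hle i hi)
  obtain ⟨j, hj, hjm⟩ := Finset.exists_mem_eq_sup (Finset.range n) ⟨i, Finset.mem_range.2 hi⟩
    (fun i => (r i).natDegree)
  have h0 := coeff_sum_sq n m r hle
  rw [coeff_eq_zero_of_natDegree_lt (by omega)] at h0
  have h1 := hR n _ h0.symm j (Finset.mem_range.1 hj)
  rw [hm, hjm] at h1
  simp only [coeff_natDegree, leadingCoeff_eq_zero] at h1
  rw [h1, natDegree_zero] at hjm
  rw [hjm] at hm
  omega

lemma FR.poly {R : Type*} [CommRing R] (hR : FR R) : FR R[X] := by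
  intro n r h i hi
  have h0 := natDegree_of_sum_sq hR n 0 r (by rw [h]; simp)
  have h1 := coeff_sum_sq n 0 r h0
  rw [h, coeff_zero] at h1
  have h2 := hR n _ h1.symm i hi
  rw [eq_C_of_natDegree_le_zero (h0 i hi), h2, C_0]

lemma FR.one_add_ne {R : Type*} [CommRing R] [Nontrivial R] (hR : FR R) (n : ℕ) (r : ℕ → R) :
    1 + ∑ i ∈ Finset.range n, r i ^ 2 ≠ 0 := by
  intro h0
  have h1 := hR (n + 1) (fun i => if i = n then 1 else r i) (by
    rw [Finset.sum_range_succ]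
    beta_reduce
    rw [if_pos rfl, ← h0, add_comm, one_pow]
    congr 1
    apply Finset.sum_congr rfl
    intro i hi
    rw [if_neg (by have := Finset.mem_range.1 hi; omega)]) n (by omega)
  simp at h1

set_option maxHeartbeats 1000000 in
theorem cassels {k : Type*} [Field k] (hk : FR k) (f : k[X]) (m n : ℕ) :
    ∀ (q : k[X]) (h : ℕ → k[X]), q ≠ 0 → q.natDegree ≤ m →
      q ^ 2 * f = ∑ i ∈ Finset.range n, h i ^ 2 → IsSumSq f := by
  induction m with
  | zero =>
    intro q h hq hm he
    obtain ⟨c, rfl⟩ : ∃ c, q = C c := ⟨_, eq_C_of_natDegree_le_zero hm⟩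
    have hc : c ≠ 0 := by rintro rfl; simp at hq
    have : f = (C c⁻¹ ^ 2) * ∑ i ∈ Finset.range n, h i ^ 2 := by
      rw [← he, ← mul_assoc, ← mul_pow, ← C_mul, inv_mul_cancel₀ hc]; simp
    rw [this]
    exact (isSumSq_sq _).mul (IsSumSq.sum_sq _ _)
  | succ m ih =>
    intro q h hq hm he
    by_cases hr : ∀ i < n, h i % q = 0
    · have h1 : q ^ 2 * f = q ^ 2 * ∑ i ∈ Finset.range n, (h i / q) ^ 2 := by
        rw [he, Finset.mul_sum]
        apply Finset.sum_congr rfl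
        intro i hi
        conv_lhs => rw [← EuclideanDomain.div_add_mod (h i) q, hr i (Finset.mem_range.1 hi)]
        ring
      rw [mul_left_cancel₀ (pow_ne_zero 2 hq) h1]
      exact IsSumSq.sum_sq _ _
    · push Not at hr
      obtain ⟨i0, hi0, hri0⟩ := hr
      set s := fun i => h i / q with hs
      set r := fun i => h i % q with hrdef
      have hdiv : ∀ i, h i = q * s i + r i := fun i => (EuclideanDomain.div_add_mod (h i) q).symm
      set Bss := ∑ i ∈ Finset.range n, s i ^ 2 with hBss
      set Bsr := ∑ i ∈ Finset.range n, s i * r i with hBsr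
      set Brr := ∑ i ∈ Finset.range n, r i ^ 2 with hBrr
      have hexp : q ^ 2 * f = q ^ 2 * Bss + 2 * q * Bsr + Brr := by
        rw [he, hBss, hBsr, hBrr, Finset.mul_sum, Finset.mul_sum, ← Finset.sum_add_distrib,
          ← Finset.sum_add_distrib]
        apply Finset.sum_congr rfl
        intro i _
        rw [hdiv i]; ring
      set Q := q * (f - Bss) - 2 * Bsr with hQ
      have hqQ : Brr = q * Q := by rw [hQ]; linear_combination hexp.symm
      have hBrr0 : Brr ≠ 0 := fun h0 => hri0 (hk.poly n r h0 i0 hi0)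
      have hQ0 : Q ≠ 0 := by rintro h0; rw [h0, mul_zero] at hqQ; exact hBrr0 hqQ
      have hrd : ∀ i, (r i).natDegree ≤ q.natDegree - 1 := by
        intro i
        rcases Nat.eq_zero_or_pos q.natDegree with h0 | h0
        · exfalso
          obtain ⟨c, hc⟩ : ∃ c, q = C c := ⟨_, eq_C_of_natDegree_le_zero h0.le⟩
          have hc0 : c ≠ 0 := by rintro rfl; simp at hc; exact hq hc
          apply hri0
          rw [hc]
          exact EuclideanDomain.mod_eq_zero.2 ((isUnit_C.2 hc0.isUnit).dvd)
        · have := natDegree_mod_lt (h i) h0.ne'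
          change (h i % q).natDegree ≤ _
          omega
      have hBd : Brr.natDegree ≤ 2 * (q.natDegree - 1) := by
        apply natDegree_sum_le_of_forall_le
        intro i _
        exact natDegree_pow_le_of_le 2 (hrd i)
      have hQd : Q.natDegree ≤ m := by
        rw [hqQ, natDegree_mul hq hQ0] at hBd
        omega
      apply ih Q (fun i => Q * s i + (Bss - f) * r i) hQ0 hQd
      have : ∑ i ∈ Finset.range n, (Q * s i + (Bss - f) * r i) ^ 2
          = Q ^ 2 * Bss + 2 * Q * (Bss - f) * Bsr + (Bss - f) ^ 2 * Brr := by
        rw [hBss, hBsr, hBrr, Finset.mul_sum, Finset.mul_sum, Finset.mul_sum,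
          ← Finset.sum_add_distrib, ← Finset.sum_add_distrib]
        apply Finset.sum_congr rfl
        intro i _; ring
      rw [this, hqQ, hQ]; ring

theorem cassels' {k : Type*} [Field k] (hk : FR k) (f q : k[X]) (hq : q ≠ 0)
    (h : IsSumSq (q ^ 2 * f)) : IsSumSq f := by
  obtain ⟨n, c, hc⟩ := IsSumSq.exists_sum h
  exact cassels hk f _ n q c hq le_rfl hc

set_option maxHeartbeats 1000000 in
/-- if `-1` is a sum of squares modulo every irreducible factor of `q`, then a constant multiple
of `q` is a sum of squares. -/
theorem sos_of_factors {k : Type*} [Field k] (hk : FR k) (m : ℕ) : ∀ q : k[X], q ≠ 0 →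
    q.natDegree ≤ m → (∀ g, Irreducible g → g ∣ q → ∃ S, IsSumSq S ∧ g ∣ 1 + S) →
    ∃ c : k, c ≠ 0 ∧ IsSumSq (C c * q) := by
  induction m with
  | zero =>
    intro q hq hm _
    obtain ⟨c, rfl⟩ : ∃ c, q = C c := ⟨_, eq_C_of_natDegree_le_zero hm⟩
    have hc : c ≠ 0 := by rintro rfl; simp at hq
    exact ⟨c⁻¹, inv_ne_zero hc, by rw [← C_mul, inv_mul_cancel₀ hc, C_1]; exact .one⟩
  | succ m ih =>
    intro q hq hm hfac
    by_cases hqm : q.natDegree ≤ m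
    · exact ih q hq hqm hfac
    have hu : ¬ IsUnit q := by
      intro hu; have := natDegree_eq_zero_of_isUnit hu; omega
    by_cases hirr : Irreducible q
    · obtain ⟨S, hS, hd⟩ := hfac q hirr dvd_rfl
      obtain ⟨n, c, hc⟩ := IsSumSq.exists_sum hS
      set r := fun i => c i % q with hr
      set S' := ∑ i ∈ Finset.range n, r i ^ 2 with hS'
      have hSS : q ∣ 1 + S' := by
        have : q ∣ S - S' := by
          rw [hc, hS', ← Finset.sum_sub_distrib]
          apply Finset.dvd_sum
          intro i _
          have : q ∣ c i - r i := by
            refine ⟨c i / q, ?_⟩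
            have := EuclideanDomain.div_add_mod (c i) q
            change _ - c i % q = _
            linear_combination -this
          exact (this.trans ⟨c i + r i, by ring⟩)
        have h2 := dvd_sub hd this
        rwa [show 1 + S - (S - S') = 1 + S' by ring] at h2
      obtain ⟨t, ht⟩ := hSS
      have hr0 : (1 + S') ≠ 0 := hk.poly.one_add_ne n r
      have ht0 : t ≠ 0 := by rintro rfl; rw [mul_zero] at ht; exact hr0 ht
      have hdeg : (1 + S').natDegree ≤ 2 * (q.natDegree - 1) := by
        refine (natDegree_add_le _ _).trans (max_le (by simp) ?_)
        apply natDegree_sum_le_of_forall_le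
        intro i _
        apply natDegree_pow_le_of_le 2
        have := natDegree_mod_lt (c i) (show q.natDegree ≠ 0 by omega)
        change (c i % q).natDegree ≤ _
        omega
      rw [ht, natDegree_mul hq ht0] at hdeg
      obtain ⟨b, hb0, hb⟩ := ih t ht0 (by omega) (fun g _ hgt =>
        ⟨S', IsSumSq.sum_sq _ _, ht ▸ (hgt.mul_left q)⟩)
      refine ⟨b, hb0, cassels' hk _ t ht0 ?_⟩
      have : t ^ 2 * (C b * q) = (C b * t) * (1 + S') := by rw [ht]; ring
      rw [this]
      exact hb.mul (IsSumSq.one.add (IsSumSq.sum_sq _ _))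
    · obtain ⟨a, b, hab, ha, hb⟩ : ∃ a b, q = a * b ∧ ¬ IsUnit a ∧ ¬ IsUnit b := by
        rw [irreducible_iff] at hirr
        push Not at hirr
        obtain ⟨a, b, h1, h2, h3⟩ := hirr hu
        exact ⟨a, b, h1, h2, h3⟩
      have ha0 : a ≠ 0 := by rintro rfl; simp at hab; exact hq hab
      have hb0 : b ≠ 0 := by rintro rfl; simp at hab; exact hq hab
      have had : 0 < a.natDegree := by
        by_contra h; exact ha (isUnit_iff_degree_eq_zero.2 (by
          rw [degree_eq_natDegree ha0]; norm_cast; omega))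
      have hbd : 0 < b.natDegree := by
        by_contra h; exact hb (isUnit_iff_degree_eq_zero.2 (by
          rw [degree_eq_natDegree hb0]; norm_cast; omega))
      rw [hab, natDegree_mul ha0 hb0] at hm
      obtain ⟨c, hc0, hc⟩ := ih a ha0 (by omega) (fun g hg hd =>
        hfac g hg (hab ▸ hd.mul_right b))
      obtain ⟨e, he0, he⟩ := ih b hb0 (by omega) (fun g hg hd =>
        hfac g hg (hab ▸ hd.mul_left a))
      refine ⟨c * e, mul_ne_zero hc0 he0, ?_⟩
      have := hc.mul he
      rwa [hab, C_mul, show C c * C e * (a * b) = C c * a * (C e * b) by ring]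

end Strip

namespace Strip
open Polynomial

section Ord
variable {K : Type*} [Field K] [LinearOrder K] [IsStrictOrderedRing K] [Algebra ℝ K]

local notation "ι" => algebraMap ℝ K

lemma io_nonneg {r : ℝ} (hr : 0 ≤ r) : 0 ≤ ι r := by
  rw [← Real.mul_self_sqrt hr, map_mul]; exact mul_self_nonneg _

lemma io_pos {r : ℝ} (hr : 0 < r) : 0 < ι r :=
  lt_of_le_of_ne (io_nonneg hr.le) (fun h => hr.ne' (by
    have := (map_eq_zero (algebraMap ℝ K)).1 h.symm; exact this))

lemma io_le {r s : ℝ} (h : r ≤ s) : ι r ≤ ι s := by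
  have := io_nonneg (K := K) (sub_nonneg.2 h)
  rw [map_sub] at this; linarith

lemma io_lt {r s : ℝ} (h : r < s) : ι r < ι s := by
  have := io_pos (K := K) (sub_pos.2 h)
  rw [map_sub] at this; linarith

lemma io_le_iff {r s : ℝ} : ι r ≤ ι s ↔ r ≤ s :=
  ⟨fun h => by by_contra hc; push Not at hc; exact absurd (io_lt (K := K) hc) (not_lt.2 h), io_le⟩

lemma io_abs (r : ℝ) : |ι r| = ι |r| := by
  rcases le_total 0 r with h | h
  · rw [abs_of_nonneg h, abs_of_nonneg (io_nonneg h)]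
  · rw [abs_of_nonpos h, abs_of_nonpos (by have := io_le (K := K) h; rwa [map_zero] at this),
      map_neg]

/-- finite elements -/
def Fi (a : K) : Prop := ∃ C : ℝ, |a| ≤ ι C
/-- infinitesimal elements -/
def Inf (a : K) : Prop := ∀ ε : ℝ, 0 < ε → |a| ≤ ι ε

variable (K) in
noncomputable def OO : Subalgebra ℝ K where
  carrier := {a | Fi a}
  mul_mem' := by
    rintro a b ⟨C, hC⟩ ⟨D, hD⟩
    refine ⟨C * D, ?_⟩
    rw [abs_mul, map_mul]
    exact mul_le_mul hC hD (abs_nonneg _) ((abs_nonneg _).trans hC)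
  add_mem' := by
    rintro a b ⟨C, hC⟩ ⟨D, hD⟩
    refine ⟨C + D, ?_⟩
    rw [map_add]
    exact (abs_add_le _ _).trans (add_le_add hC hD)
  algebraMap_mem' := fun r => ⟨|r|, (io_abs r).le⟩

lemma mem_OO {a : K} : a ∈ OO K ↔ Fi a := Iff.rfl

lemma Inf.fi {a : K} (h : Inf a) : Fi a := ⟨1, h 1 one_pos⟩

lemma Inf.add {a b : K} (ha : Inf a) (hb : Inf b) : Inf (a + b) := by
  intro ε hε
  have h1 := ha (ε / 2) (by positivity)
  have h2 := hb (ε / 2) (by positivity)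
  calc |a + b| ≤ |a| + |b| := abs_add_le _ _
    _ ≤ ι (ε / 2) + ι (ε / 2) := add_le_add h1 h2
    _ = ι ε := by rw [← map_add, add_halves]

lemma Inf.neg {a : K} (ha : Inf a) : Inf (-a) := fun ε hε => by rw [abs_neg]; exact ha ε hε

lemma Inf.mul {a b : K} (ha : Inf a) (hb : Fi b) : Inf (a * b) := by
  obtain ⟨C, hC⟩ := hb
  intro ε hε
  have h1 := ha (ε / (|C| + 1)) (by positivity)
  rw [abs_mul]
  calc |a| * |b| ≤ ι (ε / (|C| + 1)) * ι (|C| + 1) :=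
        mul_le_mul h1 (hC.trans (io_le (by have := le_abs_self C; linarith))) (abs_nonneg _)
          ((abs_nonneg _).trans h1)
    _ = ι ε := by rw [← map_mul]; congr 1; field_simp

lemma Inf.pow {a : K} (ha : Inf a) (n : ℕ) (hn : 0 < n) : Inf (a ^ n) := by
  obtain ⟨m, rfl⟩ : ∃ m, n = m + 1 := ⟨n - 1, by omega⟩
  rw [pow_succ']
  exact ha.mul (mem_OO.1 (pow_mem (S := OO K) ha.fi m))

lemma Inf.of_le {a b : K} (hb : Inf b) (h : |a| ≤ |b|) : Inf a := fun ε hε => h.trans (hb ε hε)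

lemma not_inf_io {r : ℝ} (hr : r ≠ 0) : ¬ Inf (ι r) := by
  intro h
  have := h (|r| / 2) (by positivity)
  rw [io_abs, io_le_iff] at this
  have := abs_pos.2 hr
  linarith

lemma std_part {a : K} (ha : Fi a) : ∃ c : ℝ, Inf (a - ι c) := by
  obtain ⟨C, hC⟩ := ha
  obtain ⟨h1, h2⟩ := abs_le.1 hC
  set S := {t : ℝ | ι t ≤ a} with hS
  have hne : S.Nonempty := ⟨-C, by rw [hS, Set.mem_ofPred_eq, map_neg]; exact h1⟩
  have hbd : BddAbove S := ⟨C, fun t ht => (io_le_iff (K := K)).1 (le_trans ht h2)⟩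
  refine ⟨sSup S, fun ε hε => ?_⟩
  rw [abs_le]
  constructor
  · obtain ⟨t, ht, hlt⟩ := exists_lt_of_lt_csSup hne (show sSup S - ε < sSup S by linarith)
    have h3 := io_le (K := K) hlt.le
    rw [map_sub] at h3
    have h4 : ι t ≤ a := ht
    linarith
  · by_contra hcon
    push Not at hcon
    have : sSup S + ε ∈ S := by
      rw [hS, Set.mem_ofPred_eq, map_add]; linarith
    have := le_csSup hbd this
    linarith

/-- elements with nonzero standard part are units -/
lemma fi_inv_of {a : K} {c : ℝ} (hc : c ≠ 0) (h : Inf (a - ι c)) : Fi a⁻¹ := by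
  have h1 := h (|c| / 2) (by positivity)
  have h2 : ι (|c| / 2) ≤ |a| := by
    have h3 : |ι c| ≤ |a| + |a - ι c| := by
      calc |ι c| = |a - (a - ι c)| := by congr 1; ring
        _ ≤ _ := abs_sub _ _
    rw [io_abs] at h3
    have : ι |c| = ι (|c| / 2) + ι (|c| / 2) := by rw [← map_add, add_halves]
    linarith
  have h3 : 0 < ι (|c| / 2) := io_pos (by positivity)
  refine ⟨(|c| / 2)⁻¹, ?_⟩
  rw [abs_inv, map_inv₀]
  exact inv_anti₀ h3 h2

lemma not_inf_inv {a : K} (ha : a ≠ 0) (h : Inf a) : ¬ Fi a⁻¹ := by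
  intro hf
  have := h.mul hf
  rw [mul_inv_cancel₀ ha, ← map_one (algebraMap ℝ K)] at this
  exact not_inf_io one_ne_zero this

lemma fi_div {a b : K} {C : ℝ} (hb : b ≠ 0) (h : |a| ≤ ι C * |b|) : Fi (a / b) :=
  ⟨C, by rw [abs_div, div_le_iff₀ (abs_pos.2 hb)]; exact h⟩

/-- evaluation of a real polynomial at an infinitesimal -/
lemma aeval_inf (p : ℝ[X]) {a : K} (ha : Inf a) : Inf (aeval a p - ι (p.coeff 0)) := by
  have h1 : p = X * p.divX + C (p.coeff 0) := (X_mul_divX_add p).symm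
  have : aeval a p - ι (p.coeff 0) = a * aeval a p.divX := by
    have h2 := congrArg (aeval a) h1
    rw [map_add, map_mul, aeval_X, aeval_C] at h2
    rw [h2]; ring
  rw [this]
  refine ha.mul (mem_OO.1 ?_)
  exact (aeval (⟨a, ha.fi⟩ : OO K) p.divX).2 |> fun h => by
    have h2 := Subalgebra.aeval_coe (OO K) (⟨a, ha.fi⟩ : OO K) p.divX
    rw [← h2] at h
    exact h

end Ord
end Strip

namespace Strip
open Polynomial

section Ord
variable {K : Type*} [Field K] [LinearOrder K] [IsStrictOrderedRing K] [Algebra ℝ K]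

local notation "ι" => algebraMap ℝ K

lemma fi_of_pow {a : K} (M : ℕ) (hM : 0 < M) (h : Fi (a ^ M)) : Fi a := by
  obtain ⟨C, hC⟩ := h
  refine ⟨max C 1, ?_⟩
  by_contra hcon
  push Not at hcon
  have h1 : (1 : K) ≤ ι (max C 1) := by
    rw [← map_one (algebraMap ℝ K)]; exact io_le (le_max_right _ _)
  have h2 : ι (max C 1) < |a| ^ M :=
    hcon.trans_le (le_self_pow₀ (h1.trans hcon.le) hM.ne')
  rw [abs_pow] at hC
  exact absurd (hC.trans (io_le (le_max_left C 1))) (not_le.2 h2)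

lemma exists_unif (z : K) (hz : Inf z) (hz0 : z ≠ 0) (M : ℕ) (hM : 0 < M)
    (H : ∀ a : K, a ≠ 0 → ∃ m : ℤ, Fi (a ^ M / z ^ m) ∧ Fi (z ^ m / a ^ M)) :
    ∃ π : K, π ≠ 0 ∧ Inf π ∧ (∀ a, Inf a → Fi (a / π)) ∧
      (∀ a, a ≠ 0 → ∃ e : ℕ, Fi (π ^ e / a)) := by
  classical
  have hzf : ∀ n : ℕ, Fi (z ^ n) := fun n => pow_mem (S := OO K) hz.fi n
  have fmul : ∀ {a b : K}, Fi a → Fi b → Fi (a * b) := fun ha hb => (OO K).mul_mem ha hb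
  have hex : ∃ m : ℕ, 0 < m ∧ ∃ a : K, a ≠ 0 ∧ Fi (a ^ M / z ^ m) ∧ Fi (z ^ m / a ^ M) :=
    ⟨M, hM, z, hz0, by rw [div_self (pow_ne_zero _ hz0)]; exact one_mem (OO K),
      by rw [div_self (pow_ne_zero _ hz0)]; exact one_mem (OO K)⟩
  obtain ⟨hm0, π, hπ0, h1, h2⟩ := Nat.find_spec hex
  have hmin := fun m => Nat.find_min' hex (m := m)
  set m0 := Nat.find hex with hm0def
  have hπinf : Inf π := by
    -- otherwise π⁻¹ is finite
    by_contra hcon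
    have hpi : Fi π⁻¹ := by
      unfold Inf at hcon
      push Not at hcon
      obtain ⟨ε, hε, hlt⟩ := hcon
      refine ⟨ε⁻¹, ?_⟩
      rw [abs_inv, map_inv₀]
      exact inv_anti₀ (io_pos hε) hlt.le
    have h3 : Inf (π ^ M) := by
      have := (hz.pow m0 hm0).mul h1
      rwa [mul_div_cancel₀ _ (pow_ne_zero _ hz0)] at this
    have h4 : Fi (π ^ M)⁻¹ := by
      rw [← inv_pow]; exact pow_mem (S := OO K) hpi M
    exact not_inf_inv (pow_ne_zero _ hπ0) h3 h4
  refine ⟨π, hπ0, hπinf, ?_, ?_⟩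
  · intro a ha
    by_cases ha0 : a = 0
    · rw [ha0, zero_div]; exact zero_mem (OO K)
    obtain ⟨m, h3, h4⟩ := H a ha0
    have hmpos : 0 < m := by
      by_contra hcon
      push Not at hcon
      obtain ⟨n, rfl⟩ : ∃ n : ℕ, m = -n := ⟨m.natAbs, by omega⟩
      -- z^(-n)/a^M finite, so (a^M)⁻¹ finite
      have h5 : Fi (a ^ M)⁻¹ := by
        have := fmul h4 (hzf n)
        rwa [zpow_neg, zpow_natCast, div_mul_eq_mul_div, inv_mul_cancel₀ (pow_ne_zero _ hz0),
          one_div] at this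
      exact not_inf_inv (pow_ne_zero _ ha0) (ha.pow M hM) h5
    obtain ⟨n, rfl⟩ : ∃ n : ℕ, m = n := ⟨m.natAbs, by omega⟩
    rw [zpow_natCast] at h3 h4
    have hn : m0 ≤ n := hmin n ⟨by exact_mod_cast hmpos, a, ha0, h3, h4⟩
    apply fi_of_pow M hM
    have h5 := fmul (fmul h3 (hzf (n - m0))) h2
    have h6 : z ^ n = z ^ (n - m0) * z ^ m0 := by rw [← pow_add]; congr 1; omega
    have : a ^ M / z ^ n * z ^ (n - m0) * (z ^ m0 / π ^ M) = (a / π) ^ M := by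
      rw [h6, div_pow]; field_simp
    rwa [this] at h5
  · intro a ha0
    obtain ⟨m, h3, h4⟩ := H a ha0
    refine ⟨m.natAbs, fi_of_pow M hM ?_⟩
    -- π^M / z is finite
    have h5 : Fi (π ^ M / z) := by
      have := fmul h1 (hzf (m0 - 1))
      have h6 : z ^ m0 = z ^ (m0 - 1) * z := by rw [← pow_succ]; congr 1; omega
      rwa [h6, show π ^ M / (z ^ (m0 - 1) * z) * z ^ (m0 - 1) = π ^ M / z by field_simp] at this
    have h6 : Fi (z ^ m.natAbs / z ^ m) := by
      rcases Int.natAbs_eq m with h | h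
      · have : z ^ m = z ^ m.natAbs := by conv_lhs => rw [h, zpow_natCast]
        rw [this, div_self (pow_ne_zero _ hz0)]; exact one_mem (OO K)
      · have : z ^ m = (z ^ m.natAbs)⁻¹ := by conv_lhs => rw [h, zpow_neg, zpow_natCast]
        rw [this, div_inv_eq_mul]; exact fmul (hzf _) (hzf _)
    have h7 := fmul (fmul (pow_mem (S := OO K) h5 m.natAbs) h6) h4
    have hzm : z ^ m ≠ 0 := zpow_ne_zero _ hz0
    have : (π ^ M / z) ^ m.natAbs * (z ^ m.natAbs / z ^ m) * (z ^ m / a ^ M)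
        = (π ^ m.natAbs / a) ^ M := by
      rw [div_pow, div_pow, ← pow_mul, ← pow_mul, mul_comm M]; field_simp
    rwa [this] at h7

lemma approx (π : K) (hπ0 : π ≠ 0) (hdiv : ∀ a, Inf a → Fi (a / π)) (b : K)
    (hb : Fi b) (N : ℕ) : ∃ φ : ℝ[X], Fi ((b - aeval π φ) / π ^ N) := by
  induction N with
  | zero => exact ⟨0, by simpa using hb⟩
  | succ N ih =>
    obtain ⟨φ, hφ⟩ := ih
    obtain ⟨c, hc⟩ := std_part hφ
    refine ⟨φ + C c * X ^ N, ?_⟩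
    have := hdiv _ hc
    convert this using 1
    simp only [map_add, map_mul, aeval_C, map_pow, aeval_X]
    field_simp
    ring

lemma X_pow_dvd_of_aeval (π : K) (hπ0 : π ≠ 0) (hπ : Inf π) (G : ℝ[X]) (N : ℕ)
    (h : Fi (aeval π G / π ^ N)) : X ^ N ∣ G := by
  induction N generalizing G with
  | zero => simp
  | succ N ih =>
    have h0 : G.coeff 0 = 0 := by
      by_contra hne
      have h1 := fi_inv_of hne (aeval_inf G hπ)
      have h2 : Inf (aeval π G) := by
        have := (hπ.pow (N + 1) (by omega)).mul h
        rwa [mul_div_cancel₀ _ (pow_ne_zero _ hπ0)] at this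
      have h3 : aeval π G ≠ 0 := by
        intro h3
        have := aeval_inf G hπ
        rw [h3, zero_sub] at this
        exact not_inf_io hne (by simpa using this.neg)
      exact not_inf_inv h3 h2 h1
    have h1 : G = X * G.divX := by
      conv_lhs => rw [← X_mul_divX_add G, h0]
      simp
    have h2 := ih G.divX (by
      convert h using 1
      conv_rhs => rw [h1, map_mul, aeval_X, pow_succ']
      field_simp)
    rw [h1, pow_succ']
    exact mul_dvd_mul_left X h2

end Ord
end Strip

namespace Strip
open Polynomial

lemma X_pow_factor (e : ℕ) : ∀ q : ℝ[X], ¬ X ^ (e + 1) ∣ q →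
    ∃ j ≤ e, ∃ P : ℝ[X], q = X ^ j * P ∧ P.eval 0 ≠ 0 := by
  induction e with
  | zero =>
    intro q hq
    rw [zero_add, pow_one, X_dvd_iff, coeff_zero_eq_eval_zero] at hq
    exact ⟨0, le_rfl, q, by simp, hq⟩
  | succ e ih =>
    intro q hq
    by_cases h0 : X ∣ q
    · obtain ⟨r, rfl⟩ := h0
      obtain ⟨j, hj, P, hP, h0⟩ := ih r (fun hd => hq (by
        rw [pow_succ']; exact mul_dvd_mul_left X hd))
      exact ⟨j + 1, by omega, P, by rw [hP, pow_succ']; ring, h0⟩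
    · rw [X_dvd_iff, coeff_zero_eq_eval_zero] at h0
      exact ⟨0, by omega, q, by simp, h0⟩

lemma real_contra (F : ℝ[X][X]) (p : ℝ[X]) (η : ℝ) (hη : 0 < η)
    (hF : ∀ x y, |x| < η → |p.eval x| ≤ F.evalEval x y)
    (ψ φ : ℝ[X]) (m D e N : ℕ) (hD : F.natDegree = D) (hψ : ψ.eval 0 = 0)
    (hN : e + m * D + 1 ≤ N) (hp : ¬ X ^ (e + 1) ∣ p.comp ψ)
    (hG : X ^ N ∣ ∑ i ∈ Finset.range (D + 1), (F.coeff i).comp ψ * φ ^ i * X ^ (m * (D - i))) :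
    False := by
  obtain ⟨j, hj, P, hP, hP0⟩ := X_pow_factor e _ hp
  obtain ⟨G, hG⟩ := hG
  have key : ∀ s : ℝ, s ≠ 0 → |s| < 1 → |ψ.eval s| < η → 0 ≤ |s| * |G.eval s| - |P.eval s| := by
    intro s hs0 hs1 hs
    have h1 := hF (ψ.eval s) (φ.eval s / s ^ m) hs
    have h2 : s ^ (m * D) * F.evalEval (ψ.eval s) (φ.eval s / s ^ m) = s ^ N * G.eval s := by
      have h3 := congrArg (eval s) hG
      rw [eval_mul, eval_pow, eval_X, eval_finsetSum] at h3
      rw [← h3]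
      conv_lhs => rw [as_sum_range_C_mul_X_pow' F (show F.natDegree < D + 1 by omega)]
      simp only [evalEval_finsetSum, evalEval_mul, evalEval_pow, evalEval_C, evalEval_X,
        Finset.mul_sum]
      apply Finset.sum_congr rfl
      intro i hi
      have hi' : i ≤ D := by have := Finset.mem_range.1 hi; omega
      simp only [eval_mul, eval_pow, eval_comp, eval_X]
      have : s ^ (m * D) = s ^ (m * (D - i)) * (s ^ m) ^ i := by
        rw [← pow_mul, ← pow_add]; congr 1; rw [← mul_add]; congr 1; omega
      rw [this, div_pow]
      have : (s ^ m) ^ i ≠ 0 := pow_ne_zero _ (pow_ne_zero _ hs0)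
      field_simp
    have h4 : p.eval (ψ.eval s) = s ^ j * P.eval s := by
      have := congrArg (eval s) hP
      rwa [eval_comp, eval_mul, eval_pow, eval_X] at this
    rw [h4] at h1
    have h5 : |s| ^ (m * D + j) * |P.eval s| ≤ |s| ^ (m * D + j) * (|s| * |G.eval s|) := by
      calc |s| ^ (m * D + j) * |P.eval s| = |s| ^ (m * D) * |s ^ j * P.eval s| := by
            rw [abs_mul, abs_pow, pow_add]; ring
        _ ≤ |s| ^ (m * D) * |F.evalEval (ψ.eval s) (φ.eval s / s ^ m)| := by
            exact mul_le_mul_of_nonneg_left (h1.trans (le_abs_self _)) (by positivity)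
        _ = |s| ^ N * |G.eval s| := by rw [← abs_pow, ← abs_mul, h2, abs_mul, abs_pow]
        _ ≤ |s| ^ (m * D + j + 1) * |G.eval s| := by
            apply mul_le_mul_of_nonneg_right _ (abs_nonneg _)
            exact pow_le_pow_of_le_one (abs_nonneg _) hs1.le (by omega)
        _ = _ := by ring
    have h6 := le_of_mul_le_mul_left h5 (by positivity)
    linarith
  have hcont : Continuous fun s : ℝ => |s| * |G.eval s| - |P.eval s| := by
    have := G.continuous
    have := P.continuous
    fun_prop
  have ht : Filter.Tendsto (fun s : ℝ => |s| * |G.eval s| - |P.eval s|) (nhdsWithin 0 {0}ᶜ)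
      (nhds (|0| * |G.eval 0| - |P.eval 0|)) := hcont.continuousAt.tendsto.mono_left nhdsWithin_le_nhds
  have hev : ∀ᶠ s in nhdsWithin (0 : ℝ) {0}ᶜ, 0 ≤ |s| * |G.eval s| - |P.eval s| := by
    have e1 : ∀ᶠ s in nhds (0 : ℝ), |s| < 1 := by
      apply (continuous_abs.tendsto (0 : ℝ)).eventually_lt_const; simp
    have e2 : ∀ᶠ s in nhds (0 : ℝ), |ψ.eval s| < η := by
      apply ((continuous_abs.comp ψ.continuous).tendsto (0 : ℝ)).eventually_lt_const
      simpa [hψ] using hη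
    filter_upwards [self_mem_nhdsWithin, nhdsWithin_le_nhds e1, nhdsWithin_le_nhds e2] with s h0 h1 h2
    exact key s h0 h1 h2
  have := ge_of_tendsto ht hev
  have h7 := abs_pos.2 hP0
  simp at this
  exact hP0 this

section Ord
variable {K : Type*} [Field K] [LinearOrder K] [IsStrictOrderedRing K] [Algebra ℝ K]

local notation "ι" => algebraMap ℝ K

lemma aeval_sub_fi (π : K) (hπ : Inf π) (hπ0 : π ≠ 0) (N : ℕ) (p : ℝ[X]) (a b : K) (ha : Fi a)
    (hb : Fi b) (h : Fi ((a - b) / π ^ N)) : Fi ((aeval a p - aeval b p) / π ^ N) := by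
  set a' : OO K := ⟨a, ha⟩
  set b' : OO K := ⟨b, hb⟩
  obtain ⟨t, ht⟩ : a' - b' ∣ aeval a' p - aeval b' p := by
    rw [aeval_def, aeval_def, ← eval_map, ← eval_map]; exact sub_dvd_eval_sub _ _ _
  have h2 := congrArg (Subtype.val) ht
  have ha2 : ((aeval a' p : OO K) : K) = aeval a p := (Subalgebra.aeval_coe (OO K) a' p).symm
  have hb2 : ((aeval b' p : OO K) : K) = aeval b p := (Subalgebra.aeval_coe (OO K) b' p).symm
  have h3 : aeval a p - aeval b p = (a - b) * t.1 := by
    rw [← ha2, ← hb2]; exact h2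
  rw [h3, mul_div_right_comm]
  exact (OO K).mul_mem h t.2

lemma aeval_fi {a : K} (ha : Fi a) (p : ℝ[X]) : Fi (aeval a p) := by
  have ha2 : ((aeval (⟨a, ha⟩ : OO K) p : OO K) : K) = aeval a p :=
    (Subalgebra.aeval_coe (OO K) (⟨a, ha⟩ : OO K) p).symm
  rw [← ha2]; exact (aeval (⟨a, ha⟩ : OO K) p).2

lemma mul_sub_fi (c : K) (a b a' b' : K) (ha : Fi a) (hb' : Fi b')
    (h1 : Fi ((a - a') / c)) (h2 : Fi ((b - b') / c)) : Fi ((a * b - a' * b') / c) := by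
  have : (a * b - a' * b') / c = a * ((b - b') / c) + ((a - a') / c) * b' := by ring
  rw [this]
  exact (OO K).add_mem ((OO K).mul_mem ha h2) ((OO K).mul_mem h1 hb')

lemma pow_sub_fi (c : K) (a a' : K) (ha : Fi a) (ha' : Fi a')
    (h1 : Fi ((a - a') / c)) (n : ℕ) : Fi ((a ^ n - a' ^ n) / c) := by
  induction n with
  | zero => simp; exact (OO K).zero_mem
  | succ n ih =>
    rw [pow_succ, pow_succ]
    exact mul_sub_fi c _ _ _ _ ((OO K).pow_mem ha n) ha' ih h1

theorem no_root (z : K) (hz : Inf z) (hz0 : z ≠ 0) (M : ℕ) (hM : 0 < M)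
    (H : ∀ a : K, a ≠ 0 → ∃ m : ℤ, Fi (a ^ M / z ^ m) ∧ Fi (z ^ m / a ^ M))
    (F : ℝ[X][X]) (p : ℝ[X]) (hp : p ≠ 0) (η : ℝ) (hη : 0 < η)
    (hF : ∀ x y, |x| < η → |p.eval x| ≤ F.evalEval x y) (α : K) :
    ∑ i ∈ Finset.range (F.natDegree + 1), aeval z (F.coeff i) * α ^ i ≠ 0 := by
  intro h0
  obtain ⟨π, hπ0, hπ, hdiv, hdvd⟩ := exists_unif z hz hz0 M hM H
  obtain ⟨m, hm⟩ : ∃ m : ℕ, Fi (π ^ m * α) := by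
    by_cases hα : α = 0
    · exact ⟨0, by rw [hα, mul_zero]; exact (OO K).zero_mem⟩
    · obtain ⟨e, he⟩ := hdvd α⁻¹ (inv_ne_zero hα)
      exact ⟨e, by rwa [div_inv_eq_mul] at he⟩
  have ha0 : aeval z p ≠ 0 := by
    intro ha
    have := X_pow_dvd_of_aeval z hz0 hz p (p.natDegree + 1) (by
      rw [ha, zero_div]; exact (OO K).zero_mem)
    have := natDegree_le_of_dvd this hp
    rw [natDegree_X_pow] at this
    omega
  obtain ⟨e, he⟩ := hdvd _ ha0
  set D := F.natDegree with hD
  set N := e + m * D + 1 with hN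
  obtain ⟨ψ, hψ⟩ := approx π hπ0 hdiv z hz.fi N
  obtain ⟨φ, hφ⟩ := approx π hπ0 hdiv _ hm N
  have hψ0 : ψ.eval 0 = 0 := by
    rw [← coeff_zero_eq_eval_zero]
    by_contra hne
    have h1 : Inf (z - aeval π ψ) := by
      have := (hπ.pow N (by omega)).mul hψ
      rwa [mul_div_cancel₀ _ (pow_ne_zero _ hπ0)] at this
    have h2 := aeval_inf ψ hπ
    have h3 := ((h1.add h2).neg.add hz)
    rw [show -(z - aeval π ψ + (aeval π ψ - ι (ψ.coeff 0))) + z = ι (ψ.coeff 0) by ring] at h3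
    exact not_inf_io hne h3
  have hψf : Fi (aeval π ψ) := aeval_fi hπ.fi ψ
  have hφf : Fi (aeval π φ) := aeval_fi hπ.fi φ
  refine real_contra F p η hη hF ψ φ m D e N rfl hψ0 le_rfl ?_ ?_
  · rintro ⟨t, ht⟩
    have h1 := aeval_sub_fi π hπ hπ0 N p _ _ hz.fi hψf hψ
    have h2 : aeval (aeval π ψ) p = π ^ (e + 1) * aeval π t := by
      have := congrArg (aeval π) ht
      rwa [aeval_comp, map_mul, map_pow, aeval_X] at this
    have h3 : Fi (aeval z p / π ^ (e + 1)) := by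
      have h4 := (OO K).add_mem ((OO K).mul_mem h1 ((OO K).pow_mem hπ.fi (m * D)))
        (aeval_fi hπ.fi t)
      have : (aeval z p - aeval (aeval π ψ) p) / π ^ N * π ^ (m * D) + aeval π t
          = aeval z p / π ^ (e + 1) := by
        rw [h2, show N = e + 1 + m * D by omega, pow_add π (e + 1)]
        field_simp
        ring
      rwa [this] at h4
    have h5 : Fi π⁻¹ := by
      have := (OO K).mul_mem he h3
      have h6 : π ^ e / aeval z p * (aeval z p / π ^ (e + 1)) = π⁻¹ := by
        rw [pow_succ]; field_simp
      rwa [h6] at this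
    exact not_inf_inv hπ0 hπ h5
  · apply X_pow_dvd_of_aeval π hπ0 hπ
    have h1 : ∑ i ∈ Finset.range (D + 1), aeval z (F.coeff i) * (π ^ m * α) ^ i * π ^ (m * (D - i))
        = 0 := by
      rw [← mul_zero (π ^ (m * D)), ← h0, Finset.mul_sum]
      apply Finset.sum_congr rfl
      intro i hi
      have hi' : i ≤ D := by have := Finset.mem_range.1 hi; omega
      have : π ^ (m * D) = π ^ (m * (D - i)) * (π ^ m) ^ i := by
        rw [← pow_mul, ← pow_add]; congr 1; rw [← mul_add]; congr 1; omega
      rw [this, mul_pow]; ring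
    have h2 : aeval π (∑ i ∈ Finset.range (D + 1), (F.coeff i).comp ψ * φ ^ i * X ^ (m * (D - i)))
        = - ∑ i ∈ Finset.range (D + 1), (aeval z (F.coeff i) * (π ^ m * α) ^ i
          - aeval (aeval π ψ) (F.coeff i) * (aeval π φ) ^ i) * π ^ (m * (D - i)) := by
      have h3 : ∀ i, (aeval z (F.coeff i) * (π ^ m * α) ^ i
          - aeval (aeval π ψ) (F.coeff i) * (aeval π φ) ^ i) * π ^ (m * (D - i))
          = aeval z (F.coeff i) * (π ^ m * α) ^ i * π ^ (m * (D - i))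
          - aeval (aeval π ψ) (F.coeff i) * (aeval π φ) ^ i * π ^ (m * (D - i)) := fun i => by ring
      simp only [h3, Finset.sum_sub_distrib, h1, map_sum, map_mul, map_pow, aeval_comp, aeval_X]
      ring
    rw [h2, neg_div, Finset.sum_div]
    refine (OO K).neg_mem ((OO K).sum_mem ?_)
    intro i _
    rw [mul_div_right_comm]
    refine (OO K).mul_mem ?_ ((OO K).pow_mem hπ.fi _)
    exact mul_sub_fi _ _ _ _ _ (aeval_fi hz.fi _) ((OO K).pow_mem hφf i)
      (aeval_sub_fi π hπ hπ0 N _ _ _ hz.fi hψf hψ) (pow_sub_fi _ _ _ hm hφf hφ i)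

end Ord
end Strip

namespace Strip
open PowerSeries

lemma ps_isSquare (u : PowerSeries ℝ) (hu : 0 < constantCoeff u) : IsSquare u := by
  set c := constantCoeff u with hc
  set g : PowerSeries ℝ := C c⁻¹ * u - 1 with hg
  have hg0 : constantCoeff g = 0 := by
    rw [hg, map_sub, map_mul, constantCoeff_C, map_one, ← hc, inv_mul_cancel₀ hu.ne', sub_self]
  have hs : HasSubst g := HasSubst.of_constantCoeff_zero' hg0
  set b : PowerSeries ℝ := binomialSeries ℝ (1 / 2 : ℝ) with hb
  have hbb : b * b = 1 + X := by
    rw [hb, ← binomialSeries_add]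
    have := binomialSeries_nat (R := ℝ) (A := ℝ) 1
    norm_num at this ⊢
    exact this
  have h1 := congrArg (PowerSeries.subst g) hbb
  have h2 : PowerSeries.subst g (1 + X : PowerSeries ℝ) = 1 + g := by
    rw [← coe_substAlgHom hs, map_add, map_one, coe_substAlgHom, subst_X hs]
  rw [h2, subst_mul hs] at h1
  refine ⟨C (√c) * PowerSeries.subst g b, ?_⟩
  have h3 : u = C c * (1 + g) := by
    rw [hg, add_sub_cancel, ← mul_assoc, ← map_mul, mul_inv_cancel₀ hu.ne', map_one, one_mul]
  rw [h3, ← h1]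
  have : (C c : PowerSeries ℝ) = C (√c) * C (√c) := by rw [← map_mul, Real.mul_self_sqrt hu.le]
  rw [this]; ring

lemma ps_factor (u : PowerSeries ℝ) (hu : u ≠ 0) :
    ∃ (n : ℕ) (v : PowerSeries ℝ), constantCoeff v ≠ 0 ∧ u = X ^ n * v := by
  classical
  have h := PowerSeries.exists_coeff_ne_zero_iff_ne_zero.2 hu
  set n := Nat.find h
  obtain ⟨v, hv⟩ : X ^ n ∣ u := X_pow_dvd_iff.2 (fun m hm => by
    have := Nat.find_min h hm; push Not at this; exact this)
  refine ⟨n, v, ?_, hv⟩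
  have h2 : coeff n u ≠ 0 := Nat.find_spec h
  rw [hv, coeff_X_pow_mul', if_pos le_rfl] at h2
  simpa using h2

lemma ps_X_dvd_of_sum_sq (n : ℕ) (c : ℕ → PowerSeries ℝ)
    (h : X ∣ ∑ i ∈ Finset.range n, c i ^ 2) : ∀ i < n, X ∣ c i := by
  intro i hi
  rw [X_dvd_iff] at h ⊢
  rw [map_sum, Finset.sum_eq_zero_iff_of_nonneg] at h
  · have := h i (Finset.mem_range.2 hi)
    rw [map_pow] at this
    exact pow_eq_zero_iff two_ne_zero |>.1 this
  · intro j _; rw [map_pow]; positivity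

lemma ps_FR : FR (PowerSeries ℝ) := by
  intro n c h i hi
  have key : ∀ (N : ℕ) (c : ℕ → PowerSeries ℝ), ∑ i ∈ Finset.range n, c i ^ 2 = 0 →
      ∀ i < n, X ^ N ∣ c i := by
    intro N
    induction N with
    | zero => intro c _ i _; simp
    | succ N ih =>
      intro c hc
      have h1 := ps_X_dvd_of_sum_sq n c (by rw [hc]; simp)
      choose! d hd using h1
      have h2 : ∑ i ∈ Finset.range n, d i ^ 2 = 0 := by
        have : X ^ 2 * ∑ i ∈ Finset.range n, d i ^ 2 = 0 := by
          rw [← hc, Finset.mul_sum]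
          apply Finset.sum_congr rfl
          intro i hi
          rw [hd i (Finset.mem_range.1 hi)]; ring
        exact (mul_eq_zero.1 this).resolve_left (pow_ne_zero _ X_ne_zero)
      intro i hi
      rw [hd i hi, pow_succ']
      exact mul_dvd_mul_left X (ih d h2 i hi)
  ext m
  exact X_pow_dvd_iff.1 (key (m + 1) c h i hi) m (by omega)

lemma FR.frac {R k : Type*} [CommRing R] [IsDomain R] [Field k] [Algebra R k] [IsFractionRing R k]
    (hR : FR R) : FR k := by
  classical
  intro n c h i hi
  obtain ⟨b, hb⟩ := IsLocalization.exist_integer_multiples_of_finset (nonZeroDivisors R)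
    ((Finset.range n).image c)
  have : ∀ i < n, ∃ a : R, algebraMap R k a = algebraMap R k b * c i := by
    intro i hi
    obtain ⟨a, ha⟩ := hb (c i) (Finset.mem_image_of_mem c (Finset.mem_range.2 hi))
    exact ⟨a, by rw [ha, Algebra.smul_def]⟩
  choose! a ha using this
  have hb0 : algebraMap R k b ≠ 0 := by
    rw [Ne, FaithfulSMul.algebraMap_eq_zero_iff]; exact nonZeroDivisors.ne_zero b.2
  have h2 : ∑ i ∈ Finset.range n, a i ^ 2 = 0 := by
    apply FaithfulSMul.algebraMap_injective R k
    rw [map_sum, map_zero]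
    calc _ = ∑ i ∈ Finset.range n, (algebraMap R k b) ^ 2 * c i ^ 2 := by
          apply Finset.sum_congr rfl
          intro i hi
          rw [map_pow, ha i (Finset.mem_range.1 hi)]; ring
      _ = 0 := by rw [← Finset.mul_sum, h, mul_zero]
  have h3 := hR n a h2 i hi
  have h4 := ha i hi
  rw [h3, map_zero] at h4
  exact (mul_eq_zero.1 h4.symm).resolve_left hb0

end Strip

namespace Strip
open PowerSeries

section OrdPS
variable {K : Type*} [Field K] [LinearOrder K] [IsStrictOrderedRing K] [Algebra ℝ K]

def Cm (a b : K) : Prop := Fi (a / b) ∧ Fi (b / a)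

lemma Cm.symm {a b : K} (h : Cm a b) : Cm b a := ⟨h.2, h.1⟩

lemma Cm.mul {a b c d : K} (h : Cm a b) (h' : Cm c d) : Cm (a * c) (b * d) := by
  constructor
  · rw [mul_div_mul_comm]; exact (OO K).mul_mem h.1 h'.1
  · rw [mul_div_mul_comm]; exact (OO K).mul_mem h.2 h'.2

lemma Cm.inv {a b : K} (h : Cm a b) : Cm a⁻¹ b⁻¹ := by
  constructor
  · rw [inv_div_inv]; exact h.2
  · rw [inv_div_inv]; exact h.1

lemma Cm.pow {a b : K} (h : Cm a b) (n : ℕ) : Cm (a ^ n) (b ^ n) := by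
  constructor
  · rw [← div_pow]; exact (OO K).pow_mem h.1 n
  · rw [← div_pow]; exact (OO K).pow_mem h.2 n

lemma Cm.refl {a : K} (h : a ≠ 0) : Cm a a := by
  constructor <;> rw [div_self h] <;> exact (OO K).one_mem

lemma ps_nonneg (θ : PowerSeries ℝ →+* K) (u : PowerSeries ℝ) (hu : 0 < constantCoeff u) :
    0 ≤ θ u := by
  obtain ⟨v, rfl⟩ := ps_isSquare u hu
  rw [map_mul]; exact mul_self_nonneg _

lemma ps_fi (θ : PowerSeries ℝ →+* K) (hθ : ∀ r : ℝ, θ (C r) = algebraMap ℝ K r)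
    (u : PowerSeries ℝ) : Fi (θ u) := by
  refine ⟨|constantCoeff u| + 1, ?_⟩
  rw [abs_le, ← hθ]
  have h1 := ps_nonneg θ (C (|constantCoeff u| + 1) - u) (by
    rw [map_sub, constantCoeff_C]; have := le_abs_self (constantCoeff u); linarith)
  have h2 := ps_nonneg θ (C (|constantCoeff u| + 1) + u) (by
    rw [map_add, constantCoeff_C]; have := neg_abs_le (constantCoeff u); linarith)
  rw [map_sub] at h1
  rw [map_add] at h2
  constructor <;> linarith

lemma ps_inf (θ : PowerSeries ℝ →+* K) (hθ : ∀ r : ℝ, θ (C r) = algebraMap ℝ K r) :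
    Inf (θ X) := by
  intro ε hε
  rw [abs_le, ← hθ]
  have h1 := ps_nonneg θ (C ε - X) (by simpa using hε)
  have h2 := ps_nonneg θ (C ε + X) (by simpa using hε)
  rw [map_sub] at h1
  rw [map_add] at h2
  constructor <;> linarith

lemma ps_cm (θ : PowerSeries ℝ →+* K) (hθ : ∀ r : ℝ, θ (C r) = algebraMap ℝ K r)
    (hz : θ X ≠ 0) (u : PowerSeries ℝ) (hu : u ≠ 0) : ∃ m : ℤ, Cm (θ u) (θ X ^ m) := by
  obtain ⟨n, v, hv, rfl⟩ := ps_factor u hu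
  refine ⟨n, ?_⟩
  rw [map_mul, map_pow, zpow_natCast]
  have h1 : θ v * θ v⁻¹ = 1 := by rw [← map_mul, PowerSeries.mul_inv_cancel v hv, map_one]
  have h2 : (θ v)⁻¹ = θ v⁻¹ := inv_eq_of_mul_eq_one_right h1
  have h3 : Cm (θ v) 1 := ⟨by rw [div_one]; exact ps_fi θ hθ v,
    by rw [one_div, h2]; exact ps_fi θ hθ _⟩
  have := (Cm.refl (pow_ne_zero n hz)).mul h3
  rwa [mul_one] at this

lemma exists_cm_of_sum {T : Type*} [DecidableEq T] (s : Finset T) (f : T → K) (h : ∑ i ∈ s, f i = 0)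
    (hne : ∃ i ∈ s, f i ≠ 0) : ∃ i ∈ s, ∃ j ∈ s, i ≠ j ∧ f i ≠ 0 ∧ f j ≠ 0 ∧ Cm (f i) (f j) := by
  obtain ⟨i, hi, hmax⟩ := s.exists_max_image (fun i => |f i|) (hne.imp fun _ h => h.1)
  have hi0 : f i ≠ 0 := by
    obtain ⟨j, hj, hj0⟩ := hne
    have := hmax j hj
    rw [← abs_pos] at hj0 ⊢
    exact hj0.trans_le this
  refine ⟨i, hi, ?_⟩
  have hfi : ∀ j ∈ s, Fi (f j / f i) := fun j hj => fi_div (C := 1) hi0 (by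
    rw [map_one, one_mul]; exact hmax j hj)
  by_contra hcon
  push Not at hcon
  have hinf : ∀ j ∈ s.erase i, Inf (f j / f i) := by
    intro j hj
    rw [Finset.mem_erase] at hj
    by_cases hj0 : f j = 0
    · rw [hj0, zero_div]; intro ε hε; rw [abs_zero]; exact io_nonneg hε.le
    by_contra hni
    obtain ⟨c, hc⟩ := std_part (hfi j hj.2)
    have hc0 : c ≠ 0 := by
      rintro rfl; rw [map_zero, sub_zero] at hc; exact hni hc
    have := fi_inv_of hc0 hc
    rw [inv_div] at this
    exact hcon j hj.2 (Ne.symm hj.1) hi0 hj0 ⟨this, hfi j hj.2⟩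
  have hsum : ∀ t : Finset T, t ⊆ s.erase i → Inf (∑ j ∈ t, f j / f i) := by
    intro t
    induction t using Finset.induction_on with
    | empty => intro _ ε hε; rw [Finset.sum_empty, abs_zero]; exact io_nonneg hε.le
    | insert a t ha ih =>
      intro hs
      rw [Finset.sum_insert ha]
      exact (hinf a (hs (Finset.mem_insert_self a t))).add
        (ih ((Finset.subset_insert a t).trans hs))
  have h1 := hsum _ le_rfl
  have h2 : ∑ j ∈ s.erase i, f j / f i = algebraMap ℝ K (-1) := by
    rw [← Finset.sum_div, map_neg, map_one]
    rw [← Finset.add_sum_erase s f hi] at h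
    rw [div_eq_iff hi0]; linear_combination h
  rw [h2] at h1
  exact not_inf_io (by norm_num) h1

lemma frac_cm {k : Type*} [Field k] [Algebra (PowerSeries ℝ) k] [IsFractionRing (PowerSeries ℝ) k]
    (φ : k →+* K) (hθ : ∀ r : ℝ, φ (algebraMap (PowerSeries ℝ) k (C r)) = algebraMap ℝ K r)
    (c : k) (hc : c ≠ 0) : ∃ m : ℤ, Cm (φ c) (φ (algebraMap (PowerSeries ℝ) k X) ^ m) := by
  have hinj : Function.Injective (algebraMap (PowerSeries ℝ) k) := IsFractionRing.injective _ _
  set θ := φ.comp (algebraMap (PowerSeries ℝ) k) with hθd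
  have hz : θ X ≠ 0 := by
    rw [hθd, RingHom.comp_apply, map_ne_zero, Ne, map_eq_zero_iff _ hinj]
    exact X_ne_zero
  obtain ⟨a, b, hb, rfl⟩ := IsFractionRing.div_surjective (A := PowerSeries ℝ) c
  have hb0 : b ≠ 0 := nonZeroDivisors.ne_zero hb
  have ha0 : a ≠ 0 := by rintro rfl; simp at hc
  obtain ⟨m, hm⟩ := ps_cm θ hθ hz a ha0
  obtain ⟨n, hn⟩ := ps_cm θ hθ hz b hb0
  refine ⟨m - n, ?_⟩
  have := hm.mul hn.inv
  rw [← zpow_neg, ← zpow_add₀ hz, ← sub_eq_add_neg] at this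
  rw [map_div₀, div_eq_mul_inv]
  exact this

lemma frac_H {k : Type*} [Field k] [Algebra (PowerSeries ℝ) k] [IsFractionRing (PowerSeries ℝ) k]
    [Algebra k K] [FiniteDimensional k K]
    (hθ : ∀ r : ℝ, algebraMap k K (algebraMap (PowerSeries ℝ) k (C r)) = algebraMap ℝ K r)
    (a : K) (ha : a ≠ 0) : ∃ m : ℤ,
      Cm (a ^ (Module.finrank k K).factorial) (algebraMap k K (algebraMap (PowerSeries ℝ) k X) ^ m) := by
  classical
  have hinta : IsIntegral k a := Algebra.IsIntegral.isIntegral a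
  set q := minpoly k a with hq
  have hdeg : q.natDegree ≤ Module.finrank k K := minpoly.natDegree_le a
  have hsum : ∑ i ∈ Finset.range (q.natDegree + 1), algebraMap k K (q.coeff i) * a ^ i = 0 := by
    have := minpoly.aeval k a
    rw [Polynomial.aeval_eq_sum_range] at this
    simpa [Algebra.smul_def] using this
  obtain ⟨i, hi, j, hj, hij, hi0, hj0, hcm⟩ := exists_cm_of_sum _ _ hsum
    ⟨q.natDegree, by simp, by
      have : q.coeff q.natDegree = 1 := minpoly.monic hinta
      rw [this, map_one, one_mul]; exact pow_ne_zero _ ha⟩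
  rw [Finset.mem_range] at hi hj
  wlog hlt : i < j generalizing i j
  · exact this j hj i hi (Ne.symm hij) hj0 hi0 hcm.symm (by omega)
  have hci : q.coeff i ≠ 0 := by intro h; rw [h] at hi0; simp at hi0
  have hcj : q.coeff j ≠ 0 := by intro h; rw [h] at hj0; simp at hj0
  obtain ⟨m, hm⟩ := frac_cm (algebraMap k K) hθ _ hci
  obtain ⟨n, hn⟩ := frac_cm (algebraMap k K) hθ _ hcj
  set z := algebraMap k K (algebraMap (PowerSeries ℝ) k X) with hzd
  have hinj : Function.Injective (algebraMap (PowerSeries ℝ) k) := IsFractionRing.injective _ _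
  have hz : z ≠ 0 := by
    rw [hzd, map_ne_zero, Ne, map_eq_zero_iff _ hinj]
    exact X_ne_zero
  have hci' : algebraMap k K (q.coeff i) ≠ 0 := by rwa [map_ne_zero]
  have hcj' : algebraMap k K (q.coeff j) ≠ 0 := by rwa [map_ne_zero]
  -- a^(j-i) ~ z^(m-n)
  have h1 : Cm (a ^ (j - i)) (z ^ (m - n)) := by
    obtain ⟨e, rfl⟩ : ∃ e, j = i + e := ⟨j - i, by omega⟩
    rw [Nat.add_sub_cancel_left]
    have h2 := (hcm.symm.mul (Cm.refl (inv_ne_zero (pow_ne_zero i ha)))).mul hn.inv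
    have h3 := h2.mul (Cm.refl hcj')
    have h4 := h3.mul (hm.mul (Cm.refl (inv_ne_zero hci')))
    have h5 := (Cm.refl (pow_ne_zero e ha) : Cm (a ^ e) _)
    have l1 : algebraMap k K (q.coeff (i + e)) * a ^ (i + e) * (a ^ i)⁻¹ *
        (algebraMap k K (q.coeff (i + e)))⁻¹ * algebraMap k K (q.coeff (i + e)) *
        (algebraMap k K (q.coeff i) * (algebraMap k K (q.coeff i))⁻¹)
        = algebraMap k K (q.coeff (i + e)) * a ^ e := by
      rw [pow_add]; field_simp
    have l2 : algebraMap k K (q.coeff i) * a ^ i * (a ^ i)⁻¹ *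
        (z ^ n)⁻¹ * algebraMap k K (q.coeff (i + e)) *
        (z ^ m * (algebraMap k K (q.coeff i))⁻¹)
        = algebraMap k K (q.coeff (i + e)) * z ^ (m - n) := by
      rw [zpow_sub₀ hz]; field_simp
    rw [l1, l2] at h4
    have h6 := h4.mul (Cm.refl (inv_ne_zero hcj'))
    rwa [mul_comm, ← mul_assoc, inv_mul_cancel₀ hcj', one_mul, mul_comm _ (_)⁻¹, ← mul_assoc,
      inv_mul_cancel₀ hcj', one_mul] at h6
  obtain ⟨t, ht⟩ : (j - i) ∣ (Module.finrank k K).factorial :=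
    Nat.dvd_factorial (by omega) (by omega)
  refine ⟨(m - n) * t, ?_⟩
  rw [ht, pow_mul, zpow_mul, zpow_natCast]
  exact h1.pow t

end OrdPS
end Strip

namespace Strip
open Polynomial

noncomputable abbrev PS := PowerSeries ℝ
noncomputable abbrev LS := FractionRing (PowerSeries ℝ)
noncomputable def kap : ℝ[X] →+* PS := Polynomial.coeToPowerSeries.ringHom
noncomputable def kapk : ℝ[X] →+* LS := (algebraMap PS LS).comp kap

lemma kap_apply (p : ℝ[X]) : kap p = (p : PowerSeries ℝ) := rfl

lemma alg_inj : Function.Injective (algebraMap PS LS) := IsFractionRing.injective _ _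

lemma kapk_inj : Function.Injective kapk :=
  alg_inj.comp (Polynomial.coe_injective ℝ)

lemma LS_FR : FR LS := FR.frac (R := PS) ps_FR

lemma dvd_one_add (F : ℝ[X][X]) (p : ℝ[X]) (hp : p ≠ 0) (η : ℝ) (hη : 0 < η)
    (hF : ∀ x y, |x| < η → |p.eval x| ≤ F.evalEval x y) (g : LS[X]) (hg : Irreducible g)
    (hd : g ∣ F.map kapk) : ∃ S, IsSumSq S ∧ g ∣ 1 + S := by
  haveI : Fact (Irreducible g) := ⟨hg⟩
  by_cases hS : IsSumSq (-1 : AdjoinRoot g)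
  · obtain ⟨n, c, hc⟩ := IsSumSq.exists_sum hS
    choose d hdd using fun i => AdjoinRoot.mk_surjective (c i)
    refine ⟨∑ i ∈ Finset.range n, d i ^ 2, IsSumSq.sum (fun i _ => isSumSq_sq (d i)), ?_⟩
    rw [← AdjoinRoot.mk_eq_zero, map_add, map_one, map_sum]
    have : ∑ i ∈ Finset.range n, (AdjoinRoot.mk g) (d i ^ 2) = -1 := by
      rw [hc]; exact Finset.sum_congr rfl (fun i _ => by rw [map_pow, hdd])
    rw [this, add_neg_cancel]
  · exfalso
    obtain ⟨lo, hlo⟩ := exists_order _ hS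
    haveI : FiniteDimensional LS (AdjoinRoot g) := (AdjoinRoot.powerBasis hg.ne_zero).finite
    have hθ : ∀ r : ℝ, algebraMap LS (AdjoinRoot g) (algebraMap PS LS (PowerSeries.C r))
        = algebraMap ℝ (AdjoinRoot g) r := by
      intro r
      have : (PowerSeries.C r : PS) = algebraMap ℝ PS r := rfl
      rw [this, ← IsScalarTower.algebraMap_apply ℝ PS LS,
        ← IsScalarTower.algebraMap_apply ℝ LS (AdjoinRoot g)]
    set z := algebraMap LS (AdjoinRoot g) (algebraMap PS LS PowerSeries.X) with hz
    have hz0 : z ≠ 0 := by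
      rw [hz, _root_.map_ne_zero, Ne, map_eq_zero_iff _ alg_inj]
      exact PowerSeries.X_ne_zero
    have hzi : Inf z := ps_inf ((algebraMap LS (AdjoinRoot g)).comp (algebraMap PS LS)) hθ
    refine no_root z hzi hz0 _ (Nat.factorial_pos _) (fun a ha => frac_H hθ a ha) F p hp η hη hF
      (AdjoinRoot.root g) ?_
    have h1 : ∀ q : ℝ[X], aeval z q = algebraMap LS (AdjoinRoot g) (kapk q) := by
      intro q
      have : (aeval z : ℝ[X] →ₐ[ℝ] AdjoinRoot g).toRingHom
          = (algebraMap LS (AdjoinRoot g)).comp kapk := by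
        apply Polynomial.ringHom_ext
        · intro r
          simp only [AlgHom.toRingHom_eq_coe, RingHom.coe_coe, aeval_C, RingHom.comp_apply, kapk,
            kap_apply, Polynomial.coe_C]
          exact (hθ r).symm
        · simp [kapk, kap_apply, hz]
      exact congrArg (fun f => f q) this
    have h2 : eval₂ ((algebraMap LS (AdjoinRoot g)).comp kapk) (AdjoinRoot.root g) F = 0 := by
      obtain ⟨t, ht⟩ := hd
      rw [← eval₂_map, ht, eval₂_mul]
      have : eval₂ (algebraMap LS (AdjoinRoot g)) (AdjoinRoot.root g) g = 0 :=
        AdjoinRoot.eval₂_root g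
      rw [this, zero_mul]
    rw [eval₂_eq_sum_range] at h2
    rw [← h2]
    exact Finset.sum_congr rfl (fun i _ => by rw [h1]; rfl)

lemma loc_square (q p : ℝ[X]) (hp : p ≠ 0) (η : ℝ) (hη : 0 < η)
    (hq : ∀ x, |x| < η → |p.eval x| ≤ q.eval x) : q ≠ 0 ∧ ∃ s : PS, kap q = s ^ 2 := by
  have hq0 : q ≠ 0 := by
    rintro rfl
    apply hp
    apply Polynomial.eq_zero_of_infinite_isRoot
    apply Set.Infinite.mono _ (Set.Ioo_infinite (show -η < η by linarith))
    intro x hx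
    have := hq x (abs_lt.2 hx)
    rw [eval_zero] at this
    exact abs_eq_zero.1 (le_antisymm this (abs_nonneg _))
  refine ⟨hq0, ?_⟩
  obtain ⟨j, -, P, hP, hP0⟩ := X_pow_factor q.natDegree q (fun h => by
    have := natDegree_le_of_dvd h hq0
    rw [natDegree_X_pow] at this; omega)
  -- sign persistence
  have hsg : ∃ δ > 0, δ ≤ η ∧ ∀ x, |x| < δ → 0 < P.eval x * P.eval 0 := by
    have hc : ContinuousAt (fun x => P.eval x * P.eval 0) 0 := by fun_prop
    have := hc.eventually (lt_mem_nhds (mul_self_pos.2 hP0))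
    obtain ⟨δ, hδ, h⟩ := Metric.eventually_nhds_iff.1 this
    refine ⟨min δ η, lt_min hδ hη, min_le_right _ _, fun x hx => h ?_⟩
    rw [Real.dist_eq, sub_zero]; exact hx.trans_le (min_le_left _ _)
  obtain ⟨δ, hδ, hδη, hs⟩ := hsg
  have hpos : ∀ x, |x| < η → 0 ≤ x ^ j * P.eval x := by
    intro x hx
    have := (abs_nonneg _).trans (hq x hx)
    rwa [hP, eval_mul, eval_pow, eval_X] at this
  have hP1 : 0 < P.eval 0 := by
    have hd2 : |δ / 2| < δ := by rw [abs_of_pos (by positivity)]; linarith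
    have h1 := hpos (δ / 2) (hd2.trans_le hδη)
    have h2 := hs (δ / 2) hd2
    have h3 : 0 ≤ P.eval (δ / 2) := by
      by_contra hc; push Not at hc
      have : 0 < (δ / 2) ^ j := by positivity
      nlinarith
    by_contra hc; push Not at hc
    nlinarith
  have hj : Even j := by
    by_contra hodd
    rw [Nat.not_even_iff_odd] at hodd
    have hd2 : |-(δ / 2)| < δ := by rw [abs_neg, abs_of_pos (by positivity)]; linarith
    have h1 := hpos (-(δ / 2)) (hd2.trans_le hδη)
    have h2 := hs (-(δ / 2)) hd2
    rw [hodd.neg_pow] at h1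
    have : 0 < (δ / 2) ^ j := by positivity
    have h3 : 0 < P.eval (-(δ / 2)) := by
      by_contra hc; push Not at hc; nlinarith
    nlinarith [mul_pos this h3]
  obtain ⟨l, rfl⟩ := hj
  obtain ⟨w, hw⟩ := ps_isSquare (kap P) (by
    rw [kap_apply, ← PowerSeries.coeff_zero_eq_constantCoeff_apply, Polynomial.coeff_coe,
      coeff_zero_eq_eval_zero]; exact hP1)
  exact ⟨kap X ^ l * w, by rw [hP, map_mul, map_pow, hw]; ring⟩

lemma local_sos_frac (F : ℝ[X][X]) (p : ℝ[X]) (hp : p ≠ 0) (η : ℝ) (hη : 0 < η)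
    (hF : ∀ x y, |x| < η → |p.eval x| ≤ F.evalEval x y) : IsSumSq (F.map kapk) := by
  obtain ⟨hq0, s, hs⟩ := loc_square (F.coeff 0) p hp η hη (fun x hx => by
    have := hF x 0 hx
    rwa [evalEval, C_0, ← coeff_zero_eq_eval_zero F] at this)
  have hF0 : F.map kapk ≠ 0 := by
    rw [Ne, Polynomial.map_eq_zero_iff kapk_inj]
    rintro rfl; simp at hq0
  obtain ⟨c, hc0, hc⟩ := sos_of_factors LS_FR _ (F.map kapk) hF0 le_rfl
    (fun g hg hd => dvd_one_add F p hp η hη hF g hg hd)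
  have hs0 : algebraMap PS LS s ≠ 0 := by
    rw [Ne, map_eq_zero_iff _ alg_inj]
    rintro rfl
    rw [zero_pow two_ne_zero] at hs
    exact hq0 (Polynomial.coe_injective ℝ (by rw [← kap_apply, hs, Polynomial.coe_zero]))
  have h1 : IsSumSq (c * (algebraMap PS LS s) ^ 2) := by
    have := IsSumSq.map' (evalRingHom (0 : LS)) hc
    rw [coe_evalRingHom, eval_mul, eval_C, ← coeff_zero_eq_eval_zero, coeff_map, kapk,
      RingHom.comp_apply, hs, map_pow] at this
    exact this
  have h2 : IsSumSq c := by
    have := h1.mul (isSumSq_sq ((algebraMap PS LS s)⁻¹))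
    have e : c * (algebraMap PS LS s) ^ 2 * ((algebraMap PS LS s)⁻¹) ^ 2 = c := by field_simp
    rwa [e] at this
  have h3 : IsSumSq (C c : LS[X]) := IsSumSq.map' C h2
  have h4 := (h3.mul hc).mul (isSumSq_sq (C c⁻¹))
  have e : C c * (C c * F.map kapk) * C c⁻¹ ^ 2 = F.map kapk := by
    have : (C c * C c⁻¹ : LS[X]) = 1 := by rw [← C_mul, mul_inv_cancel₀ hc0, C_1]
    linear_combination (F.map kapk) * (C c * C c⁻¹ + 1) * this
  rwa [e] at h4

lemma FR_real : FR ℝ := by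
  intro n c h i hi
  rw [Finset.sum_eq_zero_iff_of_nonneg (fun j _ => sq_nonneg _)] at h
  exact pow_eq_zero_iff two_ne_zero |>.1 (h i (Finset.mem_range.2 hi))

lemma ps_poly_descent (G : PS[X]) (n : ℕ) (j : ℕ) : ∀ (H : ℕ → PS[X]),
    C (PowerSeries.X ^ j) ^ 2 * G = ∑ i ∈ Finset.range n, H i ^ 2 →
    ∃ H' : ℕ → PS[X], G = ∑ i ∈ Finset.range n, H' i ^ 2 := by
  induction j with
  | zero => intro H h; exact ⟨H, by rw [← h]; simp⟩
  | succ j ih =>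
    intro H h
    have h1 : ∀ i < n, C PowerSeries.X ∣ H i := by
      have h2 : ∑ i ∈ Finset.range n, (mapRingHom (PowerSeries.constantCoeff (R := ℝ)) (H i)) ^ 2
          = 0 := by
        have := congrArg (mapRingHom (PowerSeries.constantCoeff (R := ℝ))) h
        rw [map_sum] at this
        simp only [map_pow] at this
        rw [← this, map_mul, map_pow]
        simp
      intro i hi
      have h3 := FR.poly FR_real n _ h2 i hi
      rw [C_dvd_iff_dvd_coeff]
      intro l
      rw [PowerSeries.X_dvd_iff]
      have := congrArg (fun q => q.coeff l) h3
      simpa using this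
    choose! H' hH' using h1
    apply ih H'
    have h4 : (C PowerSeries.X ^ 2 : PS[X]) ≠ 0 :=
      pow_ne_zero _ (by rw [Ne, C_eq_zero]; exact PowerSeries.X_ne_zero)
    apply mul_left_cancel₀ h4
    rw [Finset.mul_sum]
    calc _ = C (PowerSeries.X ^ (j + 1)) ^ 2 * G := by rw [pow_succ PowerSeries.X j, C_mul]; ring
      _ = _ := by
        rw [h]
        exact Finset.sum_congr rfl (fun i hi => by rw [hH' i (Finset.mem_range.1 hi)]; ring)

lemma local_sos_ps (F : ℝ[X][X]) (hS : IsSumSq (F.map kapk)) :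
    ∃ (n : ℕ) (H : ℕ → PS[X]), F.map kap = ∑ i ∈ Finset.range n, H i ^ 2 := by
  obtain ⟨n, r, hr⟩ := IsSumSq.exists_sum hS
  have h1 : ∀ i, ∃ (b : PS) (H : PS[X]), b ≠ 0 ∧
      H.map (algebraMap PS LS) = C (algebraMap PS LS b) * r i := by
    intro i
    obtain ⟨b, hb, h⟩ := IsLocalization.integerNormalization_spec (nonZeroDivisors PS) (r i)
    refine ⟨b, _, nonZeroDivisors.ne_zero hb, h.trans ?_⟩
    ext l
    rw [coeff_smul, coeff_C_mul, Algebra.smul_def]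
  choose b H hb hH using h1
  set B := ∏ i ∈ Finset.range n, b i with hB
  have hB0 : B ≠ 0 := Finset.prod_ne_zero_iff.2 (fun i _ => hb i)
  have h2 : ∀ i < n, ∃ H' : PS[X], H'.map (algebraMap PS LS) = C (algebraMap PS LS B) * r i := by
    intro i hi
    refine ⟨C (∏ j ∈ (Finset.range n).erase i, b j) * H i, ?_⟩
    rw [Polynomial.map_mul, map_C, hH, hB, ← Finset.mul_prod_erase _ _ (Finset.mem_range.2 hi),
      map_mul, C_mul]
    ring
  choose! H' hH' using h2
  have h3 : C B ^ 2 * F.map kap = ∑ i ∈ Finset.range n, H' i ^ 2 := by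
    apply Polynomial.map_injective _ alg_inj
    rw [Polynomial.map_mul, Polynomial.map_pow, map_C, Polynomial.map_map]
    change _ * F.map kapk = _
    rw [hr, Finset.mul_sum, Polynomial.map_sum]
    exact Finset.sum_congr rfl (fun i hi => by
      rw [Polynomial.map_pow, hH' i (Finset.mem_range.1 hi)]; ring)
  obtain ⟨j, v, hv, hj⟩ := ps_factor B hB0
  have hvv : v * v⁻¹ = 1 := PowerSeries.mul_inv_cancel v hv
  obtain ⟨H'', h''⟩ := ps_poly_descent (F.map kap) n j (fun i => C v⁻¹ * H' i) (by
    have : ∀ i, (C v⁻¹ * H' i) ^ 2 = C v⁻¹ ^ 2 * H' i ^ 2 := fun i => by ring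
    simp only [this]
    rw [← Finset.mul_sum, ← h3, hj, C_mul]
    have h5 : (C v * C v⁻¹ : PS[X]) = 1 := by rw [← C_mul, hvv, C_1]
    linear_combination (-(C (PowerSeries.X ^ j) ^ 2 * F.map kap) * (C v * C v⁻¹ + 1)) * h5)
  exact ⟨n, H'', h''⟩

lemma local_sos (F : ℝ[X][X]) (p : ℝ[X]) (hp : p ≠ 0) (η : ℝ) (hη : 0 < η)
    (hF : ∀ x y, |x| < η → |p.eval x| ≤ F.evalEval x y) (d : ℕ) (hd : F.natDegree ≤ 2 * d)
    (N : ℕ) : ∃ (n : ℕ) (A : ℕ → ℝ[X][X]), (∀ i < n, (A i).natDegree ≤ d) ∧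
      C (X ^ N) ∣ F - ∑ i ∈ Finset.range n, A i ^ 2 := by
  obtain ⟨n, H, hH⟩ := local_sos_ps F (local_sos_frac F p hp η hη hF)
  have hdeg := natDegree_of_sum_sq ps_FR n d H (by
    rw [← hH]; exact natDegree_map_le.trans hd)
  refine ⟨n, fun i => ∑ l ∈ Finset.range (d + 1), C (PowerSeries.trunc N ((H i).coeff l)) * X ^ l,
    fun i _ => ?_, ?_⟩
  · apply natDegree_sum_le_of_forall_le
    intro l hl
    have := Finset.mem_range.1 hl
    exact (natDegree_C_mul_X_pow_le _ _).trans (by omega)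
  set A : ℕ → ℝ[X][X] := fun i =>
    ∑ l ∈ Finset.range (d + 1), C (PowerSeries.trunc N ((H i).coeff l)) * X ^ l with hA
  have h1 : ∀ i < n, C (PowerSeries.X ^ N) ∣ H i - (A i).map kap := by
    intro i hi
    rw [C_dvd_iff_dvd_coeff]
    intro l
    rw [coeff_sub, coeff_map, hA]
    simp only [finsetSum_coeff, coeff_C_mul_X_pow]
    rw [Finset.sum_ite_eq]
    split_ifs with hl
    · rw [PowerSeries.X_pow_dvd_iff]
      intro m hm
      rw [map_sub, kap_apply, Polynomial.coeff_coe, PowerSeries.coeff_trunc, if_pos hm, sub_self]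
    · rw [coeff_eq_zero_of_natDegree_lt]
      · simp
      · have := hdeg i hi
        rw [Finset.mem_range] at hl; omega
  have h2 : C (PowerSeries.X ^ N) ∣ (F - ∑ i ∈ Finset.range n, A i ^ 2).map kap := by
    rw [Polynomial.map_sub, hH, Polynomial.map_sum, ← Finset.sum_sub_distrib]
    apply Finset.dvd_sum
    intro i hi
    rw [Polynomial.map_pow, sq_sub_sq]
    exact (h1 i (Finset.mem_range.1 hi)).mul_left _
  rw [C_dvd_iff_dvd_coeff] at h2 ⊢
  intro l
  have h3 := h2 l
  rw [coeff_map, kap_apply, PowerSeries.X_pow_dvd_iff] at h3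
  rw [Polynomial.X_pow_dvd_iff]
  intro m hm
  have := h3 m hm
  rwa [Polynomial.coeff_coe] at this
end Strip

namespace Strip
open Polynomial

lemma evalEval_map_gen (φ : ℝ[X] →+* ℝ[X]) (x x' : ℝ) (h : ∀ q : ℝ[X], (φ q).eval x = q.eval x')
    (P : ℝ[X][X]) (y : ℝ) : (P.map φ).evalEval x y = P.evalEval x' y := by
  conv_lhs => rw [P.as_sum_range_C_mul_X_pow]
  conv_rhs => rw [P.as_sum_range_C_mul_X_pow]
  rw [Polynomial.map_sum, evalEval_finsetSum, evalEval_finsetSum]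
  apply Finset.sum_congr rfl
  intro i _
  rw [Polynomial.map_mul, map_C, Polynomial.map_pow, map_X]
  simp only [evalEval_mul, evalEval_pow, evalEval_C, evalEval_X, h]

def LocM (f : ℝ[X][X]) (d N : ℕ) (r : ℝ) : Prop :=
  ∃ L : ℝ[X][X], InM L ∧ L.natDegree ≤ 2 * d ∧ C ((X - C r) ^ N) ∣ f - L

lemma natDegree_sum_sq_le (n d : ℕ) (A : ℕ → ℝ[X][X]) (h : ∀ i < n, (A i).natDegree ≤ d) :
    (∑ i ∈ Finset.range n, A i ^ 2).natDegree ≤ 2 * d := by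
  apply natDegree_sum_le_of_forall_le
  intro i hi
  have := h i (Finset.mem_range.1 hi)
  exact (natDegree_pow_le).trans (by omega)

lemma loc_interior (f : ℝ[X][X]) (d : ℕ) (hd : f.natDegree ≤ 2 * d) (p : ℝ[X]) (hp : p ≠ 0)
    (hf : ∀ x ∈ Set.Icc (0 : ℝ) 1, ∀ y, |p.eval x| ≤ f.evalEval x y) (r : ℝ) (h0 : 0 < r)
    (h1 : r < 1) (N : ℕ) : LocM f d N r := by
  have hcomp : ∀ (s x : ℝ) (q : ℝ[X]), (compRingHom (X + C s) q).eval x = q.eval (x + s) := by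
    intro s x q; simp
  have hp' : compRingHom (X + C r) p ≠ 0 := by
    intro h
    apply hp
    have : p = (p.comp (X + C r)).comp (X + C (-r)) := by
      rw [comp_assoc]; simp
    rw [coe_compRingHom_apply] at h; rw [this, h]; simp
  obtain ⟨n, A, hA, hdvd⟩ := local_sos (f.map (compRingHom (X + C r))) _ hp' (min r (1 - r))
    (lt_min h0 (by linarith)) (fun x y hx => by
      rw [evalEval_map_gen _ x (x + r) (hcomp r x), hcomp]
      apply hf
      have h2 := abs_lt.1 (hx.trans_le (min_le_left _ _))
      have h3 := abs_lt.1 (hx.trans_le (min_le_right _ _))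
      constructor <;> linarith) d (natDegree_map_le.trans hd) N
  refine ⟨∑ i ∈ Finset.range n, (A i).map (compRingHom (X + C (-r))) ^ 2,
    InM.sum _ _ (fun i _ => InM.sq _),
    natDegree_sum_sq_le _ _ _ (fun i hi => natDegree_map_le.trans (hA i hi)), ?_⟩
  have := map_dvd (mapRingHom (compRingHom (X + C (-r)))) hdvd
  rw [map_sub, map_sum] at this
  simp only [coe_mapRingHom, map_C, Polynomial.map_pow, map_map] at this
  convert this using 2
  · simp [sub_eq_add_neg]
  · symm
    convert Polynomial.map_id using 2
    ext <;> simp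

lemma split_poly (a : ℝ[X]) :
    a = expand ℝ 2 (contract 2 a) + X * expand ℝ 2 (contract 2 a.divX) := by
  ext m
  rw [coeff_add, coeff_expand two_pos]
  rcases m with _ | m
  · simp [coeff_contract]
  rw [coeff_X_mul, coeff_expand two_pos]
  split_ifs with h1 h2 h2
  · omega
  · rw [coeff_contract two_ne_zero, Nat.div_mul_cancel h1, add_zero]
  · rw [coeff_contract two_ne_zero, Nat.div_mul_cancel h2, coeff_divX, zero_add]
  · omega

lemma even_dvd (N : ℕ) (u v : ℝ[X]) (h : X ^ (2 * N) ∣ expand ℝ 2 u + X * expand ℝ 2 v) :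
    X ^ N ∣ u := by
  rw [X_pow_dvd_iff] at h ⊢
  intro m hm
  have := h (2 * m) (by omega)
  rw [coeff_add, coeff_expand two_pos, if_pos (dvd_mul_right _ _),
    Nat.mul_div_cancel_left _ two_pos] at this
  rcases m with _ | m
  · simpa using this
  · rw [show 2 * (m + 1) = (2 * m + 1) + 1 by ring, coeff_X_mul, coeff_expand two_pos,
      if_neg (by omega), add_zero] at this
    exact this

noncomputable def EE : ℝ[X][X] →+* ℝ[X][X] := mapRingHom (expand ℝ 2 : ℝ[X] →ₐ[ℝ] ℝ[X]).toRingHom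

lemma EE_coeff (P : ℝ[X][X]) (l : ℕ) : (EE P).coeff l = expand ℝ 2 (P.coeff l) := by
  simp [EE]

lemma split_bi (d : ℕ) (A : ℝ[X][X]) (hA : A.natDegree ≤ d) : ∃ a b : ℝ[X][X],
    a.natDegree ≤ d ∧ b.natDegree ≤ d ∧ A = EE a + C X * EE b := by
  refine ⟨∑ l ∈ Finset.range (d + 1), C (contract 2 (A.coeff l)) * X ^ l,
    ∑ l ∈ Finset.range (d + 1), C (contract 2 (A.coeff l).divX) * X ^ l, ?_, ?_, ?_⟩
  · apply natDegree_sum_le_of_forall_le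
    intro l hl
    have := Finset.mem_range.1 hl
    exact (natDegree_C_mul_X_pow_le _ _).trans (by omega)
  · apply natDegree_sum_le_of_forall_le
    intro l hl
    have := Finset.mem_range.1 hl
    exact (natDegree_C_mul_X_pow_le _ _).trans (by omega)
  · ext1 l
    rw [coeff_add, coeff_C_mul, EE_coeff, EE_coeff]
    simp only [finsetSum_coeff, coeff_C_mul_X_pow]
    rw [Finset.sum_ite_eq, Finset.sum_ite_eq]
    split_ifs with hl
    · exact split_poly _
    · rw [coeff_eq_zero_of_natDegree_lt (by rw [Finset.mem_range] at hl; omega)]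
      simp

lemma loc_zero (f : ℝ[X][X]) (d : ℕ) (hd : f.natDegree ≤ 2 * d) (p : ℝ[X]) (hp : p ≠ 0)
    (hf : ∀ x ∈ Set.Icc (0 : ℝ) 1, ∀ y, |p.eval x| ≤ f.evalEval x y) (N : ℕ) : LocM f d N 0 := by
  have hp' : expand ℝ 2 p ≠ 0 := by rwa [Ne, expand_eq_zero two_pos]
  obtain ⟨n, A, hA, hdvd⟩ := local_sos (EE f) _ hp' 1 one_pos (fun x y hx => by
      have hcomp : ∀ q : ℝ[X], (expand ℝ 2 q).eval x = q.eval (x ^ 2) := fun q => expand_eval _ _ _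
      have := evalEval_map_gen (expand ℝ 2 : ℝ[X] →ₐ[ℝ] ℝ[X]).toRingHom x (x ^ 2) hcomp f y
      rw [EE, coe_mapRingHom, this, hcomp]
      apply hf
      have := abs_lt.1 hx
      constructor <;> nlinarith) d (natDegree_map_le.trans hd) (2 * N)
  choose! a b ha hb hab using fun i (hi : i < n) => split_bi d (A i) (hA i hi)
  refine ⟨∑ i ∈ Finset.range n, a i ^ 2 + C X * ∑ i ∈ Finset.range n, b i ^ 2,
    (InM.sum _ _ (fun i _ => InM.sq _)).add (InM.CX.mul (InM.sum _ _ (fun i _ => InM.sq _))), ?_, ?_⟩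
  · apply natDegree_add_le_of_degree_le (natDegree_sum_sq_le _ _ _ ha)
    exact (natDegree_C_mul_le _ _).trans (natDegree_sum_sq_le _ _ _ hb)
  · have e : EE f - ∑ i ∈ Finset.range n, A i ^ 2 =
        EE (f - (∑ i ∈ Finset.range n, a i ^ 2 + C X * ∑ i ∈ Finset.range n, b i ^ 2))
        + C X * EE (- ∑ i ∈ Finset.range n, 2 * a i * b i) := by
      have hX : EE (C X) = C X ^ 2 := by
        rw [EE, coe_mapRingHom, map_C]; simp
      have : ∑ i ∈ Finset.range n, A i ^ 2 = ∑ i ∈ Finset.range n, EE (a i) ^ 2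
          + C X ^ 2 * ∑ i ∈ Finset.range n, EE (b i) ^ 2
          + C X * ∑ i ∈ Finset.range n, 2 * EE (a i) * EE (b i) := by
        rw [Finset.mul_sum, Finset.mul_sum, ← Finset.sum_add_distrib, ← Finset.sum_add_distrib]
        apply Finset.sum_congr rfl
        intro i hi
        rw [hab i (Finset.mem_range.1 hi)]; ring
      rw [this]
      simp only [map_sub, map_add, map_mul, map_neg, map_sum, map_pow, hX, map_ofNat]
      ring
    rw [e, C_dvd_iff_dvd_coeff] at hdvd
    rw [C_dvd_iff_dvd_coeff, C_0, sub_zero]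
    intro l
    have := hdvd l
    rw [coeff_add, coeff_C_mul, EE_coeff, EE_coeff] at this
    exact even_dvd N _ _ this

lemma loc_all (f : ℝ[X][X]) (d : ℕ) (hd : f.natDegree ≤ 2 * d) (p : ℝ[X]) (hp : p ≠ 0)
    (hf : ∀ x ∈ Set.Icc (0 : ℝ) 1, ∀ y, |p.eval x| ≤ f.evalEval x y) (r : ℝ)
    (hr : r ∈ Set.Icc (0 : ℝ) 1) (N : ℕ) : LocM f d N r := by
  rcases hr.1.eq_or_lt with rfl | h0
  · exact loc_zero f d hd p hp hf N
  rcases hr.2.lt_or_eq with h1 | rfl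
  · exact loc_interior f d hd p hp hf r h0 h1 N
  have hcomp : ∀ (x : ℝ) (q : ℝ[X]), (compRingHom (1 - X) q).eval x = q.eval (1 - x) := by
    intro x q; simp
  have hp' : compRingHom (1 - X) p ≠ 0 := by
    intro h
    apply hp
    have : p = (p.comp (1 - X)).comp (1 - X) := by
      rw [comp_assoc]; simp
    rw [coe_compRingHom_apply] at h; rw [this, h]; simp
  obtain ⟨L, hL, hLd, hdvd⟩ := loc_zero (flip f) d (natDegree_map_le.trans hd) _ hp' (fun x hx y => by
    rw [flip, coe_mapRingHom, evalEval_map_gen _ x (1 - x) (hcomp x), hcomp]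
    exact hf _ ⟨by linarith [hx.2], by linarith [hx.1]⟩ y) N
  refine ⟨flip L, hL.flip, natDegree_map_le.trans hLd, ?_⟩
  have := map_dvd flip hdvd
  rw [map_sub, flip_flip] at this
  refine dvd_trans ?_ this
  have e : flip (C ((X - C 0) ^ N)) = C ((1 - X) ^ N) := by
    rw [flip, coe_mapRingHom, map_C]; simp
  rw [e]
  apply _root_.map_dvd C
  apply pow_dvd_pow_of_dvd
  exact ⟨-1, by rw [C_1]; ring⟩

lemma loc_crt (f : ℝ[X][X]) (d : ℕ) (hd : f.natDegree ≤ 2 * d) (p : ℝ[X]) (hp : p ≠ 0)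
    (hf : ∀ x ∈ Set.Icc (0 : ℝ) 1, ∀ y, |p.eval x| ≤ f.evalEval x y) (N : ℕ) (S : Finset ℝ)
    (hS : ∀ r ∈ S, r ∈ Set.Icc (0 : ℝ) 1) : ∃ L : ℝ[X][X], InM L ∧ L.natDegree ≤ 2 * d ∧
      C (∏ r ∈ S, (X - C r) ^ N) ∣ f - L := by
  classical
  induction S using Finset.induction_on with
  | empty => exact ⟨0, InM.zero, by simp, by simp⟩
  | insert r S hr ih =>
    obtain ⟨L', hL', hd', hv'⟩ := ih (fun s hs => hS s (Finset.mem_insert_of_mem hs))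
    obtain ⟨L, hL, hLd, hv⟩ := loc_all f d hd p hp hf r (hS r (Finset.mem_insert_self _ _)) N
    rw [Finset.prod_insert hr]
    set U := ∏ s ∈ S, (X - C s) ^ N with hU
    set V := (X - C r) ^ N with hV
    have hco : IsCoprime U V := by
      apply IsCoprime.prod_left
      intro s hs
      apply IsCoprime.pow
      have hsr : s ≠ r := by rintro rfl; exact hr hs
      exact Polynomial.pairwise_coprime_X_sub_C (K := ℝ) (s := id) Function.injective_id hsr
    obtain ⟨α, β, hab⟩ := id hco
    have hab' : (C α * C U + C β * C V : ℝ[X][X]) = 1 := by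
      rw [← C_mul, ← C_mul, ← C_add, hab, C_1]
    have hcd : ∀ (q : ℝ[X]) (P : ℝ[X][X]), P.natDegree ≤ 2 * d → (C q ^ 2 * P).natDegree ≤ 2 * d := by
      intro q P h
      rw [← C_pow]
      exact (natDegree_C_mul_le _ _).trans h
    refine ⟨C (β * V) ^ 2 * L' + C (α * U) ^ 2 * L, ((InM.sq _).mul hL').add ((InM.sq _).mul hL),
      natDegree_add_le_of_degree_le (hcd _ _ hd') (hcd _ _ hLd), ?_⟩
    rw [C_mul]
    apply IsCoprime.mul_dvd
    · exact (IsCoprime.map hco C).symm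
    · have : f - (C (β * V) ^ 2 * L' + C (α * U) ^ 2 * L) = (f - L) +
        C V * (C β * (C α * C U + 1) * L - C β ^ 2 * C V * L') := by
        rw [C_mul, C_mul]
        linear_combination (-(C α * C U * L + L)) * hab'
      rw [this]
      exact dvd_add hv (dvd_mul_right _ _)
    · have : f - (C (β * V) ^ 2 * L' + C (α * U) ^ 2 * L) = (f - L') +
        C U * (C α * (C β * C V + 1) * L' - C α ^ 2 * C U * L) := by
        rw [C_mul, C_mul]
        linear_combination (-(C β * C V * L' + L')) * hab'
      rw [this]
      exact dvd_add hv' (dvd_mul_right _ _)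
end Strip

namespace Strip
open Polynomial

lemma T_sq_le_one (S : Finset ℝ) (hS : ∀ r ∈ S, r ∈ Set.Icc (0 : ℝ) 1) (x : ℝ)
    (hx : x ∈ Set.Icc (0 : ℝ) 1) : (∏ r ∈ S, (x - r)) ^ 2 ≤ 1 := by
  rw [← Finset.prod_pow]
  apply Finset.prod_le_one
  · intro r _; positivity
  · intro r hr
    have := hS r hr
    have h1 := this.1; have h2 := this.2; have h3 := hx.1; have h4 := hx.2
    nlinarith

lemma eps_aux (n : ℕ) : ∀ e : ℝ[X], e ≠ 0 → e.natDegree ≤ n → ∃ (S : Finset ℝ) (k : ℕ) (c : ℝ),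
    0 < c ∧ (∀ r ∈ S, r ∈ Set.Icc (0 : ℝ) 1) ∧
    ∀ x ∈ Set.Icc (0 : ℝ) 1, c * (∏ r ∈ S, (x - r)) ^ (2 * k) ≤ (e.eval x) ^ 2 := by
  classical
  induction n with
  | zero =>
    intro e he hd
    rw [eq_C_of_natDegree_le_zero hd] at he ⊢
    have : e.coeff 0 ≠ 0 := by intro h; rw [h] at he; simp at he
    exact ⟨∅, 0, (e.coeff 0) ^ 2, by positivity, by simp, by simp⟩
  | succ n ih =>
    intro e he hd
    by_cases hr : ∃ r ∈ Set.Icc (0 : ℝ) 1, e.eval r = 0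
    · obtain ⟨r, hr, her⟩ := hr
      obtain ⟨g, rfl⟩ := dvd_iff_isRoot.2 her
      have hg : g ≠ 0 := right_ne_zero_of_mul he
      rw [natDegree_mul (X_sub_C_ne_zero r) hg, natDegree_X_sub_C] at hd
      obtain ⟨S, k, c, hc, hS, h⟩ := ih g hg (by omega)
      refine ⟨insert r S, k + 1, c, hc, ?_, ?_⟩
      · intro s hs
        rcases Finset.mem_insert.1 hs with rfl | hs
        · exact hr
        · exact hS s hs
      · intro x hx
        have hS' : ∀ s ∈ insert r S, s ∈ Set.Icc (0 : ℝ) 1 := by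
          intro s hs
          rcases Finset.mem_insert.1 hs with rfl | hs
          · exact hr
          · exact hS s hs
        set T := ∏ s ∈ insert r S, (x - s) with hT
        have h1 : T ^ 2 ≤ (x - r) ^ 2 := by
          rw [hT, ← Finset.mul_prod_erase _ _ (Finset.mem_insert_self r S), mul_pow]
          have := T_sq_le_one ((insert r S).erase r)
            (fun s hs => hS' s (Finset.mem_of_mem_erase hs)) x hx
          nlinarith [sq_nonneg (x - r)]
        have h2 : T ^ 2 ≤ (∏ s ∈ S, (x - s)) ^ 2 := by
          by_cases hrS : r ∈ S
          · rw [hT, Finset.insert_eq_of_mem hrS]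
          · rw [hT, Finset.prod_insert hrS, mul_pow]
            have h5 := hr.1; have h2 := hr.2; have h3 := hx.1; have h4 := hx.2
            have : (x - r) ^ 2 ≤ 1 := by nlinarith
            nlinarith [sq_nonneg (∏ s ∈ S, (x - s))]
        have h3 : (T ^ 2) ^ k ≤ ((∏ s ∈ S, (x - s)) ^ 2) ^ k :=
          pow_le_pow_left₀ (sq_nonneg _) h2 k
        have h4 := h x hx
        rw [pow_mul] at h4
        rw [eval_mul, mul_pow, pow_mul, pow_succ, eval_sub, eval_X, eval_C]
        calc c * ((T ^ 2) ^ k * T ^ 2) ≤ c * (((∏ s ∈ S, (x - s)) ^ 2) ^ k * (x - r) ^ 2) := by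
              gcongr
          _ = (x - r) ^ 2 * (c * ((∏ s ∈ S, (x - s)) ^ 2) ^ k) := by ring
          _ ≤ _ := by gcongr
    · push Not at hr
      have hcont : ContinuousOn (fun x => (e.eval x) ^ 2) (Set.Icc (0 : ℝ) 1) := by fun_prop
      obtain ⟨x0, hx0, hmin⟩ := isCompact_Icc.exists_isMinOn
        (Set.nonempty_Icc.2 (zero_le_one' ℝ)) hcont
      refine ⟨∅, 0, (e.eval x0) ^ 2, ?_, by simp, ?_⟩
      · have := hr x0 hx0; positivity
      · intro x hx
        simpa using hmin hx

lemma choose_m (A c : ℝ) (k : ℕ) (hA : 0 < A) (hc : 0 < c) (hc1 : c ≤ 1) :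
    ∃ m : ℕ, ∀ q : ℝ, 0 ≤ q → q ≤ 1 → A * ((1 - c * q ^ k) ^ (2 * m) * q) ≤ 1 / 2 := by
  set δ := min (1 / (2 * A)) 1 with hδ
  have hδ0 : 0 < δ := lt_min (by positivity) one_pos
  have hδ1 : δ ≤ 1 := min_le_right _ _
  have hAδ : A * δ ≤ 1 / 2 := by
    calc A * δ ≤ A * (1 / (2 * A)) := by gcongr; exact min_le_left _ _
      _ = 1 / 2 := by field_simp
  have hck : c * δ ^ k ≤ 1 := by
    have : δ ^ k ≤ 1 := pow_le_one₀ hδ0.le hδ1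
    calc c * δ ^ k ≤ 1 * 1 := by gcongr
      _ = 1 := by norm_num
  have hb0 : 0 ≤ 1 - c * δ ^ k := by linarith
  have hb1 : 1 - c * δ ^ k < 1 := by have : 0 < c * δ ^ k := by positivity
                                     linarith
  obtain ⟨m, hm⟩ := exists_pow_lt_of_lt_one hδ0 hb1
  refine ⟨m, fun q hq0 hq1 => ?_⟩
  have hcq : c * q ^ k ≤ 1 := by
    have : q ^ k ≤ 1 := pow_le_one₀ hq0 hq1
    calc c * q ^ k ≤ 1 * 1 := by gcongr
      _ = 1 := by norm_num
  have hcq0 : 0 ≤ c * q ^ k := by positivity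
  refine le_trans ?_ hAδ
  gcongr
  rcases le_total q δ with h | h
  · calc (1 - c * q ^ k) ^ (2 * m) * q ≤ 1 * δ := by
          gcongr
          exact pow_le_one₀ (by linarith) (by linarith)
      _ = δ := one_mul _
  · have h1 : 1 - c * q ^ k ≤ 1 - c * δ ^ k := by gcongr
    calc (1 - c * q ^ k) ^ (2 * m) * q ≤ (1 - c * δ ^ k) ^ (2 * m) * 1 := by
          gcongr
      _ ≤ (1 - c * δ ^ k) ^ m := by
          rw [mul_one]
          exact pow_le_pow_of_le_one hb0 hb1.le (by omega)
      _ ≤ δ := hm.le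

lemma sep_case (f u v : ℝ[X][X]) (h : ℝ[X]) (hh : h ≠ 0) (d : ℕ) (hf0 : f ≠ 0)
    (hd : f.natDegree = 2 * d)
    (hf : ∀ x ∈ Set.Icc (0 : ℝ) 1, ∀ y, 0 ≤ f.evalEval x y)
    (hbez : u * f + v * derivative f = C h) : InM f := by
  obtain ⟨e, he, hlow⟩ := lower_bound f u v h hh d hf0 hd hf hbez
  obtain ⟨S, k, c0, hc0, hS, heps⟩ := eps_aux _ e he le_rfl
  set c := min (c0 / 2) 1 with hc
  have hcpos : 0 < c := lt_min (by positivity) one_pos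
  have hc1 : c ≤ 1 := min_le_right _ _
  have hc2 : 2 * c ≤ c0 := by have := min_le_left (c0 / 2) 1; rw [← hc] at this; linarith
  set T : ℝ[X] := ∏ r ∈ S, (X - C r) with hT
  have hTe : ∀ x, T.eval x = ∏ r ∈ S, (x - r) := by
    intro x; rw [hT, eval_prod]; simp
  have hT0 : T ≠ 0 := Finset.prod_ne_zero_iff.2 (fun r _ => X_sub_C_ne_zero r)
  set ε : ℝ[X] := C c * T ^ (2 * k) with hε
  have hε0 : ε ≠ 0 := mul_ne_zero (by rw [Ne, C_eq_zero]; exact hcpos.ne') (pow_ne_zero _ hT0)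
  have hεe : ∀ x, ε.eval x = c * ((T.eval x) ^ 2) ^ k := by
    intro x; rw [hε]; simp [pow_mul]
  have hεM : InM (C ε) := by
    rw [hε, C_mul, pow_mul', C_pow]
    exact (InM.const hcpos.le).mul (InM.sq _)
  have hq1 : ∀ x ∈ Set.Icc (0 : ℝ) 1, (T.eval x) ^ 2 ≤ 1 := by
    intro x hx; rw [hTe]; exact T_sq_le_one S hS x hx
  have hεn : ∀ x, 0 ≤ ε.eval x := by intro x; rw [hεe]; positivity
  have hε1 : ∀ x ∈ Set.Icc (0 : ℝ) 1, ε.eval x ≤ 1 := by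
    intro x hx; rw [hεe]
    calc c * ((T.eval x) ^ 2) ^ k ≤ 1 * 1 := by
          gcongr; exact pow_le_one₀ (sq_nonneg _) (hq1 x hx)
      _ = 1 := by norm_num
  set Y : ℝ[X][X] := (1 + X ^ 2) ^ d with hY
  have hYe : ∀ x y, Y.evalEval x y = (1 + y ^ 2) ^ d := by
    intro x y
    rw [hY, evalEval_pow, evalEval_add, evalEval_pow, evalEval_X, evalEval_one]
  have hYd : Y.natDegree ≤ 2 * d := by
    rw [hY]
    refine natDegree_pow_le.trans ?_
    have : (1 + X ^ 2 : ℝ[X][X]).natDegree ≤ 2 := by compute_degree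
    nlinarith
  set f1 := f - C ε * Y with hf1
  have hf1d : f1.natDegree ≤ 2 * d :=
    natDegree_sub_le_of_le hd.le ((natDegree_C_mul_le _ _).trans hYd) |>.trans (by simp)
  have hf1e : ∀ x ∈ Set.Icc (0 : ℝ) 1, ∀ y, ε.eval x * (1 + y ^ 2) ^ d ≤ f1.evalEval x y := by
    intro x hx y
    rw [hf1, evalEval_sub, evalEval_mul, evalEval_C, hYe]
    have h1 := hlow x hx y
    have h2 := heps x hx
    rw [← hTe, pow_mul] at h2
    have h3 : 2 * ε.eval x ≤ (e.eval x) ^ 2 := by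
      rw [hεe]
      refine le_trans ?_ h2
      rw [← mul_assoc]; gcongr
    have h4 : 2 * ε.eval x * (1 + y ^ 2) ^ d ≤ (e.eval x) ^ 2 * (1 + y ^ 2) ^ d := by gcongr
    linarith
  have h1y : ∀ y : ℝ, 1 ≤ (1 + y ^ 2) ^ d := fun y => one_le_pow₀ (by nlinarith [sq_nonneg y])
  obtain ⟨L, hL, hLd, R0, hR0⟩ := loc_crt f1 d hf1d ε hε0 (fun x hx y => by
    rw [abs_of_nonneg (hεn x)]
    refine le_trans ?_ (hf1e x hx y)
    nlinarith [hεn x, h1y y]) (2 * k + 2) S hS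
  set R := C (C c⁻¹) * R0 with hR
  have hRR : f1 - L = C ε * C (T ^ 2) * R := by
    have hcc : (C (C c) * C (C c⁻¹) : ℝ[X][X]) = 1 := by
      rw [← C_mul, ← C_mul, mul_inv_cancel₀ hcpos.ne', C_1, C_1]
    rw [hR0, Finset.prod_pow, ← hT, hR, hε, pow_add, C_mul, C_mul]
    linear_combination (-(C (T ^ (2 * k)) * C (T ^ 2) * R0)) * hcc
  have hRd : R.natDegree ≤ 2 * d := by
    have h1 : (C (ε * T ^ 2) * R).natDegree = R.natDegree :=
      natDegree_C_mul (mul_ne_zero hε0 (pow_ne_zero _ hT0))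
    rw [← h1, C_mul, ← hRR]
    exact (natDegree_sub_le_of_le hf1d hLd).trans (by simp)
  obtain ⟨A, hA, hRA⟩ := poly_bound R (2 * d) hRd
  have hRb : ∀ x ∈ Set.Icc (0 : ℝ) 1, ∀ y, |R.evalEval x y| ≤ A * 2 ^ d * (1 + y ^ 2) ^ d := by
    intro x hx y
    refine (hRA x hx y).trans ?_
    rw [mul_assoc, ← mul_pow, pow_mul]
    gcongr
    nlinarith [sq_nonneg (|y| - 1), sq_abs y]
  obtain ⟨m, hm⟩ := choose_m (A * 2 ^ d) c k (by positivity) hcpos hc1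
  set b : ℝ[X] := (1 - ε) ^ (2 * m) with hb
  set w : ℝ[X] := ∑ j ∈ Finset.range (2 * m), (1 - ε) ^ j with hw
  have hbw : ε * w = 1 - b := by
    have := mul_neg_geom_sum (1 - ε) (2 * m)
    rwa [sub_sub_cancel] at this
  have hbM : InM (C b) := by
    rw [hb, pow_mul', C_pow]; exact InM.sq _
  have hwn : ∀ x ∈ Set.Icc (0 : ℝ) 1, 0 ≤ w.eval x := by
    intro x hx
    rw [hw, eval_finsetSum]
    apply Finset.sum_nonneg
    intro j _
    rw [eval_pow, eval_sub, eval_one]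
    exact pow_nonneg (by linarith [hε1 x hx]) _
  set P : ℝ[X][X] := C w * f1 + C (b * T ^ 2) * R + Y with hP
  have hPd : P.natDegree ≤ 2 * d := by
    rw [hP]
    refine natDegree_add_le_of_degree_le (natDegree_add_le_of_degree_le ?_ ?_) hYd
    · exact (natDegree_C_mul_le _ _).trans hf1d
    · exact (natDegree_C_mul_le _ _).trans hRd
  have hPM : InM P := by
    apply strict_case P d hPd (1 / 2) (by norm_num)
    intro x hx y
    rw [hP, evalEval_add, evalEval_add, evalEval_mul, evalEval_mul, evalEval_C, evalEval_C, hYe]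
    have h1 : 0 ≤ w.eval x * f1.evalEval x y :=
      mul_nonneg (hwn x hx) (le_trans (mul_nonneg (hεn x) (by positivity)) (hf1e x hx y))
    have h2 := hm ((T.eval x) ^ 2) (sq_nonneg _) (hq1 x hx)
    rw [← hεe] at h2
    have h3 : (b * T ^ 2).eval x = (1 - ε.eval x) ^ (2 * m) * (T.eval x) ^ 2 := by
      rw [hb]; simp
    have h4 : 0 ≤ (b * T ^ 2).eval x := by
      rw [h3]
      have : 0 ≤ 1 - ε.eval x := by linarith [hε1 x hx]
      positivity
    rw [← h3] at h2
    have h5 : |(b * T ^ 2).eval x * R.evalEval x y| ≤ 1 / 2 * (1 + y ^ 2) ^ d := by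
      rw [abs_mul, abs_of_nonneg h4]
      calc _ ≤ (b * T ^ 2).eval x * (A * 2 ^ d * (1 + y ^ 2) ^ d) := by
            gcongr; exact hRb x hx y
        _ = (A * 2 ^ d * (b * T ^ 2).eval x) * (1 + y ^ 2) ^ d := by ring
        _ ≤ _ := by gcongr
    have h6 := neg_abs_le ((b * T ^ 2).eval x * R.evalEval x y)
    linarith
  have hfin : f = C b * L + C ε * P := by
    have hbw' : (C ε * C w : ℝ[X][X]) = 1 - C b := by rw [← C_mul, hbw, C_sub, C_1]
    have : f = f1 + C ε * Y := by rw [hf1]; ring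
    have hbT : (C (b * T ^ 2) : ℝ[X][X]) = C b * C (T ^ 2) := C_mul
    rw [this, hP, hbT]
    linear_combination (-f1) * hbw' + C b * hRR
  rw [hfin]
  exact (hbM.mul hL).add (hεM.mul hPM)
end Strip

namespace Strip
open Polynomial

lemma even_degree (p : ℝ[X]) (h : ∀ y, 0 ≤ p.eval y) : ∃ d, p.natDegree = 2 * d := by
  obtain ⟨n, r, hr⟩ := IsSumSq.exists_sum (univ_sos p h)
  rcases Nat.even_or_odd' p.natDegree with ⟨d, hd | hd⟩
  · exact ⟨d, hd⟩
  exfalso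
  have h1 := natDegree_of_sum_sq FR_real n (d + 1) r (by rw [← hr]; omega)
  have h2 := coeff_sum_sq n (d + 1) r h1
  rw [← hr, coeff_eq_zero_of_natDegree_lt (by omega)] at h2
  have h3 := FR_real n _ h2.symm
  have h4 : ∀ i < n, (r i).natDegree ≤ d := by
    intro i hi
    by_contra hc
    have h5 : (r i).natDegree = d + 1 := by have := h1 i hi; omega
    have h6 := h3 i hi
    rw [← h5, coeff_natDegree, leadingCoeff_eq_zero] at h6
    rw [h6] at h5; simp at h5
  have h7 : p.natDegree ≤ 2 * d := by
    rw [hr]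
    apply natDegree_sum_le_of_forall_le
    intro i hi
    have := h4 i (Finset.mem_range.1 hi)
    exact natDegree_pow_le.trans (by omega)
  omega

lemma exists_not_root (q : ℝ[X]) (hq : q ≠ 0) : ∃ x ∈ Set.Icc (0 : ℝ) 1, q.eval x ≠ 0 := by
  by_contra hc
  push Not at hc
  apply hq
  apply Polynomial.eq_zero_of_infinite_isRoot
  exact Set.Infinite.mono (fun x hx => hc x hx) (Set.Icc_infinite (zero_lt_one' ℝ))

lemma clear_den {R k : Type*} [CommRing R] [IsDomain R] [Field k] [Algebra R k]
    [IsFractionRing R k] (a : k[X]) : ∃ (b : R) (A : R[X]), b ≠ 0 ∧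
      A.map (algebraMap R k) = C (algebraMap R k b) * a := by
  obtain ⟨b, hb, h⟩ := IsLocalization.integerNormalization_spec (nonZeroDivisors R) a
  refine ⟨b, _, nonZeroDivisors.ne_zero hb, h.trans ?_⟩
  ext l
  rw [coeff_smul, coeff_C_mul, Algebra.smul_def]

lemma dichotomy (f : ℝ[X][X]) (hf : f ≠ 0) :
    (∃ (u v : ℝ[X][X]) (h : ℝ[X]), h ≠ 0 ∧ u * f + v * derivative f = C h) ∨
    (∃ g q : ℝ[X][X], 0 < g.natDegree ∧ f = g ^ 2 * q) := by
  set k := FractionRing ℝ[X]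
  have hinj : Function.Injective (algebraMap ℝ[X] k) := IsFractionRing.injective _ _
  have : CharZero k := charZero_of_injective_algebraMap (R := ℝ) (algebraMap ℝ k).injective
  have hfb : f.map (algebraMap ℝ[X] k) ≠ 0 := by rwa [Ne, Polynomial.map_eq_zero_iff hinj]
  by_cases hs : Squarefree (f.map (algebraMap ℝ[X] k))
  · left
    obtain ⟨a, b, hab⟩ := PerfectField.separable_iff_squarefree.2 hs
    obtain ⟨s, A, hs0, hA⟩ := clear_den (R := ℝ[X]) a
    obtain ⟨t, B, ht0, hB⟩ := clear_den (R := ℝ[X]) b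
    refine ⟨C t * A, C s * B, s * t, mul_ne_zero hs0 ht0, ?_⟩
    apply Polynomial.map_injective _ hinj
    rw [Polynomial.map_add, Polynomial.map_mul, Polynomial.map_mul, Polynomial.map_mul,
      Polynomial.map_mul, hA, hB, map_C, map_C, map_C, ← derivative_map, map_mul, C_mul]
    linear_combination (C (algebraMap ℝ[X] k s) * C (algebraMap ℝ[X] k t)) * hab
  · right
    have : Nonempty (NormalizedGCDMonoid ℝ[X]) := inferInstance
    obtain ⟨inst⟩ := this
    unfold Squarefree at hs
    push Not at hs
    obtain ⟨x, hx, hxu⟩ := hs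
    have hx0 : x ≠ 0 := by
      rintro rfl
      rw [zero_mul, zero_dvd_iff] at hx; exact hfb hx
    obtain ⟨b, B, hb0, hB⟩ := clear_den (R := ℝ[X]) x
    have hxd : 0 < x.natDegree := by
      by_contra hc
      apply hxu
      rw [eq_C_of_natDegree_le_zero (not_lt.1 hc)] at hx0 ⊢
      exact isUnit_C.2 (isUnit_iff_ne_zero.2 (fun h => hx0 (by rw [h, C_0])))
    have hbk : algebraMap ℝ[X] k b ≠ 0 := by rwa [Ne, map_eq_zero_iff _ hinj]
    have hB0 : B ≠ 0 := by
      rintro rfl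
      rw [Polynomial.map_zero] at hB
      exact mul_ne_zero (by rwa [Ne, C_eq_zero]) hx0 hB.symm
    set g := B.primPart with hg
    have hBg : B = C B.content * g := B.eq_C_content_mul_primPart
    have hcont : B.content ≠ 0 := by rwa [Ne, content_eq_zero_iff]
    have hgd : g.natDegree = x.natDegree := by
      rw [hg, natDegree_primPart, ← natDegree_map_eq_of_injective hinj, hB, natDegree_C_mul hbk]
    have hgx : g.map (algebraMap ℝ[X] k) ∣ x := by
      have h1 : C (algebraMap ℝ[X] k B.content) * g.map (algebraMap ℝ[X] k)
          = C (algebraMap ℝ[X] k b) * x := by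
        rw [← hB]; conv_rhs => rw [hBg]
        rw [Polynomial.map_mul, map_C]
      refine ⟨C (algebraMap ℝ[X] k b)⁻¹ * C (algebraMap ℝ[X] k B.content), ?_⟩
      have h2 : (C (algebraMap ℝ[X] k b)⁻¹ * C (algebraMap ℝ[X] k b) : k[X]) = 1 := by
        rw [← C_mul, inv_mul_cancel₀ hbk, C_1]
      linear_combination (-x) * h2 - C (algebraMap ℝ[X] k b)⁻¹ * h1
    have hprim : (g * g).IsPrimitive := B.isPrimitive_primPart.mul B.isPrimitive_primPart
    obtain ⟨q, hq⟩ := hprim.dvd_of_fraction_map_dvd_fraction_map (K := k) (q := f) (by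
      rw [Polynomial.map_mul]
      exact (mul_dvd_mul hgx hgx).trans hx)
    exact ⟨g, q, by omega, by rw [hq]; ring⟩

lemma q_nonneg (g q : ℝ[X][X]) (hg : g ≠ 0)
    (hf : ∀ x ∈ Set.Icc (0 : ℝ) 1, ∀ y, 0 ≤ (g ^ 2 * q).evalEval x y) :
    ∀ x ∈ Set.Icc (0 : ℝ) 1, ∀ y, 0 ≤ q.evalEval x y := by
  intro x hx y
  have hcont : Continuous (fun x => q.evalEval x y) := by
    unfold evalEval
    have : (fun x => eval x (eval (C y) q)) = fun x => (eval (C y) q).eval x := rfl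
    fun_prop
  refine nonneg_of_off_roots hcont (q := g.leadingCoeff) (leadingCoeff_ne_zero.2 hg)
    (s := Set.Icc 0 1) ?_ ?_ x hx
  · rw [interior_Icc, closure_Ioo (by norm_num)]
  · intro x hx hlc
    have hgx : g.map (evalRingHom x) ≠ 0 := by
      intro h
      apply hlc
      have := congrArg (fun p => p.coeff g.natDegree) h
      simpa using this
    have hc : Continuous (fun y => (q.map (evalRingHom x)).eval y) := by fun_prop
    have := nonneg_of_off_roots_univ hc hgx (fun y hy => by
      have h1 := hf x hx y
      rw [evalEval_mul, evalEval_pow, ← map_evalRingHom_eval, ← map_evalRingHom_eval] at h1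
      exact nonneg_of_mul_nonneg_right h1 (by positivity)) y
    rwa [map_evalRingHom_eval] at this

theorem main (n : ℕ) : ∀ f : ℝ[X][X], f.natDegree ≤ n →
    (∀ x ∈ Set.Icc (0 : ℝ) 1, ∀ y, 0 ≤ f.evalEval x y) → InM f := by
  induction n using Nat.strong_induction_on with
  | _ n ih =>
  intro f hfn hf
  by_cases hf0 : f = 0
  · rw [hf0]; exact InM.zero
  rcases dichotomy f hf0 with ⟨u, v, h, hh, hbez⟩ | ⟨g, q, hg, rfl⟩
  · obtain ⟨x0, hx0, hlc⟩ := exists_not_root f.leadingCoeff (leadingCoeff_ne_zero.2 hf0)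
    obtain ⟨d, hd⟩ := even_degree (f.map (evalRingHom x0)) (fun y => by
      rw [map_evalRingHom_eval]; exact hf x0 hx0 y)
    rw [natDegree_map_of_leadingCoeff_ne_zero _ hlc] at hd
    exact sep_case f u v h hh d hf0 hd hf hbez
  · have hg0 : g ≠ 0 := by rintro rfl; simp at hg
    have hq0 : q ≠ 0 := right_ne_zero_of_mul hf0
    rw [natDegree_mul (pow_ne_zero _ hg0) hq0, natDegree_pow] at hfn
    exact (InM.sq g).mul (ih q.natDegree (by omega) q le_rfl (q_nonneg g q hg0 hf))

end Strip

namespace Strip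
open MvPolynomial

noncomputable def toBi : MvPolynomial (Fin 2) ℝ →+* Polynomial (Polynomial ℝ) :=
  eval₂Hom ((Polynomial.C).comp Polynomial.C) ![Polynomial.C Polynomial.X, Polynomial.X]

noncomputable def ofBi : Polynomial (Polynomial ℝ) →+* MvPolynomial (Fin 2) ℝ :=
  Polynomial.eval₂RingHom (Polynomial.eval₂RingHom C (X 0)) (X 1)

lemma ofBi_toBi (f : MvPolynomial (Fin 2) ℝ) : ofBi (toBi f) = f := by
  have : ofBi.comp toBi = RingHom.id _ := by
    apply MvPolynomial.ringHom_ext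
    · intro r; simp [ofBi, toBi]
    · intro i; fin_cases i <;> simp [ofBi, toBi]
  exact congrArg (fun φ => φ f) this

lemma evalEval_toBi (f : MvPolynomial (Fin 2) ℝ) (x y : ℝ) :
    (toBi f).evalEval x y = eval ![x, y] f := by
  have : (Polynomial.evalEvalRingHom x y).comp toBi = eval ![x, y] := by
    apply MvPolynomial.ringHom_ext
    · intro r; simp [toBi, Polynomial.evalEval]
    · intro i; fin_cases i <;> simp [toBi, Polynomial.evalEval]
  exact congrArg (fun φ => φ f) this

end Strip

open MvPolynomial

theorem marshall_strip (f : MvPolynomial (Fin 2) ℝ)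
    (hf : ∀ p : Fin 2 → ℝ, p 0 ∈ Set.Icc (0 : ℝ) 1 → 0 ≤ eval p f) :
    ∃ σ τ : MvPolynomial (Fin 2) ℝ, IsSumSq σ ∧ IsSumSq τ ∧
      f = σ + τ * (X 0 - (X 0) ^ 2) := by
  obtain ⟨σ, τ, hσ, hτ, h⟩ := Strip.main _ (Strip.toBi f) le_rfl (fun x hx y => by
    rw [Strip.evalEval_toBi]; exact hf _ (by simpa using hx))
  refine ⟨Strip.ofBi σ, Strip.ofBi τ, Strip.IsSumSq.map' _ hσ, Strip.IsSumSq.map' _ hτ, ?_⟩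
  have h2 := congrArg Strip.ofBi h
  rw [Strip.ofBi_toBi, map_add, map_mul] at h2
  rw [h2]
  congr 2
  rw [Strip.ofBi, Polynomial.coe_eval₂RingHom, Polynomial.eval₂_C]
  simp
end

section
/- Suppose U ⊆ ℝ is compact and φ, ψ : U → ℝ are continuous functions with φ(x) ≤ ψ(x) for all x ∈ U and φ(x) < ψ(x) for all but finitely many x ∈ U. If φ and ψ are real-analytic at each point a ∈ U where φ(a) = ψ(a), then there exists a polynomial p(x) ∈ ℝ[x] such that φ(x) ≤ p(x) ≤ ψ(x) holds for all x ∈ U. -/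
open Polynomial

open Filter Topology in
lemma analyticAt_dslope_aux (f : ℝ → ℝ) (a b : ℝ) (ha : AnalyticAt ℝ f a) (hb : AnalyticAt ℝ f b) :
    AnalyticAt ℝ (dslope f a) b := by
  rcases eq_or_ne b a with rfl | h
  · obtain ⟨p, hp⟩ := ha
    exact ⟨_, hp.has_fpower_series_dslope_fslope⟩
  · have h1 : AnalyticAt ℝ (fun x => (x - a)⁻¹ * (f x - f a)) b := by
      have : b - a ≠ 0 := sub_ne_zero.2 h
      exact ((analyticAt_id.sub analyticAt_const).inv this).mul (hb.sub analyticAt_const)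
    refine h1.congr ?_
    filter_upwards [dslope_eventuallyEq_slope_of_ne f h] with x hx
    rw [hx]; simp [slope, smul_eq_mul]

/-- `f` can be written as `q + w * g` with `g` as regular as `f`. -/
def GoodMod (U : Set ℝ) (A : Set ℝ) (f : ℝ → ℝ) (w : ℝ[X]) : Prop :=
  ∃ (q : ℝ[X]) (g : ℝ → ℝ), ContinuousOn g U ∧ (∀ a ∈ A, AnalyticAt ℝ g a) ∧
    ∀ x, f x = q.eval x + w.eval x * g x

lemma GoodMod.step {U A : Set ℝ} {f : ℝ → ℝ} {w : ℝ[X]} (h : GoodMod U A f w) {a : ℝ}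
    (ha : a ∈ A) : GoodMod U A f ((X - C a) * w) := by
  obtain ⟨q, g, hg, hga, e⟩ := h
  refine ⟨q + C (g a) * w, dslope g a, ?_, fun b hb => analyticAt_dslope_aux g a b (hga a ha) (hga b hb), ?_⟩
  · intro x hx
    rcases eq_or_ne x a with rfl | hne
    · exact (analyticAt_dslope_aux g x x (hga x ha) (hga x ha)).continuousAt.continuousWithinAt
    · exact (continuousWithinAt_dslope_of_ne hne).2 (hg x hx)
  · intro x
    have := sub_smul_dslope g a x
    rw [smul_eq_mul] at this
    rw [e x]
    simp only [eval_add, eval_mul, eval_C, eval_sub, eval_X]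
    linear_combination (-w.eval x) * this

lemma GoodMod.pow {U A : Set ℝ} {f : ℝ → ℝ} {w : ℝ[X]} (h : GoodMod U A f w) {a : ℝ}
    (ha : a ∈ A) (n : ℕ) : GoodMod U A f ((X - C a) ^ n * w) := by
  induction n with
  | zero => simpa using h
  | succ n ih => rw [pow_succ', mul_assoc]; exact ih.step ha

lemma GoodMod.prod {U A : Set ℝ} {f : ℝ → ℝ} (hf : ContinuousOn f U)
    (hA : ∀ a ∈ A, AnalyticAt ℝ f a) (n : ℝ → ℕ) (B : Finset ℝ) (hB : ∀ b ∈ B, b ∈ A) :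
    GoodMod U A f (∏ b ∈ B, (X - C b) ^ n b) := by
  classical
  induction B using Finset.induction_on with
  | empty => exact ⟨0, f, hf, hA, by simp⟩
  | insert b B hb ih =>
    rw [Finset.prod_insert hb]
    exact (ih fun c hc => hB c (Finset.mem_insert_of_mem hc)).pow (hB b (Finset.mem_insert_self _ _)) _

lemma weierstrass_aux (U : Set ℝ) (hU : IsCompact U) (g : ℝ → ℝ) (hg : ContinuousOn g U)
    (ε : ℝ) (hε : 0 < ε) : ∃ r : ℝ[X], ∀ x ∈ U, |r.eval x - g x| < ε := by
  have : CompactSpace U := isCompact_iff_compactSpace.1 hU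
  obtain ⟨r, h⟩ := ContinuousMap.exists_mem_subalgebra_near_continuous_of_separatesPoints
    (polynomialFunctions U) (polynomialFunctions_separatesPoints U) (fun x : U => g x)
    (continuousOn_iff_continuous_domRestrict.1 hg) ε hε
  obtain ⟨p, -, hp⟩ := r.2
  refine ⟨p, fun x hx => ?_⟩
  have h1 := h ⟨x, hx⟩
  rw [← hp] at h1
  exact h1

open Filter Topology in
lemma local_lower (U : Set ℝ) (d : ℝ → ℝ) (h0 : ∀ x ∈ U, 0 ≤ d x)
    (hfin : {x ∈ U | d x = 0}.Finite) (a : ℝ) (ha : AnalyticAt ℝ d a) :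
    ∃ n : ℕ, ∃ c > 0, ∀ᶠ x in 𝓝 a, x ∈ U → c * |x - a| ^ n ≤ d x := by
  by_cases h : ∀ᶠ x in 𝓝 a, d x = 0
  · refine ⟨1, 1, one_pos, ?_⟩
    have hc : ({x ∈ U | d x = 0} \ {a})ᶜ ∈ 𝓝 a :=
      (hfin.subset Set.diff_subset).isClosed.isOpen_compl.mem_nhds (by simp)
    filter_upwards [h, hc] with x hx hx2 hxU
    have : x = a := by
      by_contra hne
      exact hx2 ⟨⟨hxU, hx⟩, hne⟩
    subst this
    simpa using h0 x hxU
  · obtain ⟨n, g, hg, hne, he⟩ := ha.exists_eventuallyEq_pow_smul_nonzero_iff.2 h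
    have hpos : 0 < |g a| := abs_pos.2 hne
    refine ⟨n, |g a| / 2, by positivity, ?_⟩
    have h2 : ∀ᶠ x in 𝓝 a, |g a| / 2 < |g x| :=
      hg.continuousAt.abs.eventually (lt_mem_nhds (by linarith))
    filter_upwards [he, h2] with x hx hx2 hxU
    rw [← abs_of_nonneg (h0 x hxU), hx, smul_eq_mul, abs_mul, abs_pow, mul_comm]
    gcongr

open Filter Topology in
lemma global_lower (U : Set ℝ) (hU : IsCompact U) (d : ℝ → ℝ) (hd : ContinuousOn d U)
    (h0 : ∀ x ∈ U, 0 ≤ d x) (A : Finset ℝ) (hA : ∀ x ∈ U, d x = 0 → x ∈ A) (n : ℝ → ℕ)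
    (hn : ∀ a ∈ A, ∃ c > 0, ∀ᶠ x in 𝓝 a, x ∈ U → c * |x - a| ^ n a ≤ d x) :
    ∃ ε > 0, ∀ x ∈ U, ε * |(∏ b ∈ A, (X - C b) ^ n b : ℝ[X]).eval x| ≤ d x := by
  classical
  set w : ℝ[X] := ∏ b ∈ A, (X - C b) ^ n b with hw
  have key : ∃ ε > 0, ∀ x ∈ U, x ∈ U → ε * |w.eval x| ≤ d x := by
    refine hU.induction_on (p := fun S => ∃ ε > 0, ∀ x ∈ S, x ∈ U → ε * |w.eval x| ≤ d x)
      ⟨1, one_pos, by simp⟩ ?_ ?_ ?_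
    · rintro s t hst ⟨ε, he, h⟩
      exact ⟨ε, he, fun x hx => h x (hst hx)⟩
    · rintro s t ⟨ε, he, h⟩ ⟨δ, hδ, h'⟩
      refine ⟨min ε δ, lt_min he hδ, ?_⟩
      rintro x (hx | hx) hxU
      · exact (mul_le_mul_of_nonneg_right (min_le_left _ _) (abs_nonneg _)).trans (h x hx hxU)
      · exact (mul_le_mul_of_nonneg_right (min_le_right _ _) (abs_nonneg _)).trans (h' x hx hxU)
    · intro a ha
      have bdd : ∀ v : ℝ[X], ∀ᶠ x in 𝓝 a, |v.eval x| < |v.eval a| + 1 := fun v =>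
        (v.continuous.continuousAt.abs).eventually (gt_mem_nhds (by linarith))
      by_cases hda : d a = 0
      · have haA := hA a ha hda
        obtain ⟨c, hc, hcx⟩ := hn a haA
        set v : ℝ[X] := ∏ b ∈ A.erase a, (X - C b) ^ n b with hv
        have hwv : w = (X - C a) ^ n a * v := (Finset.mul_prod_erase A _ haA).symm
        refine ⟨_, mem_nhdsWithin_of_mem_nhds (hcx.and (bdd v)), c / (|v.eval a| + 1), by positivity, ?_⟩
        rintro x ⟨h1, h2⟩ hxU
        refine le_trans ?_ (h1 hxU)
        have hp : 0 < |v.eval a| + 1 := by positivity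
        rw [hwv]
        simp only [eval_mul, eval_pow, eval_sub, eval_X, eval_C, abs_mul, abs_pow]
        rw [div_mul_eq_mul_div, div_le_iff₀ hp, ← mul_assoc]
        gcongr
      · have hpos : 0 < d a := lt_of_le_of_ne (h0 a ha) (Ne.symm hda)
        have h1 : ∀ᶠ x in 𝓝[U] a, d a / 2 < d x := (hd a ha).eventually (lt_mem_nhds (by linarith))
        refine ⟨_, h1.and (mem_nhdsWithin_of_mem_nhds (bdd w)), d a / 2 / (|w.eval a| + 1), by positivity, ?_⟩
        rintro x ⟨h1, h2⟩ hxU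
        refine le_trans ?_ h1.le
        have h2 : |w.eval x| < |w.eval a| + 1 := h2
        have hp : 0 < |w.eval a| + 1 := by positivity
        rw [div_mul_eq_mul_div, div_le_iff₀ hp]
        gcongr
  obtain ⟨ε, he, h⟩ := key
  exact ⟨ε, he, fun x hx => h x hx hx⟩

/-- A Weierstrass-type approximation theorem: if `φ ≤ ψ` are continuous on a compact
`U ⊆ ℝ`, with `φ < ψ` off a finite set, and both are real-analytic at each contact point,
then some polynomial `p` satisfies `φ ≤ p ≤ ψ` on `U`. -/
theorem exists_polynomial_between
    (U : Set ℝ) (hU : IsCompact U)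
    (φ ψ : ℝ → ℝ)
    (hφ : ContinuousOn φ U) (hψ : ContinuousOn ψ U)
    (hle : ∀ x ∈ U, φ x ≤ ψ x)
    (hfin : {x ∈ U | φ x = ψ x}.Finite)
    (hana : ∀ a ∈ U, φ a = ψ a → AnalyticAt ℝ φ a ∧ AnalyticAt ℝ ψ a) :
    ∃ p : Polynomial ℝ, ∀ x ∈ U, φ x ≤ p.eval x ∧ p.eval x ≤ ψ x := by
  classical
  set d : ℝ → ℝ := fun x => (ψ x - φ x) / 2 with hd
  set f : ℝ → ℝ := fun x => (ψ x + φ x) / 2 with hf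
  have hset : {x ∈ U | d x = 0} = {x ∈ U | φ x = ψ x} := by
    ext x
    simp only [hd, Set.mem_setOf_eq]
    refine and_congr_right fun _ => ⟨fun h => by linarith, fun h => by linarith⟩
  have hdan : ∀ a ∈ hfin.toFinset, AnalyticAt ℝ d a := fun a ha => by
    have h := (hfin.mem_toFinset.1 ha)
    obtain ⟨h1, h2⟩ := hana a h.1 h.2
    exact (h2.sub h1).div_const
  have hfan : ∀ a ∈ (hfin.toFinset : Set ℝ), AnalyticAt ℝ f a := fun a ha => by
    have h := (hfin.mem_toFinset.1 ha)
    obtain ⟨h1, h2⟩ := hana a h.1 h.2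
    exact (h2.add h1).div_const
  have h0 : ∀ x ∈ U, 0 ≤ d x := fun x hx => by have := hle x hx; simp only [hd]; linarith
  have hloc : ∀ a : ℝ, ∃ n : ℕ, a ∈ hfin.toFinset →
      ∃ c > 0, ∀ᶠ x in nhds a, x ∈ U → c * |x - a| ^ n ≤ d x := fun a => by
    by_cases ha : a ∈ hfin.toFinset
    · obtain ⟨n, h⟩ := local_lower U d h0 (hset ▸ hfin) a (hdan a ha)
      exact ⟨n, fun _ => h⟩
    · exact ⟨0, fun h => absurd h ha⟩
  choose n hn using hloc
  obtain ⟨ε, he, hε⟩ := global_lower U hU d ((hψ.sub hφ).div_const 2) h0 hfin.toFinset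
    (fun x hx h => hfin.mem_toFinset.2 (hset ▸ (⟨hx, h⟩ : x ∈ {x ∈ U | d x = 0}))) n hn
  obtain ⟨q, g, hg, -, hq⟩ := GoodMod.prod (U := U) (f := f) ((hψ.add hφ).div_const 2) hfan n
    hfin.toFinset (fun b hb => hb)
  set w : ℝ[X] := ∏ b ∈ hfin.toFinset, (X - C b) ^ n b with hw
  obtain ⟨r, hr⟩ := weierstrass_aux U hU g hg ε he
  refine ⟨q + w * r, fun x hx => ?_⟩
  have h1 : |(q + w * r).eval x - f x| ≤ d x := by
    have : (q + w * r).eval x - f x = (r.eval x - g x) * w.eval x := by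
      rw [hq x]; simp only [eval_add, eval_mul]; ring
    rw [this, abs_mul]
    exact (mul_le_mul_of_nonneg_right (hr x hx).le (abs_nonneg _)).trans (hε x hx)
  obtain ⟨h2, h3⟩ := abs_le.1 h1
  simp only [hf, hd] at h2 h3
  constructor <;> linarith
end

section
/- Suppose m ∈ ℕ is even and positive, and q(x) ∈ ℝ[x] has odd degree and satisfies q(x) ≥ 0 on [0,1]. Let K = {(x,y) ∈ ℝ² : 0 ≤ x ≤ 1, y^m ≥ q(x), y ≥ 0}. Then there is no finite set of generators S ⊆ ℝ[x,y] with K_S = K such that the preordering T_S is saturated. -/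
open MvPolynomial

/-- Membership in the preordering generated by a set `G` in a commutative ring:
finite sums `∑ σᵢ·mᵢ` with each `σᵢ` a sum of squares and each `mᵢ` a product of
elements of `G`. -/
def MemPreordering {R : Type*} [CommRing R] (G : Set R) (f : R) : Prop :=
  ∃ (n : ℕ) (σ m : Fin n → R),
    (∀ i, IsSumSq (σ i)) ∧ (∀ i, m i ∈ Submonoid.closure G) ∧ f = ∑ i, σ i * m i

/-- Univariate slices: nonnegative leading coefficient, and degree at most one forces
nonnegativity at `t`. -/
def GoodAt (t : ℝ) (p : Polynomial ℝ) : Prop :=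
  0 ≤ p.leadingCoeff ∧ (p.natDegree ≤ 1 → 0 ≤ p.eval t)

lemma GoodAt.mul {t : ℝ} {p r : Polynomial ℝ} (hp : GoodAt t p) (hr : GoodAt t r) :
    GoodAt t (p * r) := by
  refine ⟨by rw [Polynomial.leadingCoeff_mul]; exact mul_nonneg hp.1 hr.1, fun h => ?_⟩
  by_cases p0 : p = 0
  · simp [p0]
  by_cases r0 : r = 0
  · simp [r0]
  rw [Polynomial.natDegree_mul p0 r0] at h
  rw [Polynomial.eval_mul]
  exact mul_nonneg (hp.2 (by omega)) (hr.2 (by omega))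

lemma natDegree_add_nonneg {p r : Polynomial ℝ} (hp : 0 ≤ p.leadingCoeff)
    (hr : 0 ≤ r.leadingCoeff) (hle : p.natDegree ≤ r.natDegree) :
    0 ≤ (p + r).leadingCoeff ∧ (p + r).natDegree = r.natDegree := by
  by_cases r0 : r = 0
  · subst r0
    simp at hle ⊢
    exact ⟨hp, hle⟩
  have hrpos : 0 < r.leadingCoeff :=
    lt_of_le_of_ne hr (Ne.symm (Polynomial.leadingCoeff_ne_zero.mpr r0))
  have hc : 0 < (p + r).coeff r.natDegree := by
    rw [Polynomial.coeff_add]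
    have : 0 ≤ p.coeff r.natDegree := by
      rcases hle.eq_or_lt with h | h
      · rw [← h]; exact hp
      · rw [Polynomial.coeff_eq_zero_of_natDegree_lt h]
    have h2 : 0 < r.coeff r.natDegree := hrpos
    linarith
  have hd : (p + r).natDegree = r.natDegree := by
    apply le_antisymm
    · exact (Polynomial.natDegree_add_le p r).trans (by simp [hle])
    · exact Polynomial.le_natDegree_of_ne_zero hc.ne'
  refine ⟨?_, hd⟩
  rw [Polynomial.leadingCoeff, hd]
  exact hc.le

lemma GoodAt.add {t : ℝ} {p r : Polynomial ℝ} (hp : GoodAt t p) (hr : GoodAt t r) :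
    GoodAt t (p + r) := by
  wlog hle : p.natDegree ≤ r.natDegree generalizing p r
  · rw [add_comm]; exact this hr hp (by omega)
  obtain ⟨h1, h2⟩ := natDegree_add_nonneg hp.1 hr.1 hle
  refine ⟨h1, fun h => ?_⟩
  rw [Polynomial.eval_add]
  exact add_nonneg (hp.2 (by omega)) (hr.2 (by omega))

lemma GoodAt.zero (t : ℝ) : GoodAt t 0 := by simp [GoodAt]

lemma GoodAt.one (t : ℝ) : GoodAt t 1 := by simp [GoodAt]

lemma GoodAt.sq (t : ℝ) (p : Polynomial ℝ) : GoodAt t (p * p) := by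
  refine ⟨by rw [Polynomial.leadingCoeff_mul]; exact mul_self_nonneg _, fun _ => ?_⟩
  rw [Polynomial.eval_mul]; exact mul_self_nonneg _

lemma GoodAt.of_mem {t : ℝ} {R : Type*} [CommRing R] (φ : R →+* Polynomial ℝ) (G : Set R)
    (hG : ∀ g ∈ G, GoodAt t (φ g)) {f : R} (hf : MemPreordering G f) : GoodAt t (φ f) := by
  obtain ⟨n, σ, m, hσ, hm, rfl⟩ := hf
  rw [map_sum]
  refine Finset.sum_induction _ (GoodAt t) (fun _ _ => GoodAt.add) (GoodAt.zero t) ?_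
  intro i _
  rw [map_mul]
  refine GoodAt.mul ?_ ?_
  · have hs := hσ i
    generalize σ i = s at hs
    induction hs with
    | zero => simpa using GoodAt.zero t
    | sq_add a _ ih => rw [map_add, map_mul]; exact (GoodAt.sq t _).add ih
  · refine Submonoid.closure_induction (motive := fun x _ => GoodAt t (φ x)) hG ?_ ?_ (hm i)
    · simpa using GoodAt.one t
    · intro x y _ _ hx hy
      rw [map_mul]; exact hx.mul hy

/-- A polynomial nonnegative on a half-line has nonnegative leading coefficient. -/
lemma leadingCoeff_nonneg_of_halfline {p : Polynomial ℝ} {c : ℝ}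
    (h : ∀ y, c ≤ y → 0 ≤ p.eval y) : 0 ≤ p.leadingCoeff := by
  by_contra! hl
  by_cases hd : 0 < p.degree
  · have ht := Polynomial.tendsto_atBot_of_leadingCoeff_nonpos p hd hl.le
    obtain ⟨y, hy1, hy2⟩ := ((ht.eventually (Filter.eventually_lt_atBot 0)).and
      (Filter.eventually_ge_atTop c)).exists
    exact absurd (h y hy2) (not_le.mpr hy1)
  · have hc := Polynomial.eq_C_of_degree_le_zero (not_lt.mp hd)
    have := h c le_rfl
    rw [hc] at this hl
    simp at this hl
    linarith

/-- View `g(x,y)` as a polynomial in `y` over `ℝ[x]`. -/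
noncomputable def toYX : MvPolynomial (Fin 2) ℝ →ₐ[ℝ] Polynomial (Polynomial ℝ) :=
  MvPolynomial.aeval ![Polynomial.C Polynomial.X, Polynomial.X]

/-- Restrict `g(x,y)` to the line `x = x₀`. -/
noncomputable def sliceAt (x₀ : ℝ) : MvPolynomial (Fin 2) ℝ →+* Polynomial ℝ :=
  (Polynomial.mapRingHom (Polynomial.evalRingHom x₀)).comp toYX.toRingHom

lemma sliceAt_apply (x₀ : ℝ) (g : MvPolynomial (Fin 2) ℝ) :
    sliceAt x₀ g = (toYX g).map (Polynomial.evalRingHom x₀) := rfl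

lemma eval_sliceAt (x₀ y : ℝ) (g : MvPolynomial (Fin 2) ℝ) :
    (sliceAt x₀ g).eval y = eval ![x₀, y] g := by
  have : (Polynomial.evalRingHom y).comp (sliceAt x₀) = (eval ![x₀, y]) := by
    apply MvPolynomial.ringHom_ext
    · intro r
      simp [sliceAt_apply, toYX, Polynomial.algebraMap_apply]
    · intro i
      fin_cases i <;> simp [sliceAt_apply, toYX]
  exact congrArg (fun F => F g) this

/-- The parity argument. -/
lemma curve_ne_zero {m : ℕ} (hm : Even m) (hm0 : 0 < m) {q a : Polynomial ℝ}
    (hq : Odd q.natDegree) (ha : a ≠ 0) (b : Polynomial ℝ) : a ^ m * q - b ^ m ≠ 0 := by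
  intro h
  have h1 := congrArg Polynomial.natDegree (sub_eq_zero.mp h)
  have q0 : q ≠ 0 := by rintro rfl; simp at hq
  rw [Polynomial.natDegree_mul (pow_ne_zero _ ha) q0, Polynomial.natDegree_pow,
    Polynomial.natDegree_pow] at h1
  have e1 : Even (m * a.natDegree) := hm.mul_right _
  have e2 : Even (m * b.natDegree) := hm.mul_right _
  rw [← h1] at e2
  exact (Nat.not_even_iff_odd.mpr (e1.add_odd hq)) e2

/-- For each `P`, outside finitely many `x`, the slice has degree `≠ 1` or does not vanish on the
boundary curve. -/
lemma bad_finite {m : ℕ} (hm : Even m) (hm0 : 0 < m) {q : Polynomial ℝ}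
    (hq : Odd q.natDegree) (P : Polynomial (Polynomial ℝ)) :
    ∃ Z : Finset ℝ, ∀ x ∉ Z, ∀ h : ℝ, h ^ m = q.eval x →
      (P.map (Polynomial.evalRingHom x)).natDegree = 1 →
      (P.map (Polynomial.evalRingHom x)).eval h ≠ 0 := by
  by_cases hP : P.natDegree = 1
  · have hlc : P.coeff 1 ≠ 0 := by
      rw [← hP]
      exact Polynomial.leadingCoeff_ne_zero.mpr (by rintro rfl; simp at hP)
    refine ⟨((P.coeff 1) ^ m * q - (P.coeff 0) ^ m).roots.toFinset, fun x hx h hh _ h0 => hx ?_⟩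
    rw [Multiset.mem_toFinset, Polynomial.mem_roots (curve_ne_zero hm hm0 hq hlc _)]
    rw [Polynomial.eq_X_add_C_of_natDegree_le_one hP.le] at h0
    simp at h0
    have : (P.coeff 0).eval x = - ((P.coeff 1).eval x * h) := by linarith
    simp [Polynomial.IsRoot, this, hm.neg_pow, mul_pow, hh]
  · by_cases P0 : P = 0
    · exact ⟨∅, fun x _ h _ h1 => by simp [P0] at h1⟩
    refine ⟨P.leadingCoeff.roots.toFinset, fun x hx h _ h1 => absurd h1 ?_⟩
    rw [Polynomial.natDegree_map_of_leadingCoeff_ne_zero]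
    · exact hP
    · intro h2
      exact hx (by
        rw [Multiset.mem_toFinset, Polynomial.mem_roots (Polynomial.leadingCoeff_ne_zero.mpr P0)]
        exact h2)

/-- Let `m` be even and positive and `q ∈ ℝ[x]` of odd degree with `q ≥ 0` on `[0,1]`.
For `K = {(x,y) : 0 ≤ x ≤ 1, y^m ≥ q(x), y ≥ 0}`, there is no finite set of generators
`S ⊆ ℝ[x,y]` with `K_S = K` whose preordering `T_S` is saturated.
Here `x = X 0`, `y = X 1`. -/
theorem no_saturated_preordering_halfstrip_cut
    (m : ℕ) (hm : Even m) (hm0 : 0 < m)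
    (q : Polynomial ℝ) (hqdeg : Odd q.natDegree)
    (hq : ∀ x ∈ Set.Icc (0 : ℝ) 1, 0 ≤ q.eval x)
    (K : Set (Fin 2 → ℝ))
    (hK : K = {p | 0 ≤ p 0 ∧ p 0 ≤ 1 ∧ q.eval (p 0) ≤ p 1 ^ m ∧ 0 ≤ p 1}) :
    ¬ ∃ S : Finset (MvPolynomial (Fin 2) ℝ),
        {p : Fin 2 → ℝ | ∀ g ∈ S, 0 ≤ eval p g} = K ∧
        ∀ f : MvPolynomial (Fin 2) ℝ,
          (∀ p ∈ K, 0 ≤ eval p f) → MemPreordering (↑S) f := by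
  rintro ⟨S, hS, hsat⟩
  subst hK
  have hm0' : m ≠ 0 := hm0.ne'
  set h : ℝ → ℝ := fun x => (q.eval x) ^ ((m : ℝ)⁻¹) with hdef
  have hpow : ∀ x ∈ Set.Icc (0 : ℝ) 1, h x ^ m = q.eval x := fun x hx =>
    Real.rpow_inv_natCast_pow (hq x hx) hm0'
  have hnn : ∀ x ∈ Set.Icc (0 : ℝ) 1, 0 ≤ h x := fun x hx => Real.rpow_nonneg (hq x hx) _
  have hcont : ContinuousOn h (Set.Icc 0 1) := by
    refine Continuous.continuousOn ?_
    exact Continuous.rpow_const q.continuous (fun x => Or.inr (by positivity))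
  -- choose the point
  choose Z hZ using fun g : MvPolynomial (Fin 2) ℝ => bad_finite hm hm0 hqdeg (toYX g)
  obtain ⟨x₀, hx₀, hx₀Z⟩ : ∃ x ∈ Set.Icc (0 : ℝ) 1, x ∉ S.biUnion Z := by
    obtain ⟨x, hx, hx'⟩ := (Set.Icc_infinite (zero_lt_one (α := ℝ))).exists_notMem_finset
      (S.biUnion Z)
    exact ⟨x, hx, hx'⟩
  have hslice : ∀ g ∈ S, ∀ y, h x₀ ≤ y → 0 ≤ (sliceAt x₀ g).eval y := by
    intro g hg y hy
    rw [eval_sliceAt]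
    have hmem : (![x₀, y] : Fin 2 → ℝ) ∈ {p : Fin 2 → ℝ | ∀ g ∈ S, 0 ≤ eval p g} := by
      rw [hS]
      refine ⟨hx₀.1, hx₀.2, ?_, (hnn x₀ hx₀).trans hy⟩
      simp only [Matrix.cons_val_zero, Matrix.cons_val_one]
      rw [← hpow x₀ hx₀]
      exact pow_le_pow_left₀ (hnn x₀ hx₀) hy m
    exact hmem g hg
  have hev : ∀ᶠ t in nhds (h x₀), ∀ g ∈ S, GoodAt t (sliceAt x₀ g) := by
    rw [Filter.eventually_all_finset]
    intro g hg
    have hl := leadingCoeff_nonneg_of_halfline (hslice g hg)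
    by_cases hd : (sliceAt x₀ g).natDegree = 1
    · have hne := hZ g x₀ (fun hz => hx₀Z (Finset.mem_biUnion.mpr ⟨g, hg, hz⟩)) (h x₀)
        (hpow x₀ hx₀) hd
      have hpos : 0 < (sliceAt x₀ g).eval (h x₀) :=
        lt_of_le_of_ne (hslice g hg _ le_rfl) (Ne.symm hne)
      filter_upwards [(sliceAt x₀ g).continuous.continuousAt.eventually (lt_mem_nhds hpos)]
        with t ht
      exact ⟨hl, fun _ => ht.le⟩
    · refine Filter.Eventually.of_forall fun t => ⟨hl, fun hd1 => ?_⟩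
      have hc := Polynomial.eq_C_of_natDegree_eq_zero (p := sliceAt x₀ g) (by omega)
      have := hslice g hg _ le_rfl
      rw [hc] at this ⊢
      simpa using this
  obtain ⟨ε, hε, hball⟩ := Metric.eventually_nhds_iff.mp hev
  have hgood := @hball (h x₀ - ε / 2) (by
    rw [Real.dist_eq, show h x₀ - ε / 2 - h x₀ = -(ε / 2) by ring, abs_neg,
      abs_of_pos (by linarith)]
    linarith)
  -- approximate the curve from below
  obtain ⟨r, hr⟩ := exists_polynomial_near_of_continuousOn 0 1 (fun x => h x - ε / 5)
    (hcont.sub continuousOn_const) (ε / 5) (by linarith)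
  have hmem := hsat (X 1 - Polynomial.aeval (X 0) r) (by
    rintro p ⟨hp0, hp1, hp2, hp3⟩
    have hx : p 0 ∈ Set.Icc (0 : ℝ) 1 := ⟨hp0, hp1⟩
    have h1 := abs_lt.mp (hr (p 0) hx)
    have h2 : h (p 0) ≤ p 1 := by
      rw [← hpow _ hx] at hp2
      exact le_of_pow_le_pow_left₀ hm0' hp3 hp2
    have h3 : eval p (Polynomial.aeval (X 0) r) = r.eval (p 0) := by
      rw [← MvPolynomial.coe_aeval_eq_eval, RingHom.coe_coe, ← Polynomial.aeval_algHom_apply]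
      simp
    rw [map_sub, h3, eval_X]
    linarith [h1.2])
  have hG := GoodAt.of_mem (sliceAt x₀) _ hgood hmem
  have hsl : sliceAt x₀ (X 1 - Polynomial.aeval (X 0) r) =
      Polynomial.X - Polynomial.C (r.eval x₀) := by
    apply Polynomial.funext
    intro y
    rw [eval_sliceAt]
    have h3 : eval ![x₀, y] (Polynomial.aeval (X 0) r) = r.eval x₀ := by
      rw [← MvPolynomial.coe_aeval_eq_eval, RingHom.coe_coe, ← Polynomial.aeval_algHom_apply]
      simp
    rw [map_sub, h3]
    simp
  rw [hsl] at hG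
  have h4 := hG.2 (by rw [Polynomial.natDegree_X_sub_C])
  have h5 := (abs_lt.mp (hr x₀ hx₀)).1
  simp at h4
  linarith
end

section
/- Let K = {(x,y) ∈ ℝ² : 0 ≤ x ≤ 1, y² ≥ x, y ≥ 0} (the half-strip [0,1] × ℝ⁺ cut by the parabola y² = x, which is the semialgebraic set of S = {x − x², y² − x, y}). Then there is no finite set of generators S ⊆ ℝ[x,y] with K_S = K such that the preordering T_S is saturated. -/
open MvPolynomial

/-- Restriction to the vertical line `x = c`. -/
noncomputable def fiberMap (c : ℝ) : MvPolynomial (Fin 2) ℝ →ₐ[ℝ] Polynomial ℝ :=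
  MvPolynomial.aeval ![Polynomial.C c, Polynomial.X]

/-- View a bivariate polynomial as a polynomial in `y` over `ℝ[x]`. -/
noncomputable def asPolyY : MvPolynomial (Fin 2) ℝ →ₐ[ℝ] Polynomial (Polynomial ℝ) :=
  MvPolynomial.aeval ![Polynomial.C Polynomial.X, Polynomial.X]

lemma eval_fiberMap (c y : ℝ) (g : MvPolynomial (Fin 2) ℝ) :
    (fiberMap c g).eval y = eval ![c, y] g := by
  have h : ((Polynomial.evalRingHom y).comp (fiberMap c).toRingHom)
      = (eval ![c, y] : MvPolynomial (Fin 2) ℝ →+* ℝ) := by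
    apply MvPolynomial.ringHom_ext
    · intro r
      simp [fiberMap]
    · intro i
      fin_cases i <;> simp [fiberMap]
  exact congrArg (fun φ : MvPolynomial (Fin 2) ℝ →+* ℝ => φ g) h

lemma map_asPolyY (c : ℝ) (g : MvPolynomial (Fin 2) ℝ) :
    (asPolyY g).map (Polynomial.evalRingHom c) = fiberMap c g := by
  have h : ((Polynomial.mapRingHom (Polynomial.evalRingHom c)).comp asPolyY.toRingHom)
      = (fiberMap c).toRingHom := by
    apply MvPolynomial.ringHom_ext
    · intro r
      simp [fiberMap, asPolyY, Polynomial.algebraMap_apply]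
    · intro i
      fin_cases i <;> simp [fiberMap, asPolyY]
  exact congrArg (fun φ : MvPolynomial (Fin 2) ℝ →+* Polynomial ℝ => φ g) h

lemma term_shape (b : ℝ) (t : Polynomial ℝ)
    (h : ∀ y, b ≤ y → 0 ≤ t.eval y ∧ t.eval y ≤ y - b) :
    ∃ l : ℝ, t = Polynomial.C l * (Polynomial.X - Polynomial.C b) := by
  have hd : t.degree ≤ (Polynomial.X - Polynomial.C b : Polynomial ℝ).degree := by
    by_contra hlt
    have ht := Polynomial.abs_div_tendsto_atTop_atTop_of_degree_gt t _ (not_le.1 hlt)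
      (Polynomial.X_sub_C_ne_zero b)
    obtain ⟨y, hy2, hy⟩ := ((ht.eventually_ge_atTop 2).and (Filter.eventually_gt_atTop b)).exists
    obtain ⟨h1, h2⟩ := h y hy.le
    simp only [Polynomial.eval_sub, Polynomial.eval_X, Polynomial.eval_C] at hy2
    have hyb : 0 < y - b := by linarith
    rw [abs_of_nonneg (div_nonneg h1 hyb.le), le_div_iff₀ hyb] at hy2
    linarith
  have hb : t.IsRoot b := by
    have := h b le_rfl
    show t.eval b = 0
    linarith [this.1, this.2]
  obtain ⟨q, hq⟩ := Polynomial.dvd_iff_isRoot.2 hb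
  rw [Polynomial.degree_X_sub_C] at hd
  have hq0 : q.degree ≤ 0 := by
    by_cases h0 : q = 0
    · simp [h0]
    · have hn : t.natDegree ≤ 1 := Polynomial.natDegree_le_of_degree_le hd
      rw [hq, Polynomial.natDegree_mul (Polynomial.X_sub_C_ne_zero b) h0,
        Polynomial.natDegree_X_sub_C] at hn
      exact Polynomial.natDegree_eq_zero_iff_degree_le_zero.1 (by omega)
  refine ⟨q.coeff 0, ?_⟩
  rw [← Polynomial.eq_C_of_degree_le_zero hq0, hq, mul_comm]

lemma exists_dvd_of_closure (φ : MvPolynomial (Fin 2) ℝ →+* Polynomial ℝ)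
    (S : Set (MvPolynomial (Fin 2) ℝ)) (p : Polynomial ℝ) (hp : Prime p)
    (m : MvPolynomial (Fin 2) ℝ) (hm : m ∈ Submonoid.closure S) :
    p ∣ φ m → ∃ g ∈ S, p ∣ φ g ∧ φ g ∣ φ m := by
  induction hm using Submonoid.closure_induction with
  | mem x hx => exact fun h => ⟨x, hx, h, dvd_rfl⟩
  | one =>
    intro h
    rw [map_one] at h
    exact absurd (isUnit_of_dvd_one h) hp.not_isUnit
  | mul x y _ _ ihx ihy =>
    intro h
    rw [map_mul] at h ⊢
    rcases hp.dvd_or_dvd h with h | h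
    · obtain ⟨g, hg, h1, h2⟩ := ihx h
      exact ⟨g, hg, h1, h2.mul_right _⟩
    · obtain ⟨g, hg, h1, h2⟩ := ihy h
      exact ⟨g, hg, h1, h2.mul_left _⟩

/-- The tangent-type minorant of the square root. -/
lemma minorant (b u y : ℝ) (hb : 0 < b) (hu : 0 ≤ u) (hy : 0 ≤ y) (h : u ≤ y ^ 2) :
    0 ≤ y - (b + (u - b ^ 2) / (2 * b) - (u - b ^ 2) ^ 2 / (2 * b ^ 3)) := by
  have hs := Real.sq_sqrt hu
  have hs0 := Real.sqrt_nonneg u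
  have hsy : √u ≤ y := Real.sqrt_le_iff.2 ⟨hy, h⟩
  generalize √u = v at *
  subst hs
  have e : v - (b + (v ^ 2 - b ^ 2) / (2 * b) - (v ^ 2 - b ^ 2) ^ 2 / (2 * b ^ 3))
      = (v - b) ^ 2 * (v ^ 2 + 2 * v * b) / (2 * b ^ 3) := by
    field_simp
    ring
  have : 0 ≤ (v - b) ^ 2 * (v ^ 2 + 2 * v * b) / (2 * b ^ 3) := by positivity
  linarith

lemma fiber_generator (S : Finset (MvPolynomial (Fin 2) ℝ))
    (hS : ∀ p : Fin 2 → ℝ, 0 ≤ p 0 → p 0 ≤ 1 → p 0 ≤ p 1 ^ 2 → 0 ≤ p 1 → ∀ g ∈ S, 0 ≤ eval p g)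
    (hsat : ∀ f : MvPolynomial (Fin 2) ℝ,
      (∀ p : Fin 2 → ℝ, 0 ≤ p 0 → p 0 ≤ 1 → p 0 ≤ p 1 ^ 2 → 0 ≤ p 1 → 0 ≤ eval p f) →
        MemPreordering (↑S) f)
    (b : ℝ) (hb0 : 0 < b) (hb1 : b < 1) :
    ∃ g ∈ S, fiberMap (b ^ 2) g ≠ 0 ∧ (fiberMap (b ^ 2) g).natDegree ≤ 1 ∧
      (fiberMap (b ^ 2) g).eval b = 0 := by
  obtain ⟨n, σ, m, hσ, hm, hf⟩ := hsat
    (X 1 - (C b + C (1 / (2 * b)) * (X 0 - C (b ^ 2))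
      - C (1 / (2 * b ^ 3)) * (X 0 - C (b ^ 2)) ^ 2)) (by
      intro p h0 _ h1 h2
      have := minorant b (p 0) (p 1) hb0 h0 h2 h1
      simp only [map_sub, map_add, map_mul, map_pow, eval_X, eval_C]
      convert this using 1
      ring)
  have hf' := congrArg (fiberMap (b ^ 2)) hf
  have hl : fiberMap (b ^ 2) (X 1 - (C b + C (1 / (2 * b)) * (X 0 - C (b ^ 2))
      - C (1 / (2 * b ^ 3)) * (X 0 - C (b ^ 2)) ^ 2)) = Polynomial.X - Polynomial.C b := by
    apply Polynomial.funext
    intro y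
    rw [eval_fiberMap]
    simp
  rw [hl, map_sum] at hf'
  have hσ0 : ∀ i y, 0 ≤ (fiberMap (b ^ 2) (σ i)).eval y := by
    intro i y
    rw [eval_fiberMap]
    have := hσ i
    generalize σ i = s at this
    induction this with
    | zero => simp
    | sq_add a _ ih =>
      rw [map_add, map_mul]
      exact add_nonneg (mul_self_nonneg _) ih
  have hm0 : ∀ i y, b ≤ y → 0 ≤ (fiberMap (b ^ 2) (m i)).eval y := by
    intro i y hy
    rw [eval_fiberMap]
    have := hm i
    generalize m i = s at this
    induction this using Submonoid.closure_induction with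
    | mem x hx =>
      refine hS _ ?_ ?_ ?_ ?_ x hx <;> simp [-sq_le_one_iff_abs_le_one, -sq_le_sq₀] <;> nlinarith
    | one => simp
    | mul x z _ _ ihx ihz =>
      rw [map_mul]
      exact mul_nonneg ihx ihz
  have hterm : ∀ i y, b ≤ y → 0 ≤ (fiberMap (b ^ 2) (σ i * m i)).eval y := by
    intro i y hy
    rw [map_mul, Polynomial.eval_mul]
    exact mul_nonneg (hσ0 i y) (hm0 i y hy)
  have hshape : ∀ i, ∃ l : ℝ, fiberMap (b ^ 2) (σ i * m i)
      = Polynomial.C l * (Polynomial.X - Polynomial.C b) := by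
    intro i
    apply term_shape
    intro y hy
    refine ⟨hterm i y hy, ?_⟩
    have := congrArg (Polynomial.eval y) hf'
    rw [Polynomial.eval_finsetSum] at this
    simp only [Polynomial.eval_sub, Polynomial.eval_X, Polynomial.eval_C] at this
    rw [this]
    exact Finset.single_le_sum (f := fun i => (fiberMap (b ^ 2) (σ i * m i)).eval y)
      (fun j _ => hterm j y hy) (Finset.mem_univ i)
  have hex : ∃ i, fiberMap (b ^ 2) (σ i * m i) ≠ 0 := by
    by_contra hcon
    push Not at hcon
    rw [Finset.sum_eq_zero (fun i _ => hcon i)] at hf'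
    exact Polynomial.X_sub_C_ne_zero b hf'
  obtain ⟨i, hi⟩ := hex
  obtain ⟨l, hl⟩ := hshape i
  have hl0 : l ≠ 0 := by
    rintro rfl
    simp [hl] at hi
  have hdeg : (fiberMap (b ^ 2) (σ i * m i)).natDegree = 1 := by
    rw [hl, Polynomial.natDegree_C_mul hl0, Polynomial.natDegree_X_sub_C]
  have hprime := Polynomial.prime_X_sub_C b
  have hdm : (Polynomial.X - Polynomial.C b) ∣ fiberMap (b ^ 2) (m i) := by
    have hdvd : (Polynomial.X - Polynomial.C b) ∣ fiberMap (b ^ 2) (σ i) * fiberMap (b ^ 2) (m i) := by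
      rw [← map_mul, hl]
      exact dvd_mul_left _ _
    rcases hprime.dvd_or_dvd hdvd with h | h
    · exfalso
      obtain ⟨q, hq⟩ := h
      have h3 : Polynomial.C l = q * fiberMap (b ^ 2) (m i) := by
        apply mul_right_cancel₀ (Polynomial.X_sub_C_ne_zero b)
        rw [← hl, map_mul, hq]
        ring
      have hqu : IsUnit q := isUnit_of_mul_isUnit_left
        (h3 ▸ Polynomial.isUnit_C.2 (isUnit_iff_ne_zero.2 hl0))
      obtain ⟨r, hr, rfl⟩ := Polynomial.isUnit_iff.1 hqu
      have e1 := hσ0 i (b + 1)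
      have e2 := hσ0 i (b - 1)
      simp [hq] at e1 e2
      exact hr.ne_zero (le_antisymm e2 e1)
    · exact h
  obtain ⟨g, hg, h1, h2⟩ := exists_dvd_of_closure (fiberMap (b ^ 2)).toRingHom S _ hprime _ (hm i) hdm
  have h2' : fiberMap (b ^ 2) g ∣ fiberMap (b ^ 2) (σ i * m i) := by
    rw [map_mul]
    exact Dvd.dvd.mul_left h2 _
  refine ⟨g, hg, ?_, ?_, ?_⟩
  · intro h0
    rw [h0] at h2'
    exact hi (zero_dvd_iff.1 h2')
  · rw [← hdeg]
    exact Polynomial.natDegree_le_of_dvd h2' hi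
  · exact Polynomial.dvd_iff_isRoot.1 h1

lemma finite_of_generator (g : MvPolynomial (Fin 2) ℝ) :
    {b : ℝ | 0 < b ∧ fiberMap (b ^ 2) g ≠ 0 ∧ (fiberMap (b ^ 2) g).natDegree ≤ 1 ∧
      (fiberMap (b ^ 2) g).eval b = 0}.Finite := by
  by_contra hinf
  set B := {b : ℝ | 0 < b ∧ fiberMap (b ^ 2) g ≠ 0 ∧ (fiberMap (b ^ 2) g).natDegree ≤ 1 ∧
      (fiberMap (b ^ 2) g).eval b = 0} with hB
  have hinf : B.Infinite := hinf
  have hinj : Set.InjOn (fun b : ℝ => b ^ 2) B := by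
    intro x hx y hy hxy
    exact (pow_left_inj₀ hx.1.le hy.1.le two_ne_zero).1 hxy
  have hinf2 := hinf.image hinj
  have hcoeff : ∀ b j, (fiberMap (b ^ 2) g).coeff j = ((asPolyY g).coeff j).eval (b ^ 2) := by
    intro b j
    rw [← map_asPolyY, Polynomial.coeff_map]
    rfl
  have hvan : ∀ P : Polynomial ℝ, (∀ b ∈ B, P.eval (b ^ 2) = 0) → P = 0 := by
    intro P hP
    apply Polynomial.eq_zero_of_infinite_isRoot
    refine hinf2.mono ?_
    rintro _ ⟨b, hb, rfl⟩
    exact hP b hb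
  have hhigh : ∀ j, 2 ≤ j → (asPolyY g).coeff j = 0 := by
    intro j hj
    apply hvan
    intro b hb
    rw [← hcoeff]
    exact Polynomial.coeff_eq_zero_of_natDegree_lt (lt_of_le_of_lt hb.2.2.1 (by omega))
  have hrel : (asPolyY g).coeff 0 ^ 2 = Polynomial.X * (asPolyY g).coeff 1 ^ 2 := by
    rw [← sub_eq_zero]
    apply hvan
    intro b hb
    have h1 := Polynomial.eq_X_add_C_of_natDegree_le_one hb.2.2.1
    have h2 := hb.2.2.2
    rw [h1] at h2
    simp only [hcoeff, Polynomial.eval_add, Polynomial.eval_mul, Polynomial.eval_C,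
      Polynomial.eval_X] at h2
    simp only [Polynomial.eval_sub, Polynomial.eval_mul, Polynomial.eval_pow, Polynomial.eval_X]
    linear_combination (((asPolyY g).coeff 0).eval (b ^ 2) - ((asPolyY g).coeff 1).eval (b ^ 2) * b) * h2
  have ha1 : (asPolyY g).coeff 1 = 0 := by
    by_contra hne
    have := congrArg Polynomial.natDegree hrel
    rw [Polynomial.natDegree_mul Polynomial.X_ne_zero (pow_ne_zero 2 hne), Polynomial.natDegree_pow,
      Polynomial.natDegree_pow, Polynomial.natDegree_X] at this
    omega
  have ha0 : (asPolyY g).coeff 0 = 0 := by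
    rw [ha1] at hrel
    simpa using hrel
  have hz : asPolyY g = 0 := by
    ext1 j
    rcases j with _ | _ | j
    · simpa using ha0
    · simpa using ha1
    · simpa using hhigh (j + 2) (by omega)
  obtain ⟨b, hb⟩ := hinf.nonempty
  apply hb.2.1
  rw [← map_asPolyY, hz, Polynomial.map_zero]

/-- For the half-strip `K = {(x,y) : 0 ≤ x ≤ 1, y² ≥ x, y ≥ 0}` (the set `[0,1] × ℝ⁺` cut
by the parabola `y² = x`), there is no finite set of generators `S ⊆ ℝ[x,y]` with
`K_S = K` whose preordering `T_S` is saturated. Here `x = X 0`, `y = X 1`. -/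
theorem no_saturated_preordering_parabola_halfstrip
    (K : Set (Fin 2 → ℝ))
    (hK : K = {p | 0 ≤ p 0 ∧ p 0 ≤ 1 ∧ p 0 ≤ p 1 ^ 2 ∧ 0 ≤ p 1}) :
    ¬ ∃ S : Finset (MvPolynomial (Fin 2) ℝ),
        {p : Fin 2 → ℝ | ∀ g ∈ S, 0 ≤ eval p g} = K ∧
        ∀ f : MvPolynomial (Fin 2) ℝ,
          (∀ p ∈ K, 0 ≤ eval p f) → MemPreordering (↑S) f := by
  rintro ⟨S, hSK, hsat⟩
  have hfin := S.finite_toSet.biUnion (fun g _ => finite_of_generator g)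
  refine (Set.Ioo_infinite (zero_lt_one (α := ℝ))) (hfin.subset ?_)
  intro b hb
  obtain ⟨g, hg, h⟩ := fiber_generator S
    (by
      intro p h0 h1 h2 h3
      have : p ∈ K := by
        rw [hK]
        exact ⟨h0, h1, h2, h3⟩
      rw [← hSK] at this
      exact this)
    (by
      intro f hf
      apply hsat
      intro p hp
      rw [hK] at hp
      exact hf p hp.1 hp.2.1 hp.2.2.1 hp.2.2.2)
    b hb.1 hb.2
  exact Set.mem_biUnion hg ⟨hb.1, h⟩
end

section
/- Let σ ∈ ℝ[x,y] be a finite sum of squares of polynomials and let r ∈ ℝ. If σ(r,y) = 0 for all y ∈ ℝ, then (x − r)² divides σ(x,y) in ℝ[x,y]. -/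
open MvPolynomial

lemma dvd_of_vanishes_on_line (p : MvPolynomial (Fin 2) ℝ) (r : ℝ)
    (h : ∀ y : ℝ, eval ![r, y] p = 0) : (X 0 - C r) ∣ p := by
  have h0 : aeval (![C r, X 1] : Fin 2 → MvPolynomial (Fin 2) ℝ) p = 0 := by
    apply MvPolynomial.funext
    intro v
    have key : ((aeval v).comp (aeval (![C r, X 1] : Fin 2 → MvPolynomial (Fin 2) ℝ)) :
        MvPolynomial (Fin 2) ℝ →ₐ[ℝ] ℝ) = aeval ![r, v 1] := by
      apply MvPolynomial.algHom_ext
      intro i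
      fin_cases i <;> simp
    have := DFunLike.congr_fun key p
    simp only [AlgHom.comp_apply, aeval_eq_eval, RingHom.coe_coe] at this
    rw [map_zero, ← h (v 1)]
    simpa [aeval_eq_eval] using this
  have key : (Ideal.Quotient.mkₐ ℝ (Ideal.span {(X 0 - C r : MvPolynomial (Fin 2) ℝ)})).comp
      (aeval (![C r, X 1] : Fin 2 → MvPolynomial (Fin 2) ℝ)) =
      Ideal.Quotient.mkₐ ℝ (Ideal.span {(X 0 - C r : MvPolynomial (Fin 2) ℝ)}) := by
    apply MvPolynomial.algHom_ext
    intro i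
    fin_cases i
    · simp only [AlgHom.comp_apply, aeval_X, Ideal.Quotient.mkₐ_eq_mk]
      symm
      exact Ideal.Quotient.eq.2 (Ideal.mem_span_singleton_self _)
    · simp
  have := DFunLike.congr_fun key p
  rw [AlgHom.comp_apply, h0, map_zero] at this
  exact Ideal.mem_span_singleton.1 (Ideal.Quotient.eq_zero_iff_mem.1 this.symm)

lemma eval_nonneg_of_isSumSq (σ : MvPolynomial (Fin 2) ℝ) (hσ : IsSumSq σ) (v : Fin 2 → ℝ) :
    0 ≤ eval v σ := by
  induction hσ with
  | zero => simp
  | sq_add a _ ih =>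
    rw [map_add, map_mul]
    exact add_nonneg (mul_self_nonneg _) ih

/-- If a sum of squares `σ ∈ ℝ[x,y]` vanishes identically on the line `x = r`,
then `(x - r)²` divides `σ`. Here `x = X 0`, `y = X 1`. -/
theorem sq_dvd_of_sumSq_vanishes_on_line
    (σ : MvPolynomial (Fin 2) ℝ) (hσ : IsSumSq σ) (r : ℝ)
    (hvanish : ∀ y : ℝ, eval ![r, y] σ = 0) :
    (X 0 - C r) ^ 2 ∣ σ := by
  induction hσ with
  | zero => exact dvd_zero _
  | sq_add a hs ih =>
    have h1 := fun y => eval_nonneg_of_isSumSq _ hs ![r, y]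
    simp only [map_add, map_mul] at hvanish
    refine dvd_add ?_ (ih fun y => ?_)
    · have := dvd_of_vanishes_on_line a r fun y => by
        have := hvanish y
        have := h1 y
        exact mul_self_eq_zero.1 (by nlinarith [mul_self_nonneg (eval ![r, y] a)])
      rw [pow_two]
      exact mul_dvd_mul this this
    · have := hvanish y
      have := h1 y
      nlinarith [mul_self_nonneg (eval ![r, y] a)]
end
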